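/- arXiv:1404.6920 — 5 statements merged into one kernel-verified Lean document; each statement's English description precedes it below -/
import Mathlib

section
/- Let a be any real number in the interval (0, c/r_min]. Then the packing measure of E satisfies P^s(E) = max{ h(x,d) : x ∈ E, 0 < d ≤ a } = max{ h(x,d) : x ∈ E, a·r_min ≤ d ≤ a }, and in particular both maxima are attained. -/
open Metric Set MeasureTheory Filter Topology
open scoped ENNReal NNReal

noncomputable section

/-- `P^s_δ(A)`: the supremum of `∑ᵢ |Bᵢ|^s` over all `δ`-packings of `A`, i.e. countable
collections of pairwise disjoint closed balls centered at points of `A` with diameters `≤ δ`.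
(Finite packings are represented by padding with empty balls of negative radius, which
contribute `0` to the sum.) -/
def packPre {X : Type*} [PseudoMetricSpace X] (s δ : ℝ) (A : Set X) : ℝ≥0∞ :=
  ⨆ (cen : ℕ → X) (rad : ℕ → ℝ) (_ : ∀ i, cen i ∈ A)
    (_ : ∀ i, Metric.diam (Metric.closedBall (cen i) (rad i)) ≤ δ)
    (_ : Pairwise fun i j =>
      Disjoint (Metric.closedBall (cen i) (rad i)) (Metric.closedBall (cen j) (rad j))),
    ∑' i, ENNReal.ofReal (Metric.diam (Metric.closedBall (cen i) (rad i)) ^ s)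

/-- The packing premeasure `P₀^s(A) = lim_{δ→0} P^s_δ(A)`; since `δ ↦ P^s_δ(A)` is
nondecreasing, the limit is the infimum over `δ > 0`. -/
def packPre0 {X : Type*} [PseudoMetricSpace X] (s : ℝ) (A : Set X) : ℝ≥0∞ :=
  ⨅ (δ : ℝ) (_ : 0 < δ), packPre s δ A

/-- The packing measure `P^s(A) = inf { ∑ᵢ P₀^s(Uᵢ) : A ⊆ ⋃ᵢ Uᵢ }`. -/
def packM {X : Type*} [PseudoMetricSpace X] (s : ℝ) (A : Set X) : ℝ≥0∞ :=
  ⨅ (U : ℕ → Set X) (_ : A ⊆ ⋃ i, U i), ∑' i, packPre0 s (U i)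

/-- The density function `h(x,d) = (2d)^s / μ(B(x,d))` (closed ball). -/
def densityh {X : Type*} [PseudoMetricSpace X] [MeasurableSpace X]
    (μ : MeasureTheory.Measure X) (s : ℝ) (x : X) (d : ℝ) : ℝ≥0∞ :=
  ENNReal.ofReal ((2 * d) ^ s) / μ (Metric.closedBall x d)

/-- The discrete density function `h_k(x,d) = (2d)^s / μ_k(B'(x,d))` (open ball). -/
def densityhk {X : Type*} [PseudoMetricSpace X] [MeasurableSpace X]
    (μ : MeasureTheory.Measure X) (s : ℝ) (x : X) (d : ℝ) : ℝ≥0∞ :=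
  ENNReal.ofReal ((2 * d) ^ s) / μ (Metric.ball x d)

/-- `fWord f σ k = f_{σ 0} ∘ ⋯ ∘ f_{σ (k-1)}`: the composition of the maps along the
first `k` letters of the code `σ` (so `fWord f σ k '' E` is the cylinder set `E_{σ(k)}`). -/
def fWord {X : Type*} {N : ℕ} (f : Fin N → X → X) (σ : ℕ → Fin N) : ℕ → X → X
  | 0 => id
  | (k+1) => fWord f σ k ∘ f (σ k)

/-- `rWord rr σ k = r_{σ 0} ⋯ r_{σ (k-1)}`: the contraction ratio of `fWord f σ k`. -/
def rWord {N : ℕ} (rr : Fin N → ℝ) (σ : ℕ → Fin N) (k : ℕ) : ℝ :=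
  ∏ j ∈ Finset.range k, rr (σ j)

/-- The algorithm's point sets: `algA f 1` is the set of fixed points of the maps `fᵢ`,
and `algA f (k+1) = ⋃ i, fᵢ(algA f k)`; `algA f 0` is unused (empty). -/
def algA {X : Type*} {N : ℕ} (f : Fin N → X → X) : ℕ → Set X
  | 0 => ∅
  | 1 => {x | ∃ i, f i x = x}
  | (k+2) => ⋃ i, f i '' algA f (k+1)

/-- Composition of the maps `fᵢ` along a finite word `w`. -/
def wordComp {X : Type*} {N : ℕ} (f : Fin N → X → X) : ∀ k, (Fin k → Fin N) → X → X
  | 0, _ => id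
  | (k+1), w => f (w 0) ∘ wordComp f k (w ∘ Fin.succ)

/-- The discrete measures `μ_k = ∑_{x ∈ A_k} r_{i_k(x)}^s · δ_x`: the sum runs over all
words `w` of length `k`, with weight `r_w^s` and Dirac mass at the point of `A_k` with
address `w`, namely `f_w(fix(last letter of w))`; `algMu … 0` is unused (zero measure). -/
def algMu {X : Type*} [MeasurableSpace X] {N : ℕ} (f : Fin N → X → X)
    (rr : Fin N → ℝ) (fix : Fin N → X) (s : ℝ) : ℕ → MeasureTheory.Measure X
  | 0 => 0
  | (k+1) => ∑ w : Fin (k+1) → Fin N,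
      ENNReal.ofReal ((∏ j, rr (w j)) ^ s) •
        MeasureTheory.Measure.dirac (wordComp f (k+1) w (fix (w (Fin.last k))))

/-- The algorithm's admissible set of radii
`D_k = {dist(x,y) : x, y ∈ A_k} ∩ [c̃, c̃/r_min]`. -/
def algD {X : Type*} [PseudoMetricSpace X] {N : ℕ} (f : Fin N → X → X)
    (ct rmin : ℝ) (k : ℕ) : Set ℝ :=
  {d | (∃ x ∈ algA f k, ∃ y ∈ algA f k, d = dist x y) ∧ ct ≤ d ∧ d ≤ ct / rmin}

end

/-- Bundled hypotheses on the self-similar system (working form). -/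
structure SSHyp {n N : ℕ} (f : Fin N → EuclideanSpace ℝ (Fin n) → EuclideanSpace ℝ (Fin n))
    (rr : Fin N → ℝ) (E : Set (EuclideanSpace ℝ (Fin n))) (c s ρ : ℝ)
    (μ : MeasureTheory.Measure (EuclideanSpace ℝ (Fin n))) : Prop where
  r0 : ∀ i, 0 < rr i
  rρ : ∀ i, rr i ≤ ρ
  ρ0 : 0 < ρ
  ρ1 : ρ < 1
  hsim : ∀ i x y, dist (f i x) (f i y) = rr i * dist x y
  cp : IsCompact E
  ne : E.Nonempty
  inv : ∀ y ∈ E, ∃ i, ∃ x ∈ E, f i x = y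
  maps : ∀ i, ∀ x ∈ E, f i x ∈ E
  sep : ∀ i j, i ≠ j → ∀ x ∈ E, ∀ y ∈ E, c ≤ dist (f i x) (f j y)
  c0 : 0 < c
  diam : ∀ x ∈ E, ∀ y ∈ E, dist x y ≤ 1
  s0 : 0 < s
  hsum : ∑ i, ENNReal.ofReal (rr i ^ s) = 1
  prob : IsProbabilityMeasure μ
  μss : ∀ A : Set (EuclideanSpace ℝ (Fin n)), MeasurableSet A →
      μ A = ∑ i, ENNReal.ofReal (rr i ^ s) * μ (f i ⁻¹' A)

namespace SSHyp

variable {n N : ℕ} {f : Fin N → EuclideanSpace ℝ (Fin n) → EuclideanSpace ℝ (Fin n)}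
    {rr : Fin N → ℝ} {E : Set (EuclideanSpace ℝ (Fin n))} {c s ρ : ℝ}
    {μ : MeasureTheory.Measure (EuclideanSpace ℝ (Fin n))}

theorem inj (H : SSHyp f rr E c s ρ μ) (i : Fin N) : Function.Injective (f i) := by
  intro x y hxy
  have := H.hsim i x y
  rw [hxy, dist_self] at this
  have h0 := H.r0 i
  have : dist x y = 0 := by
    rcases mul_eq_zero.1 this.symm with h | h
    · linarith
    · exact h
  exact dist_eq_zero.1 this

theorem cont (H : SSHyp f rr E c s ρ μ) (i : Fin N) : Continuous (f i) := by
  have : LipschitzWith ⟨rr i, (H.r0 i).le⟩ (f i) :=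
    LipschitzWith.of_dist_le_mul (fun x y => (H.hsim i x y).le)
  exact this.continuous

theorem surj (H : SSHyp f rr E c s ρ μ) (i : Fin N) : Function.Surjective (f i) := by
  have h0 := H.r0 i
  have hi : Isometry (fun x => (rr i)⁻¹ • f i x) := by
    refine Isometry.of_dist_eq fun x y => ?_
    rw [dist_smul₀, H.hsim, Real.norm_eq_abs, abs_of_pos (inv_pos.2 h0)]
    field_simp
  set g := hi.affineIsometryOfStrictConvexSpace with hg
  have hs : Function.Surjective g := by
    have h1 : Function.Injective g.linear := (AffineMap.linear_injective_iff g.toAffineMap).2 g.injective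
    have h2 : Function.Surjective g.linear := LinearMap.injective_iff_surjective.1 h1
    exact (AffineMap.linear_surjective_iff g.toAffineMap).1 h2
  intro y
  obtain ⟨x, hx⟩ := hs ((rr i)⁻¹ • y)
  refine ⟨x, ?_⟩
  have : (rr i)⁻¹ • f i x = (rr i)⁻¹ • y := hx
  exact (smul_right_injective _ (inv_ne_zero h0.ne')) this

theorem w_pos (H : SSHyp f rr E c s ρ μ) (i : Fin N) : ENNReal.ofReal (rr i ^ s) ≠ 0 := by
  have := Real.rpow_pos_of_pos (H.r0 i) s
  simpa using this

theorem E_full (H : SSHyp f rr E c s ρ μ) : μ Eᶜ = 0 := by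
  have := H.prob
  have hρ0 := H.ρ0
  have hρ1 := H.ρ1
  have mono : ∀ t : ℝ, 0 < t → μ (cthickening (t / ρ) E) ≤ μ (cthickening t E) := by
    intro t ht
    rw [H.μss (cthickening t E) isClosed_cthickening.measurableSet]
    calc μ (cthickening (t / ρ) E) = ∑ i, ENNReal.ofReal (rr i ^ s) * μ (cthickening (t / ρ) E) := by
          rw [← Finset.sum_mul, H.hsum, one_mul]
      _ ≤ _ := by
          refine Finset.sum_le_sum fun i _ => ?_
          gcongr
          intro x hx
          rw [H.cp.cthickening_eq_biUnion_closedBall (by positivity)] at hx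
          simp only [mem_iUnion, mem_closedBall, exists_prop] at hx
          obtain ⟨y, hy, hxy⟩ := hx
          refine mem_cthickening_of_dist_le (f i x) (f i y) t E (H.maps i y hy) ?_
          rw [H.hsim]
          have := H.rρ i
          calc rr i * dist x y ≤ ρ * (t / ρ) := by gcongr
            _ = t := by field_simp
  have mono' : ∀ t : ℝ, 0 < t → ∀ k : ℕ, μ (cthickening (t / ρ ^ k) E) ≤ μ (cthickening t E) := by
    intro t ht k
    induction k with
    | zero => simp
    | succ k ih =>
      refine le_trans ?_ ih
      rw [pow_succ, ← div_div]
      exact mono _ (by positivity)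
  have full : ∀ t : ℝ, 0 < t → μ (cthickening t E) = 1 := by
    intro t ht
    refine le_antisymm prob_le_one ?_
    obtain ⟨x0, hx0⟩ := H.ne
    have hinc : Monotone (fun k : ℕ => cthickening (t / ρ ^ k) E) := by
      intro k l hkl
      refine cthickening_mono ?_ E
      have : ρ ^ l ≤ ρ ^ k := pow_le_pow_of_le_one hρ0.le hρ1.le hkl
      gcongr
    have hU : (⋃ k : ℕ, cthickening (t / ρ ^ k) E) = univ := by
      refine eq_univ_of_forall fun y => mem_iUnion.2 ?_
      have hlim : Tendsto (fun k : ℕ => dist y x0 * ρ ^ k) atTop (𝓝 (dist y x0 * 0)) :=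
        (tendsto_pow_atTop_nhds_zero_of_lt_one hρ0.le hρ1).const_mul _
      rw [mul_zero] at hlim
      obtain ⟨k, hk⟩ := (hlim.eventually (gt_mem_nhds ht)).exists
      refine ⟨k, mem_cthickening_of_dist_le y x0 _ E hx0 ?_⟩
      rw [le_div_iff₀ (by positivity)]
      exact hk.le
    have hlim := tendsto_measure_iUnion_atTop (μ := μ) hinc
    rw [hU, measure_univ] at hlim
    exact le_of_tendsto' hlim (fun k => mono' t ht k)
  have hE : E = ⋂ k : ℕ, cthickening (1 / ((k : ℝ) + 1)) E := by
    apply Subset.antisymm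
    · exact subset_iInter fun k => self_subset_cthickening E
    · intro x hx
      rw [← H.cp.isClosed.closure_eq, mem_closure_iff_infEDist_zero]
      have hx' : ∀ k : ℕ, infEDist x E ≤ ENNReal.ofReal (1 / ((k : ℝ) + 1)) := fun k => (mem_iInter.1 hx) k
      have hl : Tendsto (fun k : ℕ => ENNReal.ofReal (1 / ((k : ℝ) + 1))) atTop (𝓝 (ENNReal.ofReal 0)) :=
        ENNReal.tendsto_ofReal tendsto_one_div_add_atTop_nhds_zero_nat
      rw [ENNReal.ofReal_zero] at hl
      exact le_antisymm (ge_of_tendsto' hl hx') bot_le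
  rw [hE, compl_iInter, measure_iUnion_null_iff]
  intro k
  rw [prob_compl_eq_zero_iff isClosed_cthickening.measurableSet]
  exact full _ (by positivity)

theorem μE (H : SSHyp f rr E c s ρ μ) : μ E = 1 := by
  have := H.prob
  exact (prob_compl_eq_zero_iff H.cp.isClosed.measurableSet).1 H.E_full

/-- Outer-measure form of self-similarity. -/
theorem outer_le (H : SSHyp f rr E c s ρ μ) (D : Set (EuclideanSpace ℝ (Fin n))) (hD : D ⊆ E) :
    μ D ≤ ∑ j, ENNReal.ofReal (rr j ^ s) * μ (E ∩ f j ⁻¹' D) := by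
  have := H.prob
  have hsub : D ⊆ ⋃ j, f j '' (E ∩ f j ⁻¹' D) := by
    intro y hy
    obtain ⟨i, x, hx, rfl⟩ := H.inv y (hD hy)
    exact mem_iUnion.2 ⟨i, x, ⟨hx, hy⟩, rfl⟩
  refine (measure_mono hsub).trans ((measure_iUnion_fintype_le μ _).trans ?_)
  refine Finset.sum_le_sum fun j _ => ?_
  set C := E ∩ f j ⁻¹' D with hC
  set K := toMeasurable μ C ∩ E with hK
  have hKm : MeasurableSet K := (measurableSet_toMeasurable μ C).inter H.cp.isClosed.measurableSet
  have hCK : C ⊆ K := fun x hx => ⟨subset_toMeasurable μ C hx, hx.1⟩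
  have hfK : MeasurableSet (f j '' K) :=
    hKm.image_of_continuousOn_injOn (H.cont j).continuousOn (H.inj j).injOn
  refine (measure_mono (image_mono hCK)).trans ?_
  rw [H.μss _ hfK, Finset.sum_eq_single j]
  · rw [preimage_image_eq _ (H.inj j)]
    refine mul_le_mul_right ?_ _
    exact (measure_mono inter_subset_left).trans (measure_toMeasurable C).le
  · intro k _ hkj
    have : μ (f k ⁻¹' (f j '' K)) = 0 := by
      refine measure_mono_null ?_ H.E_full
      rintro x ⟨y, hy, hxy⟩ hxE
      have := H.sep k j hkj x hxE y hy.2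
      rw [hxy, dist_self] at this
      exact absurd H.c0 (not_lt.2 this)
    rw [this, mul_zero]
  · simp

theorem avoid (H : SSHyp f rr E c s ρ μ) (A : Set (EuclideanSpace ℝ (Fin n))) (hA : A ⊆ E)
    (hgood : ∀ i, ∀ z ∈ E, f i z ∈ A → z ∈ A) (k : ℕ) :
    ∀ x0 ∈ E, ∀ η : ℝ, ρ ^ k < η → ∃ κ : ℝ≥0∞, κ < 1 ∧
      ∀ D ⊆ A, Disjoint D (ball x0 η) → μ D ≤ κ * μ A := by
  have := H.prob
  induction k with
  | zero =>
    intro x0 hx0 η hη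
    refine ⟨0, one_pos, fun D hD hdis => ?_⟩
    have : D = ∅ := by
      refine eq_empty_of_forall_notMem fun y hy => ?_
      refine disjoint_left.1 hdis hy ?_
      rw [pow_zero] at hη
      exact (H.diam y (hA (hD hy)) x0 hx0).trans_lt hη
    simp [this]
  | succ k ih =>
    intro x0 hx0 η hη
    obtain ⟨i, x1, hx1, rfl⟩ := H.inv x0 hx0
    have hri := H.r0 i
    have hriρ := H.rρ i
    have hρ0 := H.ρ0
    obtain ⟨κ, hκ, hκD⟩ := ih x1 hx1 (η / rr i) (by
      rw [lt_div_iff₀ hri]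
      refine lt_of_le_of_lt ?_ hη
      rw [pow_succ]
      gcongr)
    classical
    refine ⟨∑ j, ENNReal.ofReal (rr j ^ s) * (if j = i then κ else 1), ?_, ?_⟩
    · calc _ < ∑ j, ENNReal.ofReal (rr j ^ s) := ?_
        _ = 1 := H.hsum
      rw [← Finset.add_sum_erase _ _ (Finset.mem_univ i), ← Finset.add_sum_erase _
        (fun j => ENNReal.ofReal (rr j ^ s)) (Finset.mem_univ i)]
      refine ENNReal.add_lt_add_of_lt_of_le ?_ ?_ ?_
      · refine ne_top_of_le_ne_top ENNReal.one_ne_top (le_trans ?_ H.hsum.le)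
        refine (Finset.sum_le_sum (g := fun j => ENNReal.ofReal (rr j ^ s)) fun j hj => ?_).trans
          (Finset.sum_le_sum_of_subset (Finset.erase_subset _ _))
        simp [Finset.ne_of_mem_erase hj]
      · have h1 := ENNReal.mul_lt_mul_right (H.w_pos i) ENNReal.ofReal_ne_top hκ
        simpa using h1
      · refine Finset.sum_le_sum fun j hj => ?_
        simp [Finset.ne_of_mem_erase hj]
    · intro D hD hdis
      refine (H.outer_le D (hD.trans hA)).trans ?_
      rw [Finset.sum_mul]
      refine Finset.sum_le_sum fun j _ => ?_
      rw [mul_assoc]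
      gcongr
      have hsub : E ∩ f j ⁻¹' D ⊆ A := fun z hz => hgood j z hz.1 (hD hz.2)
      split_ifs with hji
      · subst hji
        refine hκD _ hsub ?_
        rw [disjoint_left]
        intro z hz hzb
        refine disjoint_left.1 hdis hz.2 ?_
        rw [mem_ball] at hzb ⊢
        rw [H.hsim]
        rwa [lt_div_iff₀ hri, mul_comm] at hzb
      · rw [one_mul]
        exact measure_mono hsub

theorem avoid_null (H : SSHyp f rr E c s ρ μ) (A : Set (EuclideanSpace ℝ (Fin n))) (hA : A ⊆ E)
    (hgood : ∀ i, ∀ z ∈ E, f i z ∈ A → z ∈ A) (x0) (hx0 : x0 ∈ E) (η : ℝ) (hη : 0 < η)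
    (hdis : Disjoint A (ball x0 η)) : μ A = 0 := by
  have := H.prob
  obtain ⟨k, hk⟩ := exists_pow_lt_of_lt_one hη H.ρ1
  obtain ⟨κ, hκ, h⟩ := H.avoid A hA hgood k x0 hx0 η hk
  have h1 := h A subset_rfl hdis
  by_contra h0
  have : κ * μ A < 1 * μ A := ENNReal.mul_lt_mul_left h0 (measure_ne_top μ A) hκ
  rw [one_mul] at this
  exact absurd h1 (not_le.2 this)

theorem ball_pos (H : SSHyp f rr E c s ρ μ) (x0) (hx0 : x0 ∈ E) (η : ℝ) (hη : 0 < η) :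
    0 < μ (ball x0 η) := by
  have := H.prob
  obtain ⟨k, hk⟩ := exists_pow_lt_of_lt_one hη H.ρ1
  obtain ⟨κ, hκ, h⟩ := H.avoid E subset_rfl (fun _ _ hz _ => hz) k x0 hx0 η hk
  have h1 := h (E \ ball x0 η) sdiff_subset disjoint_sdiff_left
  rw [H.μE, mul_one] at h1
  by_contra h0
  have h0 : μ (ball x0 η) = 0 := by simpa using h0
  rw [measure_sdiff_null h0, H.μE] at h1
  exact absurd h1 (not_le.2 hκ)

theorem cball_pos (H : SSHyp f rr E c s ρ μ) (x0) (hx0 : x0 ∈ E) (η : ℝ) (hη : 0 < η) :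
    0 < μ (closedBall x0 η) :=
  (H.ball_pos x0 hx0 η hη).trans_le (measure_mono ball_subset_closedBall)

theorem scale (H : SSHyp f rr E c s ρ μ) (i : Fin N) (x) (hx : x ∈ E) (d : ℝ) (hd : 0 < d)
    (hdc : rr i * d < c) : densityh μ s (f i x) (rr i * d) = densityh μ s x d := by
  have hri := H.r0 i
  have hball : μ (closedBall (f i x) (rr i * d)) = ENNReal.ofReal (rr i ^ s) * μ (closedBall x d) := by
    rw [H.μss _ isClosed_closedBall.measurableSet, Finset.sum_eq_single i]
    · congr 2
      ext z
      simp [H.hsim, hri]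
    · intro j _ hji
      have : μ (f j ⁻¹' closedBall (f i x) (rr i * d)) = 0 := by
        refine measure_mono_null ?_ H.E_full
        intro z hz hzE
        have h1 := H.sep j i hji z hzE x hx
        have h2 : dist (f j z) (f i x) ≤ rr i * d := hz
        linarith
      rw [this, mul_zero]
    · simp
  unfold densityh
  rw [hball, show 2 * (rr i * d) = rr i * (2 * d) by ring,
    Real.mul_rpow hri.le (by positivity), ENNReal.ofReal_mul (by positivity),
    ENNReal.mul_div_mul_left _ _ (H.w_pos i) ENNReal.ofReal_ne_top]

/-- Common zero set of a space of functions. -/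
def Zset (K : Submodule ℝ (EuclideanSpace ℝ (Fin n) → ℝ)) : Set (EuclideanSpace ℝ (Fin n)) :=
  {z | ∀ q ∈ K, q z = 0}

/-- The span of constants and squared distance functions. -/
def Lsp (n : ℕ) : Submodule ℝ (EuclideanSpace ℝ (Fin n) → ℝ) :=
  Submodule.span ℝ ({fun _ => 1} ∪ Set.range (fun (p z : EuclideanSpace ℝ (Fin n)) => dist z p ^ 2))

theorem Lsp_fin (n : ℕ) : FiniteDimensional ℝ (Lsp n) := by
  set S0 : Set (EuclideanSpace ℝ (Fin n) → ℝ) :=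
    {fun _ => 1, fun z => ‖z‖ ^ 2} ∪ Set.range (fun (i : Fin n) (z : EuclideanSpace ℝ (Fin n)) => z i) with hS0
  have hfin : S0.Finite := (Set.toFinite _).union (Set.finite_range _)
  have : FiniteDimensional ℝ (Submodule.span ℝ S0) := FiniteDimensional.span_of_finite ℝ hfin
  refine Submodule.finiteDimensional_of_le (S₂ := Submodule.span ℝ S0) ?_
  unfold Lsp
  rw [Submodule.span_le]
  rintro q (rfl | ⟨p, rfl⟩)
  · exact Submodule.subset_span (by simp [hS0])
  · have h1 : (fun _ => 1 : EuclideanSpace ℝ (Fin n) → ℝ) ∈ Submodule.span ℝ S0 :=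
      Submodule.subset_span (by simp [hS0])
    have h2 : (fun z => ‖z‖ ^ 2 : EuclideanSpace ℝ (Fin n) → ℝ) ∈ Submodule.span ℝ S0 :=
      Submodule.subset_span (by simp [hS0])
    have h3 : ∀ i, (fun z => z i : EuclideanSpace ℝ (Fin n) → ℝ) ∈ Submodule.span ℝ S0 :=
      fun i => Submodule.subset_span (by simp [hS0])
    have : (fun z => dist z p ^ 2 : EuclideanSpace ℝ (Fin n) → ℝ) =
        (fun z => ‖z‖ ^ 2) + (‖p‖ ^ 2) • (fun _ => 1) +
        ∑ i, (-2 * p i) • (fun z : EuclideanSpace ℝ (Fin n) => z i) := by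
      ext z
      simp only [Pi.add_apply, Pi.smul_apply, Finset.sum_apply, smul_eq_mul,
        EuclideanSpace.dist_sq_eq, EuclideanSpace.norm_sq_eq, Real.dist_eq, Real.norm_eq_abs, sq_abs,
        mul_one]
      rw [← Finset.sum_add_distrib, ← Finset.sum_add_distrib]
      refine Finset.sum_congr rfl fun i _ => by ring
    show (fun z => dist z p ^ 2 : EuclideanSpace ℝ (Fin n) → ℝ) ∈ Submodule.span ℝ S0
    rw [this]
    exact add_mem (add_mem h2 (Submodule.smul_mem _ _ h1))
      (Submodule.sum_mem _ fun i _ => Submodule.smul_mem _ _ (h3 i))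

theorem Lsp_cont {q : EuclideanSpace ℝ (Fin n) → ℝ} (hq : q ∈ Lsp n) : Continuous q := by
  unfold Lsp at hq
  induction hq using Submodule.span_induction with
  | mem q h =>
    rcases h with rfl | ⟨p, rfl⟩
    · exact continuous_const
    · fun_prop
  | zero => exact continuous_const
  | add x y _ _ hx hy => exact hx.add hy
  | smul a x _ hx => exact hx.const_smul a

theorem Zset_closed {K : Submodule ℝ (EuclideanSpace ℝ (Fin n) → ℝ)} (hK : K ≤ Lsp n) :
    IsClosed (Zset K) := by
  have : Zset K = ⋂ q ∈ K, {z | q z = 0} := by ext; simp [Zset]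
  rw [this]
  exact isClosed_biInter fun q hq => isClosed_eq (Lsp_cont (hK hq)) continuous_const

theorem Lsp_comp (H : SSHyp f rr E c s ρ μ) (i : Fin N) :
    (Lsp n).map (LinearMap.funLeft ℝ ℝ (f i)) ≤ Lsp n := by
  conv_lhs => unfold Lsp
  rw [Submodule.map_span_le]
  rintro q (rfl | ⟨p, rfl⟩)
  · exact Submodule.subset_span (Or.inl rfl)
  · obtain ⟨p', rfl⟩ := H.surj i p
    have : LinearMap.funLeft ℝ ℝ (f i) (fun z => dist z (f i p') ^ 2) =
        (rr i ^ 2) • (fun z => dist z p' ^ 2) := by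
      ext z
      simp [LinearMap.funLeft_apply, H.hsim, mul_pow]
    rw [this]
    exact Submodule.smul_mem _ _ (Submodule.subset_span (Or.inr ⟨p', rfl⟩))

theorem null_zero (H : SSHyp f rr E c s ρ μ) (q : EuclideanSpace ℝ (Fin n) → ℝ) (hq : q ∈ Lsp n)
    (x) (hx : x ∈ E) (hqx : q x ≠ 0) : μ {z | q z = 0} = 0 := by
  classical
  have := H.prob
  have hLf := Lsp_fin n
  let P : ℕ → Prop := fun k => ∃ K : Submodule ℝ (EuclideanSpace ℝ (Fin n) → ℝ), K ≤ Lsp n ∧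
    Module.finrank ℝ K = k ∧ μ (Zset K) ≠ 0
  have hbd : ∀ K : Submodule ℝ (EuclideanSpace ℝ (Fin n) → ℝ), K ≤ Lsp n →
      Module.finrank ℝ K ≤ Module.finrank ℝ (Lsp n) := fun K hK => Submodule.finrank_mono hK
  have hP0 : P 0 := ⟨⊥, bot_le, by simp, by
    have : Zset (⊥ : Submodule ℝ (EuclideanSpace ℝ (Fin n) → ℝ)) = univ := by
      ext z; simp [Zset]
    rw [this]; simp⟩
  set k := Nat.findGreatest P (Module.finrank ℝ (Lsp n)) with hk
  have hPk : P k := Nat.findGreatest_spec (Nat.zero_le _) hP0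
  have hmax : ∀ K : Submodule ℝ (EuclideanSpace ℝ (Fin n) → ℝ), K ≤ Lsp n →
      k < Module.finrank ℝ K → μ (Zset K) = 0 := by
    intro K hK hlt
    by_contra h
    exact absurd (Nat.le_findGreatest (hbd K hK) (⟨K, hK, rfl, h⟩ : P _)) (not_le.2 hlt)
  have hsup : ∀ K K' : Submodule ℝ (EuclideanSpace ℝ (Fin n) → ℝ), Zset K ∩ Zset K' ⊆ Zset (K ⊔ K') := by
    rintro K K' z ⟨h1, h2⟩ q hq
    obtain ⟨a, ha, b, hb, rfl⟩ := Submodule.mem_sup.1 hq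
    simp [h1 a ha, h2 b hb]
  let I := {K : Submodule ℝ (EuclideanSpace ℝ (Fin n) → ℝ) // K ≤ Lsp n ∧ Module.finrank ℝ K = k}
  obtain ⟨K0, hK0L, hK0k, hK0⟩ := hPk
  have hfin : Set.Finite {K : I | μ (Zset K0) ≤ μ (Zset K.1)} := by
    refine Measure.finite_const_le_meas_of_disjoint_iUnion₀ μ (pos_iff_ne_zero.2 hK0)
      (As := fun K : I => Zset K.1)
      (fun K => (Zset_closed K.2.1).measurableSet.nullMeasurableSet) ?_ (measure_ne_top μ _)
    intro K K' hne
    refine measure_mono_null (hsup K.1 K'.1) (hmax _ (sup_le K.2.1 K'.2.1) ?_)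
    have hle : K.1 < K.1 ⊔ K'.1 := by
      refine lt_of_le_of_ne le_sup_left fun heq => hne ?_
      have h2 : K'.1 ≤ K.1 := heq ▸ le_sup_right
      have : FiniteDimensional ℝ K.1 := Submodule.finiteDimensional_of_le K.2.1
      exact (Subtype.ext (Submodule.eq_of_le_of_finrank_eq h2 (by rw [K.2.2, K'.2.2]))).symm
    have : FiniteDimensional ℝ (K.1 ⊔ K'.1 : Submodule ℝ (EuclideanSpace ℝ (Fin n) → ℝ)) :=
      Submodule.finiteDimensional_of_le (sup_le K.2.1 K'.2.1)
    have := Submodule.finrank_lt_finrank_of_lt hle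
    rwa [K.2.2] at this
  obtain ⟨Ks, hKs, hKsmax⟩ := Set.exists_max_image _ (fun K : I => μ (Zset K.1)) hfin
    ⟨⟨K0, hK0L, hK0k⟩, le_refl (μ (Zset K0))⟩
  have hKsmax' : ∀ K : I, μ (Zset K.1) ≤ μ (Zset Ks.1) := by
    intro K
    by_cases h : μ (Zset K0) ≤ μ (Zset K.1)
    · exact hKsmax K h
    · exact (not_le.1 h).le.trans hKs
  set p := μ (Zset Ks.1) with hp
  have hp0 : p ≠ 0 := fun h => hK0 (le_antisymm (hKs.trans h.le) bot_le)
  -- pull-back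
  have hpull : ∀ (K : I), μ (Zset K.1) = p → ∀ i, ∃ K' : I, μ (Zset K'.1) = p ∧
      Zset K'.1 = f i ⁻¹' Zset K.1 := by
    intro K hK
    have hinj : ∀ i, Function.Injective (LinearMap.funLeft ℝ ℝ (f i)) :=
      fun i => LinearMap.funLeft_injective_of_surjective ℝ ℝ (f i) (H.surj i)
    let T : Fin N → I := fun i => ⟨K.1.map (LinearMap.funLeft ℝ ℝ (f i)),
      (Submodule.map_mono K.2.1).trans (Lsp_comp H i), by
        rw [← (Submodule.equivMapOfInjective _ (hinj i) K.1).finrank_eq]; exact K.2.2⟩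
    have hT : ∀ i, Zset (T i).1 = f i ⁻¹' Zset K.1 := by
      intro i
      ext z
      simp [T, Zset, LinearMap.funLeft_apply]
    intro i
    refine ⟨T i, ?_, hT i⟩
    by_contra hne
    have hlt : μ (Zset (T i).1) < p := lt_of_le_of_ne (hKsmax' _) hne
    have hsum := H.μss (Zset K.1) (Zset_closed K.2.1).measurableSet
    simp only [← hT] at hsum
    rw [hK] at hsum
    have hpt : p ≠ ⊤ := measure_ne_top μ _
    have : ∑ i, ENNReal.ofReal (rr i ^ s) * μ (Zset (T i).1) < ∑ i, ENNReal.ofReal (rr i ^ s) * p := by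
      rw [← Finset.add_sum_erase _ _ (Finset.mem_univ i), ← Finset.add_sum_erase _
        (fun j => ENNReal.ofReal (rr j ^ s) * p) (Finset.mem_univ i)]
      refine ENNReal.add_lt_add_of_lt_of_le ?_ ?_ ?_
      · exact (ENNReal.sum_lt_top.2 fun j _ =>
          ENNReal.mul_lt_top ENNReal.ofReal_lt_top (measure_lt_top μ _)).ne
      · exact ENNReal.mul_lt_mul_right (H.w_pos i) ENNReal.ofReal_ne_top hlt
      · refine Finset.sum_le_sum fun j hj => ?_
        exact mul_le_mul_right (hKsmax' (T j)) _
    rw [← hsum, ← Finset.sum_mul, H.hsum, one_mul] at this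
    exact lt_irrefl _ this
  have hclose : ∀ m : ℕ, ∀ K : I, μ (Zset K.1) = p → ∀ y ∈ E, ∃ z ∈ Zset K.1, dist z y ≤ ρ ^ m := by
    intro m
    induction m with
    | zero =>
      intro K hK y hy
      have : (Zset K.1 ∩ E).Nonempty := by
        rw [Set.nonempty_iff_ne_empty]
        intro h
        apply hp0
        rw [← hK]
        refine measure_mono_null ?_ H.E_full
        intro z hz hzE
        have : z ∈ Zset K.1 ∩ E := ⟨hz, hzE⟩
        rw [h] at this
        exact this
      obtain ⟨z, hz, hzE⟩ := this
      exact ⟨z, hz, by simpa using H.diam z hzE y hy⟩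
    | succ m ih =>
      intro K hK y hy
      obtain ⟨i, y', hy', rfl⟩ := H.inv y hy
      obtain ⟨K', hK', hZ⟩ := hpull K hK i
      obtain ⟨z', hz', hd⟩ := ih K' hK' y' hy'
      rw [hZ] at hz'
      refine ⟨f i z', hz', ?_⟩
      rw [H.hsim, pow_succ, mul_comm]
      have := H.rρ i
      have := H.ρ0
      have := (H.r0 i).le
      gcongr
  have hEsub : E ⊆ Zset Ks.1 := by
    intro y hy
    rw [← (Zset_closed Ks.2.1).closure_eq, Metric.mem_closure_iff]
    intro ε hε
    obtain ⟨m, hm⟩ := exists_pow_lt_of_lt_one hε H.ρ1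
    obtain ⟨z, hz, hd⟩ := hclose m Ks rfl y hy
    exact ⟨z, hz, by rw [dist_comm]; exact hd.trans_lt hm⟩
  have hqK : q ∉ Ks.1 := fun h => hqx (hEsub hx q h)
  have hle2 : Ks.1 ⊔ Submodule.span ℝ {q} ≤ Lsp n :=
    sup_le Ks.2.1 ((Submodule.span_singleton_le_iff_mem _ _).2 hq)
  have hnull : μ (Zset (Ks.1 ⊔ Submodule.span ℝ {q})) = 0 := by
    refine hmax _ hle2 ?_
    have : FiniteDimensional ℝ (Ks.1 ⊔ Submodule.span ℝ {q} : Submodule ℝ (EuclideanSpace ℝ (Fin n) → ℝ)) :=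
      Submodule.finiteDimensional_of_le hle2
    have hlt : Ks.1 < Ks.1 ⊔ Submodule.span ℝ {q} := by
      refine lt_of_le_of_ne le_sup_left fun heq => hqK ?_
      rw [heq]
      exact Submodule.mem_sup_right (Submodule.mem_span_singleton_self q)
    have := Submodule.finrank_lt_finrank_of_lt hlt
    rwa [Ks.2.2] at this
  have hsub : {z | q z = 0} ⊆ Zset (Ks.1 ⊔ Submodule.span ℝ {q}) ∪ Eᶜ := by
    intro z hz
    by_cases hzE : z ∈ E
    · left
      refine hsup _ _ ⟨hEsub hzE, ?_⟩
      intro g hg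
      obtain ⟨a, rfl⟩ := Submodule.mem_span_singleton.1 hg
      have : q z = 0 := hz
      simp [this]
    · right; exact hzE
  exact measure_mono_null hsub (measure_union_null hnull H.E_full)

theorem null_sphere (H : SSHyp f rr E c s ρ μ) (x) (hx : x ∈ E) (d : ℝ) (hd : 0 < d) :
    μ (sphere x d) = 0 := by
  have := H.null_zero (fun z => dist z x ^ 2 - d ^ 2) (by
      have : (fun z : EuclideanSpace ℝ (Fin n) => dist z x ^ 2 - d ^ 2) =
        (fun z => dist z x ^ 2) - (d ^ 2) • (fun _ => 1) := by ext z; simp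
      rw [this]
      exact sub_mem (Submodule.subset_span (Or.inr ⟨x, rfl⟩))
        (Submodule.smul_mem _ _ (Submodule.subset_span (Or.inl rfl)))) x hx (by simp [hd.ne'])
  refine measure_mono_null ?_ this
  intro z hz
  have : dist z x = d := hz
  simp [this]

theorem cont_density (H : SSHyp f rr E c s ρ μ) (x) (hx : x ∈ E) (d : ℝ) (hd : 0 < d) :
    ContinuousAt (fun p : EuclideanSpace ℝ (Fin n) × ℝ => densityh μ s p.1 p.2) (x, d) := by
  have := H.prob
  unfold densityh ContinuousAt
  refine ENNReal.Tendsto.div ?_ (Or.inl ?_) ?_ (Or.inl (measure_ne_top μ _))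
  · refine ENNReal.tendsto_ofReal ?_
    have : ContinuousAt (fun p : EuclideanSpace ℝ (Fin n) × ℝ => (2 * p.2) ^ s) (x, d) := by
      refine ContinuousAt.rpow_const (by fun_prop) (Or.inr H.s0.le)
    exact this
  · have : 0 < (2 * d) ^ s := by positivity
    simpa using this
  · refine tendsto_measure_of_ae_tendsto_indicator_of_isFiniteMeasure (𝓝 (x, d))
      isClosed_closedBall.measurableSet (fun p => isClosed_closedBall.measurableSet) ?_
    have h0 : ∀ᵐ z ∂μ, z ∉ sphere x d := measure_eq_zero_iff_ae_notMem.1 (H.null_sphere x hx d hd)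
    filter_upwards [h0] with z hz
    have hz : dist z x ≠ d := hz
    have hc1 : ContinuousAt (fun p : EuclideanSpace ℝ (Fin n) × ℝ => dist z p.1) (x, d) := by fun_prop
    have hc2 : ContinuousAt (fun p : EuclideanSpace ℝ (Fin n) × ℝ => p.2) (x, d) := by fun_prop
    rcases lt_or_gt_of_ne hz with h | h
    · filter_upwards [hc1.eventually_lt hc2 h] with p hp
      exact iff_of_true (mem_closedBall.2 hp.le) (mem_closedBall.2 h.le)
    · filter_upwards [hc2.eventually_lt hc1 h] with p hp
      exact iff_of_false (by simpa using hp) (by simpa using h)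

theorem exists_max (H : SSHyp f rr E c s ρ μ) (a rmin : ℝ) (ha : 0 < a) (hr : 0 < rmin) (hr1 : rmin ≤ 1) :
    ∃ x0 ∈ E, ∃ d0, a * rmin ≤ d0 ∧ d0 ≤ a ∧ ∀ x ∈ E, ∀ d, a * rmin ≤ d → d ≤ a →
      densityh μ s x d ≤ densityh μ s x0 d0 := by
  have hle : a * rmin ≤ a := by nlinarith
  obtain ⟨p, hp, hmax⟩ := (H.cp.prod (isCompact_Icc (a := a * rmin) (b := a))).exists_isMaxOn
    (f := fun p : EuclideanSpace ℝ (Fin n) × ℝ => densityh μ s p.1 p.2)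
    (H.ne.prod (nonempty_Icc.2 hle)) (by
      intro p hp
      exact (H.cont_density p.1 hp.1 p.2 (lt_of_lt_of_le (by positivity) hp.2.1)).continuousWithinAt)
  exact ⟨p.1, hp.1, p.2, hp.2.1, hp.2.2, fun x hx d h1 h2 => hmax (show (x, d) ∈ _ from ⟨hx, h1, h2⟩)⟩

theorem reduce (H : SSHyp f rr E c s ρ μ) (a rmin : ℝ) (ha : 0 < a) (hr : 0 < rmin)
    (hrle : ∀ i, rmin ≤ rr i) (hac : a * rmin ≤ c) (m : ℝ≥0∞)
    (hm : ∀ x ∈ E, ∀ d, a * rmin ≤ d → d ≤ a → densityh μ s x d ≤ m) :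
    ∀ x ∈ E, ∀ d, 0 < d → d ≤ a → densityh μ s x d ≤ m := by
  have key : ∀ k : ℕ, ∀ x ∈ E, ∀ d, a * rmin * ρ ^ k ≤ d → d ≤ a → densityh μ s x d ≤ m := by
    intro k
    induction k with
    | zero => intro x hx d h1 h2; exact hm x hx d (by simpa using h1) h2
    | succ k ih =>
      intro x hx d h1 h2
      by_cases h : a * rmin ≤ d
      · exact hm x hx d h h2
      push Not at h
      obtain ⟨i, x', hx', rfl⟩ := H.inv x hx
      have hri := H.r0 i
      have hρ := H.rρ i
      have hρ0 := H.ρ0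
      have hd : 0 < d := lt_of_lt_of_le (by positivity) h1
      have e : rr i * (d / rr i) = d := by field_simp
      have hs := H.scale i x' hx' (d / rr i) (by positivity) (by rw [e]; linarith)
      rw [e] at hs
      rw [hs]
      refine ih x' hx' _ ?_ ?_
      · rw [le_div_iff₀ hri]
        calc a * rmin * ρ ^ k * rr i ≤ a * rmin * ρ ^ k * ρ := by gcongr
          _ ≤ d := by rw [pow_succ] at h1; linarith
      · rw [div_le_iff₀ hri]
        nlinarith [hrle i]
  intro x hx d h1 h2
  obtain ⟨k, hk⟩ := exists_pow_lt_of_lt_one (show 0 < d / (a * rmin) by positivity) H.ρ1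
  refine key k x hx d ?_ h2
  rw [lt_div_iff₀ (by positivity)] at hk
  linarith

theorem nontriv (hdiam : Metric.diam E = 1) : Nontrivial (EuclideanSpace ℝ (Fin n)) := by
  by_contra h
  rw [not_nontrivial_iff_subsingleton] at h
  rw [Metric.diam_subsingleton Set.subsingleton_of_subsingleton] at hdiam
  exact zero_ne_one hdiam

theorem packM_le (H : SSHyp f rr E c s ρ μ) [Nontrivial (EuclideanSpace ℝ (Fin n))] (a : ℝ) (ha : 0 < a)
    (m : ℝ≥0∞) (hm : ∀ x ∈ E, ∀ d, 0 < d → d ≤ a → densityh μ s x d ≤ m) : packM s E ≤ m := by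
  have := H.prob
  have h1 : packM s E ≤ packPre0 s E := by
    unfold packM
    refine (iInf₂_le (fun k : ℕ => if k = 0 then E else ∅)
      (fun x hx => mem_iUnion.2 ⟨0, by simpa using hx⟩)).trans ?_
    rw [tsum_eq_single 0]
    · simp
    · intro k hk
      simp only [hk, if_false]
      unfold packPre0
      refine le_antisymm ((iInf₂_le 1 one_pos).trans ?_) bot_le
      unfold packPre
      refine iSup_le fun cen => iSup_le fun rad => iSup_le fun h => ?_
      exact (h 0).elim
  refine h1.trans ?_
  unfold packPre0
  refine (iInf₂_le a ha).trans ?_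
  unfold packPre
  refine iSup_le fun cen => iSup_le fun rad => iSup_le fun hcen => iSup_le fun hdia => iSup_le fun hdis => ?_
  calc ∑' i, ENNReal.ofReal (Metric.diam (Metric.closedBall (cen i) (rad i)) ^ s)
      ≤ ∑' i, m * μ (closedBall (cen i) (rad i)) := by
        refine ENNReal.tsum_le_tsum fun i => ?_
        rcases le_or_gt (rad i) 0 with h | h
        · have : Metric.diam (closedBall (cen i) (rad i)) = 0 := by
            refine Metric.diam_subsingleton ?_
            intro u hu v hv
            have h1 : dist u (cen i) ≤ 0 := le_trans hu h
            have h2 : dist v (cen i) ≤ 0 := le_trans hv h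
            rw [dist_le_zero.1 h1, dist_le_zero.1 h2]
          rw [this, Real.zero_rpow H.s0.ne']
          simp
        · have hd := hdia i
          rw [Metric.diam_closedBall_eq _ h.le] at hd ⊢
          have := hm (cen i) (hcen i) (rad i) h (by linarith)
          unfold densityh at this
          rwa [ENNReal.div_le_iff (H.cball_pos _ (hcen i) _ h).ne' (measure_ne_top μ _)] at this
    _ = m * ∑' i, μ (closedBall (cen i) (rad i)) := ENNReal.tsum_mul_left
    _ = m * μ (⋃ i, closedBall (cen i) (rad i)) := by
        rw [measure_iUnion hdis fun i => isClosed_closedBall.measurableSet]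
    _ ≤ m * 1 := mul_le_mul_right prob_le_one _
    _ = m := mul_one m

theorem packPre0_ge (H : SSHyp f rr E c s ρ μ) [Nontrivial (EuclideanSpace ℝ (Fin n))] (m : ℝ≥0∞)
    (U : Set (EuclideanSpace ℝ (Fin n)))
    (hU : ∀ y ∈ U, ∀ δ : ℝ, 0 < δ → ∃ r, 0 < r ∧ r < δ ∧ m ≤ densityh μ s y r) :
    m * μ U ≤ packPre0 s U := by
  have := H.prob
  unfold packPre0
  refine le_iInf₂ fun δ hδ => ?_
  obtain ⟨t, r, htc, htU, hr, hcov, hdis⟩ := Besicovitch.exists_disjoint_closedBall_covering_ae μ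
    (fun y => {r | m ≤ densityh μ s y r}) U (fun y hy ε hε => by
      obtain ⟨r, h1, h2, h3⟩ := hU y hy ε hε
      exact ⟨r, h3, h1, h2⟩) (fun _ => δ / 2) (fun _ _ => by positivity)
  have hμU : μ U ≤ ∑' x : t, μ (closedBall x.1 (r x)) := by
    have h1 : U ⊆ (U \ ⋃ x ∈ t, closedBall x (r x)) ∪ ⋃ x ∈ t, closedBall x (r x) := by
      intro y hy
      by_cases h : y ∈ ⋃ x ∈ t, closedBall x (r x)
      · exact Or.inr h
      · exact Or.inl ⟨hy, h⟩
    refine (measure_mono h1).trans ((measure_union_le _ _).trans ?_)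
    rw [hcov, zero_add]
    exact measure_biUnion_le μ htc _
  rcases t.eq_empty_or_nonempty with rfl | ⟨p, hp⟩
  · simp at hμU
    simp [hμU]
  have : Countable t := htc.to_subtype
  obtain ⟨g, hg⟩ := exists_injective_nat t
  let cen : ℕ → EuclideanSpace ℝ (Fin n) := Function.extend g (fun x : t => x.1) (fun _ => p)
  let rad : ℕ → ℝ := Function.extend g (fun x : t => r x) (fun _ => -1)
  have hcg : ∀ x : t, cen (g x) = x.1 := fun x => hg.extend_apply _ _ x
  have hrg : ∀ x : t, rad (g x) = r x := fun x => hg.extend_apply _ _ x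
  have hr' : ∀ k, (¬ ∃ x, g x = k) → rad k = -1 := fun k hk => Function.extend_apply' _ _ _ hk
  have hc' : ∀ k, (¬ ∃ x, g x = k) → cen k = p := fun k hk => Function.extend_apply' _ _ _ hk
  have h1 : ∀ k, cen k ∈ U := by
    intro k
    by_cases hk : ∃ x, g x = k
    · obtain ⟨x, rfl⟩ := hk
      rw [hcg]; exact htU x.2
    · rw [hc' k hk]; exact htU hp
  have hemp : ∀ k, (¬ ∃ x, g x = k) → closedBall (cen k) (rad k) = ∅ := by
    intro k hk
    rw [hr' k hk]
    exact closedBall_eq_empty.2 (by norm_num)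
  have h2 : ∀ k, Metric.diam (closedBall (cen k) (rad k)) ≤ δ := by
    intro k
    by_cases hk : ∃ x, g x = k
    · obtain ⟨x, rfl⟩ := hk
      have := (hr x x.2).2
      rw [hrg, Metric.diam_closedBall_eq _ this.1.le]
      linarith [this.2]
    · rw [hemp k hk, Metric.diam_empty]; exact hδ.le
  have h3 : Pairwise fun i j =>
      Disjoint (Metric.closedBall (cen i) (rad i)) (Metric.closedBall (cen j) (rad j)) := by
    intro i j hij
    by_cases hi : ∃ x, g x = i
    · by_cases hj : ∃ x, g x = j
      · obtain ⟨x, rfl⟩ := hi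
        obtain ⟨y, rfl⟩ := hj
        rw [hcg, hcg, hrg, hrg]
        refine hdis x.2 y.2 fun h => hij ?_
        rw [Subtype.ext h]
      · rw [hemp j hj]; exact disjoint_bot_right
    · rw [hemp i hi]; exact disjoint_bot_left
  calc m * μ U ≤ m * ∑' x : t, μ (closedBall x.1 (r x)) := mul_le_mul_right hμU _
    _ = ∑' x : t, m * μ (closedBall x.1 (r x)) := ENNReal.tsum_mul_left.symm
    _ ≤ ∑' x : t, ENNReal.ofReal (Metric.diam (closedBall (cen (g x)) (rad (g x))) ^ s) := by
        refine ENNReal.tsum_le_tsum fun x => ?_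
        have h := hr x x.2
        rw [hcg, hrg, Metric.diam_closedBall_eq _ h.2.1.le]
        exact ENNReal.mul_le_of_le_div h.1
    _ ≤ ∑' k, ENNReal.ofReal (Metric.diam (closedBall (cen k) (rad k)) ^ s) :=
        ENNReal.tsum_comp_le_tsum_of_injective hg
          (fun k => ENNReal.ofReal (Metric.diam (closedBall (cen k) (rad k)) ^ s))
    _ ≤ packPre s δ U := by
        unfold packPre
        exact le_iSup_of_le cen (le_iSup_of_le rad (le_iSup_of_le h1 (le_iSup_of_le h2
          (le_iSup_of_le h3 le_rfl))))

theorem le_packM (H : SSHyp f rr E c s ρ μ) [Nontrivial (EuclideanSpace ℝ (Fin n))] (i : Fin N)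
    (x) (hx : x ∈ E) (d : ℝ) (hd : 0 < d) (hdc : rr i * d ≤ c) : densityh μ s x d ≤ packM s E := by
  have := H.prob
  refine le_of_forall_lt fun m hm => ?_
  suffices hgoal : ∀ m, m < densityh μ s x d → m ≤ packM s E by
    obtain ⟨m', h1, h2⟩ := exists_between hm
    exact h1.trans_le (hgoal m' h2)
  clear hm m
  intro m hm
  -- slightly smaller radius
  obtain ⟨d', hd'0, hd'd, hd'⟩ : ∃ d', 0 < d' ∧ d' < d ∧
      m < ENNReal.ofReal ((2 * d') ^ s) / μ (closedBall x d) := by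
    have hc : ContinuousAt (fun e : ℝ => ENNReal.ofReal ((2 * e) ^ s) / μ (closedBall x d)) d := by
      refine ENNReal.Tendsto.div_const ?_ (Or.inr (H.cball_pos x hx d hd).ne')
      refine ENNReal.tendsto_ofReal ?_
      have : ContinuousAt (fun e : ℝ => (2 * e) ^ s) d :=
        ContinuousAt.rpow_const (by fun_prop) (Or.inr H.s0.le)
      exact this
    have h1 := hc.eventually (lt_mem_nhds hm)
    have h2 : ∀ᶠ e in 𝓝[<] d, m < ENNReal.ofReal ((2 * e) ^ s) / μ (closedBall x d) :=
      h1.filter_mono nhdsWithin_le_nhds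
    have h3 : ∀ᶠ e in 𝓝[<] d, 0 < e := (lt_mem_nhds hd).filter_mono nhdsWithin_le_nhds
    obtain ⟨e, he, h4, h5⟩ := (h2.and (h3.and self_mem_nhdsWithin)).exists
    exact ⟨e, h4, h5, he⟩
  have hy : ∀ y, dist y x ≤ d - d' → m < densityh μ s y d' := by
    intro y hyx
    refine hd'.trans_le ?_
    unfold densityh
    refine ENNReal.div_le_div_left (measure_mono ?_) _
    exact closedBall_subset_closedBall' (by linarith)
  have hri := H.r0 i
  have hc0 := H.c0
  let A : ℝ → Set (EuclideanSpace ℝ (Fin n)) :=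
    fun δ => {y | y ∈ E ∧ ∀ r, 0 < r → r < δ → densityh μ s y r ≤ m}
  have hAE : ∀ δ, A δ ⊆ E := fun δ y hy => hy.1
  have hgood : ∀ δ ≤ c, ∀ j, ∀ z ∈ E, f j z ∈ A δ → z ∈ A (δ / ρ) := by
    intro δ hδ j z hz hfz
    refine ⟨hz, fun r h1 h2 => ?_⟩
    have hrj := H.r0 j
    have hρ := H.rρ j
    rw [lt_div_iff₀ H.ρ0] at h2
    have h3 : rr j * r < δ := by nlinarith
    rw [← H.scale j z hz r h1 (h3.trans_le hδ)]
    exact hfz.2 _ (by positivity) h3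
  have hanti : ∀ δ δ', δ ≤ δ' → A δ' ⊆ A δ := fun δ δ' h y hy =>
    ⟨hy.1, fun r h1 h2 => hy.2 r h1 (h2.trans_le h)⟩
  have hA0 : μ (A c) = 0 := by
    refine H.avoid_null (A c) (hAE c) (fun j z hz h => ?_) (f i x) (H.maps i x hx)
      (min (rr i * (d - d')) c) (lt_min (mul_pos hri (by linarith)) hc0) ?_
    · refine hanti c (c / ρ) ?_ (hgood c le_rfl j z hz h)
      rw [le_div_iff₀ H.ρ0]
      nlinarith [H.ρ1]
    · rw [disjoint_left]
      intro z hz hzb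
      rw [mem_ball, lt_min_iff] at hzb
      obtain ⟨j, y, hyE, rfl⟩ := H.inv z hz.1
      by_cases hji : j = i
      · subst hji
        rw [H.hsim] at hzb
        have h1 : dist y x ≤ d - d' := (lt_of_mul_lt_mul_left hzb.1 hri.le).le
        have h2 : rr j * d' < c := by nlinarith
        have h3 := hz.2 (rr j * d') (by positivity) h2
        rw [H.scale j y hyE d' hd'0 h2] at h3
        exact absurd (hy y h1) (not_lt.2 h3)
      · have := H.sep j i hji y hyE x hx
        linarith [hzb.2]
  have hAk : ∀ k : ℕ, μ (A (c * ρ ^ k)) = 0 := by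
    intro k
    induction k with
    | zero => simpa using hA0
    | succ k ih =>
      refine le_antisymm ((H.outer_le _ (hAE _)).trans ?_) bot_le
      refine (Finset.sum_eq_zero fun j _ => ?_).le
      have : μ (E ∩ f j ⁻¹' A (c * ρ ^ (k + 1))) = 0 := by
        refine measure_mono_null ?_ ih
        rintro z ⟨hz, hfz⟩
        have hle : c * ρ ^ (k + 1) ≤ c := by
          have : ρ ^ (k + 1) ≤ 1 := pow_le_one₀ H.ρ0.le H.ρ1.le
          nlinarith
        have := hgood _ hle j z hz hfz
        have e : c * ρ ^ (k + 1) / ρ = c * ρ ^ k := by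
          have := H.ρ0.ne'
          rw [pow_succ]
          field_simp
        rwa [e] at this
      rw [this, mul_zero]
  let B := ⋃ k : ℕ, A (c * ρ ^ k)
  have hB : μ B = 0 := measure_iUnion_null hAk
  have hEB : ∀ y ∈ E \ B, ∀ δ : ℝ, 0 < δ → ∃ r, 0 < r ∧ r < δ ∧ m ≤ densityh μ s y r := by
    rintro y ⟨hyE, hyB⟩ δ hδ
    by_contra hcon
    push Not at hcon
    obtain ⟨k, hk⟩ := exists_pow_lt_of_lt_one (show 0 < δ / c by positivity) H.ρ1
    rw [lt_div_iff₀ hc0] at hk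
    refine hyB (mem_iUnion.2 ⟨k, hyE, fun r h1 h2 => (hcon r h1 ?_).le⟩)
    linarith
  unfold packM
  refine le_iInf₂ fun U hU => ?_
  calc m = m * μ (E \ B) := by rw [measure_sdiff_null hB, H.μE, mul_one]
    _ ≤ m * μ (⋃ k, U k ∩ (E \ B)) := by
        refine mul_le_mul_right (measure_mono fun y hy => ?_) _
        obtain ⟨k, hk⟩ := mem_iUnion.1 (hU hy.1)
        exact mem_iUnion.2 ⟨k, hk, hy⟩
    _ ≤ m * ∑' k, μ (U k ∩ (E \ B)) := mul_le_mul_right (measure_iUnion_le _) _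
    _ = ∑' k, m * μ (U k ∩ (E \ B)) := ENNReal.tsum_mul_left.symm
    _ ≤ ∑' k, packPre0 s (U k) := by
        refine ENNReal.tsum_le_tsum fun k => ?_
        refine (H.packPre0_ge m (U k ∩ (E \ B)) (fun y hy => hEB y hy.2)).trans ?_
        unfold packPre0 packPre
        refine iInf₂_mono fun δ hδ => iSup_mono fun cen => iSup_mono fun rad => ?_
        refine iSup_le fun h => le_iSup_of_le (fun j => (h j).1) le_rfl

end SSHyp

theorem packing_measure_as_max_of_density
{n N : ℕ} (hN : 2 ≤ N)
    (f : Fin N → EuclideanSpace ℝ (Fin n) → EuclideanSpace ℝ (Fin n))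
    (rr : Fin N → ℝ) (hr : ∀ i, 0 < rr i ∧ rr i < 1)
    (hsim : ∀ i x y, dist (f i x) (f i y) = rr i * dist x y)
    (E : Set (EuclideanSpace ℝ (Fin n))) (hEne : E.Nonempty) (hEcp : IsCompact E)
    (hEinv : E = ⋃ i, f i '' E)
    (hssc : ∀ i j, i ≠ j → Disjoint (f i '' E) (f j '' E))
(hEdiam : Metric.diam E = 1)
(rmin : ℝ) (hrmin : IsLeast (Set.range rr) rmin)
(c : ℝ) (hc : 0 < c)
    (hcdef : c = sInf {d : ℝ | ∃ i j : Fin N, i ≠ j ∧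
      ∃ u ∈ f i '' E, ∃ v ∈ f j '' E, d = dist u v})
(s : ℝ) (hs : 0 < s) (hsum : ∑ i, rr i ^ s = 1)
    (μ : MeasureTheory.Measure (EuclideanSpace ℝ (Fin n))) (hμ : IsProbabilityMeasure μ)
    (hμss : ∀ A : Set (EuclideanSpace ℝ (Fin n)), MeasurableSet A →
      μ A = ∑ i, ENNReal.ofReal (rr i ^ s) * μ (f i ⁻¹' A))
    (a : ℝ) (ha : 0 < a) (ha' : a ≤ c / rmin) :
    IsGreatest {v : ℝ≥0∞ | ∃ x ∈ E, ∃ d : ℝ, 0 < d ∧ d ≤ a ∧ v = densityh μ s x d}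
      (packM s E) ∧
    IsGreatest {v : ℝ≥0∞ | ∃ x ∈ E, ∃ d : ℝ, a * rmin ≤ d ∧ d ≤ a ∧ v = densityh μ s x d}
      (packM s E) := by
  obtain ⟨⟨i0, hi0⟩, hleast⟩ := hrmin
  have hrle : ∀ i, rmin ≤ rr i := fun i => hleast ⟨i, rfl⟩
  have hr0 : 0 < rmin := hi0 ▸ (hr i0).1
  have hr1 : rmin ≤ 1 := hi0 ▸ (hr i0).2.le
  obtain ⟨i1, hi1⟩ := @Finite.exists_max _ _ _ ⟨i0⟩ _ rr
  have H : SSHyp f rr E c s (rr i1) μ :=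
    { r0 := fun i => (hr i).1
      rρ := hi1
      ρ0 := (hr i1).1
      ρ1 := (hr i1).2
      hsim := hsim
      cp := hEcp
      ne := hEne
      inv := by
        intro y hy
        rw [hEinv] at hy
        obtain ⟨i, x, hx, rfl⟩ := mem_iUnion.1 hy
        exact ⟨i, x, hx, rfl⟩
      maps := by
        intro i x hx
        rw [hEinv]
        exact mem_iUnion.2 ⟨i, x, hx, rfl⟩
      sep := by
        intro i j hij x hx y hy
        rw [hcdef]
        refine csInf_le ⟨0, ?_⟩ ⟨i, j, hij, _, ⟨x, hx, rfl⟩, _, ⟨y, hy, rfl⟩, rfl⟩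
        rintro d ⟨_, _, _, u, _, v, _, rfl⟩
        exact dist_nonneg
      c0 := hc
      diam := by
        intro x hx y hy
        rw [← hEdiam]
        exact Metric.dist_le_diam_of_mem hEcp.isBounded hx hy
      s0 := hs
      hsum := by
        rw [← ENNReal.ofReal_sum_of_nonneg (fun i _ => Real.rpow_nonneg (hr i).1.le s), hsum,
          ENNReal.ofReal_one]
      prob := hμ
      μss := hμss }
  have hnt := SSHyp.nontriv hEdiam
  rw [le_div_iff₀ hr0] at ha'
  obtain ⟨x0, hx0, d0, hd0, hd0a, hmax⟩ := H.exists_max a rmin ha hr0 hr1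
  have hred := H.reduce a rmin ha hr0 hrle ha' _ hmax
  have hd0pos : 0 < d0 := lt_of_lt_of_le (by positivity) hd0
  have hub : ∀ x ∈ E, ∀ d, 0 < d → d ≤ a → densityh μ s x d ≤ packM s E := by
    intro x hx d h1 h2
    refine H.le_packM i0 x hx d h1 ?_
    rw [hi0]
    nlinarith
  have heq : packM s E = densityh μ s x0 d0 :=
    le_antisymm (H.packM_le a ha _ hred) (hub x0 hx0 d0 hd0pos hd0a)
  refine ⟨⟨⟨x0, hx0, d0, hd0pos, hd0a, heq⟩, ?_⟩, ⟨⟨x0, hx0, d0, hd0, hd0a, heq⟩, ?_⟩⟩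
  · rintro v ⟨x, hx, d, h1, h2, rfl⟩
    exact hub x hx d h1 h2
  · rintro v ⟨x, hx, d, h1, h2, rfl⟩
    exact hub x hx d (lt_of_lt_of_le (by positivity) h1) h2
end

section
/- For every r ∈ (0, 1/3], the packing measure of the Sierpinski gasket S_r in its similarity dimension s(r) equals P^{s(r)}(S_r) = (2(1−r)/r)^{s(r)}. -/
open Metric Set MeasureTheory Filter Topology
open scoped ENNReal NNReal

namespace SG

/-- codes -/
abbrev Om := ℕ → Fin 3

/-- uniform measure on three letters -/
noncomputable def Q : Measure (Fin 3) := (PMF.uniformOfFintype (Fin 3)).toMeasure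

instance : IsProbabilityMeasure Q := by unfold Q; infer_instance

lemma Q_singleton (i : Fin 3) : Q {i} = 3⁻¹ := by
  simp [Q]

/-- Bernoulli measure -/
noncomputable def nu : Measure Om := Measure.infinitePi (fun _ : ℕ => Q)

instance : IsProbabilityMeasure nu := by unfold nu; infer_instance

/-- shift -/
def shift (σ : Om) : Om := fun n => σ (n + 1)

/-- prepend a letter -/
def cons (i : Fin 3) (σ : Om) : Om := fun n => Nat.casesOn n i σ

@[simp] lemma cons_zero (i : Fin 3) (σ : Om) : cons i σ 0 = i := rfl
@[simp] lemma cons_succ (i : Fin 3) (σ : Om) (n : ℕ) : cons i σ (n + 1) = σ n := rfl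
@[simp] lemma shift_cons (i : Fin 3) (σ : Om) : shift (cons i σ) = σ := rfl
lemma cons_shift (σ : Om) : cons (σ 0) (shift σ) = σ := by
  funext n; cases n <;> rfl

lemma measurable_shift : Measurable shift := by
  unfold shift; fun_prop

lemma measurable_cons : Measurable (fun x : Fin 3 × Om => cons x.1 x.2) := by
  refine measurable_pi_lambda _ fun n => ?_
  cases n with
  | zero => exact measurable_fst
  | succ n => exact (measurable_pi_apply n).comp measurable_snd

lemma map_cons : (Q.prod nu).map (fun x : Fin 3 × Om => cons x.1 x.2) = nu := by
  refine Measure.eq_infinitePi _ fun s t ht => ?_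
  classical
  obtain ⟨N, hN⟩ : ∃ N, s ⊆ Finset.range (N + 1) :=
    ⟨s.sup id, fun x hx => Finset.mem_range.2 (Nat.lt_succ_of_le (Finset.le_sup (f := id) hx))⟩
  set t' : ℕ → Set (Fin 3) := fun n => if n ∈ s then t n else univ with ht'
  have ht'm : ∀ n, MeasurableSet (t' n) := fun n => Set.Finite.measurableSet (Set.toFinite _)
  have h1 : Set.pi (s : Set ℕ) t = Set.pi (Finset.range (N + 1) : Set ℕ) t' := by
    ext σ
    simp only [Set.mem_pi, Finset.mem_coe, ht']
    constructor
    · intro h n _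
      split_ifs with hn
      · exact h n hn
      · trivial
    · intro h n hn
      have := h n (hN hn)
      rwa [if_pos hn] at this
  have h2 : ∏ i ∈ s, Q (t i) = ∏ i ∈ Finset.range (N + 1), Q (t' i) := by
    rw [← Finset.prod_subset hN]
    · exact Finset.prod_congr rfl fun i hi => by simp [ht', hi]
    · intro x _ hx
      simp [ht', hx]
  rw [h1, h2, Measure.map_apply measurable_cons
    (MeasurableSet.pi (Finset.countable_toSet _) fun i _ => ht'm i)]
  have h3 : (fun x : Fin 3 × Om => cons x.1 x.2) ⁻¹' (Set.pi (Finset.range (N + 1) : Set ℕ) t')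
      = t' 0 ×ˢ Set.pi (Finset.range N : Set ℕ) (fun n => t' (n + 1)) := by
    ext ⟨i, σ⟩
    simp only [Set.mem_preimage, Set.mem_pi, Finset.mem_coe, Finset.mem_range, Set.mem_prod]
    constructor
    · intro h
      exact ⟨h 0 (Nat.succ_pos _), fun n hn => h (n + 1) (Nat.succ_lt_succ hn)⟩
    · rintro ⟨h0, h⟩ n hn
      cases n with
      | zero => exact h0
      | succ n => exact h n (Nat.lt_of_succ_lt_succ hn)
  rw [h3, Measure.prod_prod, nu, Measure.infinitePi_pi _ (fun i _ => ht'm _),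
    Finset.prod_range_succ', mul_comm]

lemma cyl_meas (i : Fin 3) {A : Set Om} (hA : MeasurableSet A) :
    MeasurableSet {σ : Om | σ 0 = i ∧ shift σ ∈ A} :=
  (measurableSet_eq_fun (measurable_pi_apply 0) measurable_const).inter (measurable_shift hA)

lemma nu_cyl (i : Fin 3) {A : Set Om} (hA : MeasurableSet A) :
    nu {σ | σ 0 = i ∧ shift σ ∈ A} = 3⁻¹ * nu A := by
  have hm : MeasurableSet {σ : Om | σ 0 = i ∧ shift σ ∈ A} :=
    (measurableSet_eq_fun (measurable_pi_apply 0) measurable_const).inter (measurable_shift hA)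
  conv_lhs => rw [← map_cons]
  rw [Measure.map_apply measurable_cons hm]
  have : (fun x : Fin 3 × Om => cons x.1 x.2) ⁻¹' {σ | σ 0 = i ∧ shift σ ∈ A} = {i} ×ˢ A := by
    ext ⟨j, σ⟩; simp
  rw [this, Measure.prod_prod, Q_singleton]

lemma nu_shift {A : Set Om} (hA : MeasurableSet A) : nu (shift ⁻¹' A) = nu A := by
  conv_lhs => rw [← map_cons]
  rw [Measure.map_apply measurable_cons (measurable_shift hA)]
  have : (fun x : Fin 3 × Om => cons x.1 x.2) ⁻¹' (shift ⁻¹' A) = univ ×ˢ A := by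
    ext ⟨j, σ⟩; simp
  rw [this, Measure.prod_prod, measure_univ, one_mul]

lemma iter_shift (k : ℕ) (σ : Om) (n : ℕ) : shift^[k] σ n = σ (n + k) := by
  induction k generalizing σ with
  | zero => rfl
  | succ k ih => rw [Function.iterate_succ_apply, ih]; simp [shift, add_assoc]

lemma measurable_iter (k : ℕ) : Measurable (shift^[k]) := measurable_shift.iterate k

lemma nu_iter (k : ℕ) {A : Set Om} (hA : MeasurableSet A) : nu (shift^[k] ⁻¹' A) = nu A := by
  induction k with
  | zero => rfl
  | succ k ih =>
    rw [Function.iterate_succ, Set.preimage_comp, nu_shift (measurable_iter k hA), ih]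

lemma nu_run (m : ℕ) {A : Set Om} (hA : MeasurableSet A) :
    nu {σ | (∀ j < m, σ j = 0) ∧ shift^[m] σ ∈ A} = (3⁻¹) ^ m * nu A := by
  have hmeas : ∀ m : ℕ, MeasurableSet {σ : Om | (∀ j < m, σ j = 0) ∧ shift^[m] σ ∈ A} := by
    intro m
    refine MeasurableSet.inter ?_ (measurable_iter m hA)
    have : {σ : Om | ∀ j < m, σ j = 0} = ⋂ j, ⋂ (_ : j < m), {σ : Om | σ j = 0} := by
      ext; simp
    change MeasurableSet {σ : Om | ∀ j < m, σ j = 0}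
    rw [this]
    exact MeasurableSet.iInter fun j => MeasurableSet.iInter fun _ =>
      (measurable_pi_apply j) (measurableSet_singleton 0)
  induction m with
  | zero => simp
  | succ m ih =>
    have : {σ : Om | (∀ j < m + 1, σ j = 0) ∧ shift^[m + 1] σ ∈ A}
        = {σ | σ 0 = 0 ∧ shift σ ∈ {σ : Om | (∀ j < m, σ j = 0) ∧ shift^[m] σ ∈ A}} := by
      ext σ
      simp only [Set.mem_ofPred_eq, Function.iterate_succ_apply, ← and_assoc]
      refine and_congr_left fun _ => ?_
      constructor
      · intro h
        exact ⟨h 0 (Nat.succ_pos _), fun j hj => h (j + 1) (Nat.succ_lt_succ hj)⟩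
      · rintro ⟨h0, h⟩ j hj
        cases j with
        | zero => exact h0
        | succ j => exact h j (Nat.lt_of_succ_lt_succ hj)
    rw [this, nu_cyl 0 (hmeas m), ih, pow_succ', mul_assoc]

lemma norun_meas (m : ℕ) : MeasurableSet {σ : Om | ∃ k, ∀ j < m, σ (k + j) = 0} := by
  have : {σ : Om | ∃ k, ∀ j < m, σ (k + j) = 0}
      = ⋃ k, ⋂ j, ⋂ (_ : j < m), {σ : Om | σ (k + j) = 0} := by
    ext; simp
  rw [this]
  exact MeasurableSet.iUnion fun k => MeasurableSet.iInter fun j => MeasurableSet.iInter fun _ =>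
      (measurable_pi_apply (k + j)) (measurableSet_singleton 0)

lemma nu_norun (m : ℕ) : nu {σ : Om | ∃ k, ∀ j < m, σ (k + j) = 0}ᶜ = 0 := by
  set B := {σ : Om | ∃ k, ∀ j < m, σ (k + j) = 0}ᶜ with hB
  have hBm : MeasurableSet B := (norun_meas m).compl
  set D := {σ : Om | (∀ j < m, σ j = 0) ∧ shift^[m] σ ∈ B} with hD
  have hdisj : Disjoint B D := by
    rw [Set.disjoint_left]
    rintro σ hσ ⟨h, _⟩
    exact hσ ⟨0, by simpa using h⟩
  have hsub : B ∪ D ⊆ shift^[m] ⁻¹' B := by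
    rintro σ (hσ | hσ)
    · rintro ⟨k, hk⟩
      refine hσ ⟨k + m, fun j hj => ?_⟩
      have := hk j hj
      rw [iter_shift] at this
      rw [← this]; congr 1; ring
    · exact hσ.2
  have h := measure_mono (μ := nu) hsub
  rw [nu_iter m hBm, measure_union' hdisj hBm, hD, nu_run m hBm] at h
  have hfin : nu B ≠ ⊤ := measure_ne_top _ _
  have h0 : (3⁻¹ : ℝ≥0∞) ^ m * nu B ≤ 0 := by
    have : nu B + (3⁻¹ : ℝ≥0∞) ^ m * nu B ≤ nu B + 0 := by simpa using h
    exact (ENNReal.add_le_add_iff_left hfin).1 this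
  have h1 := mul_eq_zero.1 (le_antisymm h0 zero_le)
  rcases h1 with h1 | h1
  · exfalso
    exact (pow_ne_zero m (by simp : (3⁻¹ : ℝ≥0∞) ≠ 0)) h1
  · exact h1

/-- good codes: arbitrarily long runs of zeros arbitrarily far out -/
def good : Set Om := {σ | ∀ m n : ℕ, ∃ k, ∀ j < m, shift^[n] σ (k + j) = 0}

lemma nu_good : nu goodᶜ = 0 := by
  have : goodᶜ = ⋃ m : ℕ, ⋃ n : ℕ,
      shift^[n] ⁻¹' {σ : Om | ∃ k, ∀ j < m, σ (k + j) = 0}ᶜ := by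
    ext σ; simp [good]
  rw [this, measure_iUnion_null_iff]
  intro m
  rw [measure_iUnion_null_iff]
  intro n
  rw [nu_iter n (norun_meas m).compl, nu_norun]

end SG

namespace SG

/-- the plane -/
abbrev E2 := EuclideanSpace ℝ (Fin 2)

/-- vertices -/
noncomputable def pt : Fin 3 → E2 := ![0, !₂[1, 0], !₂[1/2, Real.sqrt 3 / 2]]

lemma pt_zero : pt 0 = 0 := rfl
lemma pt_one : pt 1 = !₂[1, 0] := rfl
lemma pt_two : pt 2 = !₂[1/2, Real.sqrt 3 / 2] := rfl

lemma dist_pt {i j : Fin 3} (h : i ≠ j) : dist (pt i) (pt j) = 1 := by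
  have h3 : (Real.sqrt 3) ^ 2 = 3 := Real.sq_sqrt (by norm_num)
  rw [EuclideanSpace.dist_eq, Real.sqrt_eq_one]
  fin_cases i <;> fin_cases j <;>
    simp [pt, Fin.sum_univ_two, Real.dist_eq] at h ⊢ <;> nlinarith

lemma dist_pt_le (i j : Fin 3) : dist (pt i) (pt j) ≤ 1 := by
  by_cases h : i = j
  · simp [h]
  · exact (dist_pt h).le

lemma norm_pt_le (i : Fin 3) : ‖pt i‖ ≤ 1 := by
  have := dist_pt_le i 0
  rwa [pt_zero, dist_zero_right] at this

lemma norm_pt {i : Fin 3} (h : i ≠ 0) : ‖pt i‖ = 1 := by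
  have := dist_pt h
  rwa [pt_zero, dist_zero_right] at this

lemma inner_pt (i j : Fin 3) : 0 ≤ inner ℝ (pt i) (pt j) := by
  fin_cases i <;> fin_cases j <;>
    simp [pt, PiLp.inner_apply, Fin.sum_univ_two]

/-- coding map -/
noncomputable def cod (r : ℝ) (σ : Om) : E2 := ∑' k, ((1 - r) * r ^ k) • pt (σ k)

lemma hasSum_geo {r : ℝ} (h0 : 0 < r) (h1 : r < 1) : HasSum (fun k : ℕ => (1 - r) * r ^ k) 1 := by
  have := (hasSum_geometric_of_lt_one h0.le h1).mul_left (1 - r)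
  rwa [mul_inv_cancel₀ (by linarith)] at this

lemma term_le {r : ℝ} (h0 : 0 < r) (h1 : r < 1) (σ : Om) (k : ℕ) : ‖((1 - r) * r ^ k) • pt (σ k)‖ ≤ (1 - r) * r ^ k := by
  have hp : 0 ≤ (1 - r) * r ^ k := mul_nonneg (by linarith) (pow_nonneg h0.le _)
  rw [norm_smul, Real.norm_of_nonneg hp]
  exact mul_le_of_le_one_right hp (norm_pt_le _)

lemma summable_cod {r : ℝ} (h0 : 0 < r) (h1 : r < 1) (σ : Om) : Summable (fun k => ((1 - r) * r ^ k) • pt (σ k)) :=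
  Summable.of_norm_bounded (hasSum_geo h0 h1).summable (term_le h0 h1 σ)

lemma cod_eq {r : ℝ} (h0 : 0 < r) (h1 : r < 1) (σ : Om) : cod r σ = r • cod r (shift σ) + (1 - r) • pt (σ 0) := by
  rw [cod, (summable_cod h0 h1 σ).tsum_eq_zero_add, add_comm]
  congr 1
  · rw [cod, ← (summable_cod h0 h1 (shift σ)).tsum_const_smul]
    refine tsum_congr fun k => ?_
    rw [smul_smul, shift]
    congr 1
    ring
  · simp

lemma cod_cons {r : ℝ} (h0 : 0 < r) (h1 : r < 1) (i : Fin 3) (σ : Om) : cod r (cons i σ) = r • cod r σ + (1 - r) • pt i := by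
  rw [cod_eq h0 h1]; simp

lemma continuous_cod {r : ℝ} (h0 : 0 < r) (h1 : r < 1) : Continuous (cod r) := by
  refine continuous_tsum (fun k => ?_) (hasSum_geo h0 h1).summable
    (fun k σ => term_le h0 h1 σ k)
  have : Continuous pt := continuous_of_discreteTopology
  have hk : Continuous (fun σ : Om => σ k) := continuous_apply k
  exact (this.comp hk).const_smul ((1 - r) * r ^ k)

lemma dist_cod_le {r : ℝ} (h0 : 0 < r) (h1 : r < 1) (σ τ : Om) : dist (cod r σ) (cod r τ) ≤ 1 := by
  rw [dist_eq_norm, cod, cod, ← (summable_cod h0 h1 σ).tsum_sub (summable_cod h0 h1 τ)]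
  refine tsum_of_norm_bounded (hasSum_geo h0 h1) fun k => ?_
  have hp : 0 ≤ (1 - r) * r ^ k := mul_nonneg (by linarith) (pow_nonneg h0.le _)
  rw [← smul_sub, norm_smul, Real.norm_of_nonneg hp, ← dist_eq_norm]
  exact mul_le_of_le_one_right hp (dist_pt_le _ _)

lemma norm_cod_le {r : ℝ} (h0 : 0 < r) (h1 : r < 1) (σ : Om) : ‖cod r σ‖ ≤ 1 :=
  tsum_of_norm_bounded (hasSum_geo h0 h1) (term_le h0 h1 σ)

lemma inner_cod {r : ℝ} (h0 : 0 < r) (h1 : r < 1) (i : Fin 3) (σ : Om) : 0 ≤ inner ℝ (pt i) (cod r σ) := by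
  have h := (summable_cod h0 h1 σ).hasSum.mapL (innerSL ℝ (pt i))
  refine h.nonneg fun k => ?_
  have hp : 0 ≤ (1 - r) * r ^ k := mul_nonneg (by linarith) (pow_nonneg h0.le _)
  simp only [innerSL_apply_apply, inner_smul_right]
  exact mul_nonneg hp (inner_pt _ _)

lemma cod_const {r : ℝ} (h0 : 0 < r) (h1 : r < 1) (i : Fin 3) : cod r (fun _ => i) = pt i := by
  have := (hasSum_geo h0 h1).smul_const (pt i)
  rw [one_smul] at this
  exact this.tsum_eq

lemma attr_subset {r : ℝ} (h0 : 0 < r) (h1 : r < 1) {A B : Set E2} (hA : IsCompact A) (hB : IsClosed B) (hBn : B.Nonempty)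
    (hA' : ∀ x ∈ A, ∃ i, ∃ u ∈ A, x = r • u + (1 - r) • pt i)
    (hB' : ∀ u ∈ B, ∀ i, r • u + (1 - r) • pt i ∈ B) : A ⊆ B := by
  intro a ha
  obtain ⟨x, hx, hmax⟩ := hA.exists_isMaxOn ⟨a, ha⟩ (continuous_infDist_pt B).continuousOn
  obtain ⟨i, u, hu, rfl⟩ := hA' x hx
  have hstep : infDist (r • u + (1 - r) • pt i) B ≤ r * infDist u B := by
    rw [mul_comm, ← div_le_iff₀ h0, le_infDist hBn]
    intro y hy
    rw [div_le_iff₀ h0]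
    refine (infDist_le_dist_of_mem (hB' y hy i)).trans ?_
    rw [dist_add_right, dist_smul₀, Real.norm_of_nonneg h0.le, mul_comm]
  have h2 : infDist u B ≤ infDist (r • u + (1 - r) • pt i) B := hmax hu
  have h3 : infDist a B ≤ infDist (r • u + (1 - r) • pt i) B := hmax ha
  have h4 : 0 ≤ infDist u B := infDist_nonneg
  have h5 : infDist u B ≤ 0 := by nlinarith
  have h6 : infDist a B = 0 := le_antisymm (by nlinarith) infDist_nonneg
  exact (hB.mem_iff_infDist_zero hBn).2 h6

lemma attr_eq {r : ℝ} (h0 : 0 < r) (h1 : r < 1) {S : Set E2} (hSne : S.Nonempty) (hScp : IsCompact S)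
    (hinv : S = (fun v => r • v) '' S ∪
        (fun v => r • v + (WithLp.equiv 2 (Fin 2 → ℝ)).symm ![1 - r, 0]) '' S ∪
        (fun v => r • v +
          (1 - r) • (WithLp.equiv 2 (Fin 2 → ℝ)).symm ![1/2, Real.sqrt 3 / 2]) '' S) :
    S = range (cod r) := by
  have e1 : (WithLp.equiv 2 (Fin 2 → ℝ)).symm ![1 - r, 0] = (1 - r) • pt 1 := by
    ext i; fin_cases i <;> simp [pt]
  have e2 : (1 - r) • (WithLp.equiv 2 (Fin 2 → ℝ)).symm ![1/2, Real.sqrt 3 / 2]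
      = (1 - r) • pt 2 := rfl
  rw [e1, e2] at hinv
  have hK : IsCompact (range (cod r)) := isCompact_range (continuous_cod h0 h1)
  refine Subset.antisymm (attr_subset h0 h1 hScp hK.isClosed (range_nonempty _) ?_ ?_)
    (attr_subset h0 h1 hK hScp.isClosed hSne ?_ ?_)
  · intro x hx
    rw [hinv] at hx
    rcases hx with (⟨u, hu, rfl⟩ | ⟨u, hu, rfl⟩) | ⟨u, hu, rfl⟩
    · exact ⟨0, u, hu, by simp [pt_zero]⟩
    · exact ⟨1, u, hu, rfl⟩
    · exact ⟨2, u, hu, rfl⟩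
  · rintro _ ⟨σ, rfl⟩ i
    exact ⟨cons i σ, cod_cons h0 h1 i σ⟩
  · rintro _ ⟨σ, rfl⟩
    exact ⟨σ 0, _, ⟨shift σ, rfl⟩, cod_eq h0 h1 σ⟩
  · intro u hu i
    rw [hinv]
    fin_cases i
    · exact Or.inl (Or.inl ⟨u, hu, by simp [pt_zero]⟩)
    · exact Or.inl (Or.inr ⟨u, hu, rfl⟩)
    · exact Or.inr ⟨u, hu, rfl⟩

end SG

namespace SG

lemma packPre_mono {s δ : ℝ} {A B : Set E2} (h : A ⊆ B) : packPre s δ A ≤ packPre s δ B := by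
  unfold packPre
  refine iSup_mono fun cen => iSup_mono fun rad => iSup_le fun hc => ?_
  exact le_iSup_of_le (fun i => h (hc i)) le_rfl

lemma packPre0_mono {s : ℝ} {A B : Set E2} (h : A ⊆ B) : packPre0 s A ≤ packPre0 s B :=
  iInf_mono fun _ => iInf_mono fun _ => packPre_mono h

lemma packPre0_empty {s : ℝ} : packPre0 s (∅ : Set E2) = 0 := by
  refine le_antisymm ?_ zero_le
  refine (iInf₂_le (1 : ℝ) one_pos).trans ?_
  unfold packPre
  refine iSup_le fun cen => iSup_le fun rad => iSup_le fun hc => ?_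
  exact absurd (hc 0) (Set.notMem_empty _)

lemma sum_le_packPre {ι : Type*} [Countable ι] {s δ : ℝ} (hδ : 0 < δ) {A : Set E2}
    (hA : A.Nonempty)
    (cen : ι → E2) (rad : ι → ℝ) (hc : ∀ i, cen i ∈ A) (hr : ∀ i, 0 ≤ rad i)
    (hd : ∀ i, 2 * rad i ≤ δ)
    (hdisj : Pairwise fun i j => Disjoint (closedBall (cen i) (rad i)) (closedBall (cen j) (rad j))) :
    ∑' i, ENNReal.ofReal ((2 * rad i) ^ s) ≤ packPre s δ A := by
  obtain ⟨e, he⟩ := exists_injective_nat ι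
  obtain ⟨a0, ha0⟩ := hA
  set C : ℕ → E2 := Function.extend e cen (fun _ => a0) with hC
  set R : ℕ → ℝ := Function.extend e rad (fun _ => -1) with hR
  have key : ∀ n, (∃ i, e i = n) ∨ (C n = a0 ∧ R n = -1) := by
    intro n
    by_cases h : ∃ i, e i = n
    · exact Or.inl h
    · exact Or.inr ⟨Function.extend_apply' _ _ _ h, Function.extend_apply' _ _ _ h⟩
  have hCe : ∀ i, C (e i) = cen i := fun i => he.extend_apply _ _ _
  have hRe : ∀ i, R (e i) = rad i := fun i => he.extend_apply _ _ _
  have hemp : ∀ n, R n = -1 → closedBall (C n) (R n) = ∅ := by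
    intro n hn; rw [hn, closedBall_eq_empty]; norm_num
  have hmain : ∑' n, ENNReal.ofReal (Metric.diam (closedBall (C n) (R n)) ^ s) ≤ packPre s δ A := by
    unfold packPre
    refine le_iSup_of_le C (le_iSup_of_le R (le_iSup_of_le ?_ (le_iSup_of_le ?_
      (le_iSup_of_le ?_ le_rfl))))
    · intro n
      rcases key n with ⟨i, rfl⟩ | ⟨h, _⟩
      · rw [hCe]; exact hc i
      · rw [h]; exact ha0
    · intro n
      rcases key n with ⟨i, rfl⟩ | ⟨_, h⟩
      · rw [hCe, hRe, diam_closedBall_eq _ (hr i)]; exact hd i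
      · rw [hemp n h, diam_empty]; exact hδ.le
    · intro n m hnm
      rcases key n with ⟨i, rfl⟩ | ⟨_, h⟩
      · rcases key m with ⟨j, rfl⟩ | ⟨_, h'⟩
        · have : i ≠ j := fun h => hnm (by rw [h])
          simp only [hCe, hRe]
          exact hdisj this
        · simp only [hemp m h']; exact disjoint_empty _
      · simp only [hemp n h]; exact empty_disjoint _
  refine le_trans ?_ hmain
  refine le_trans (le_of_eq ?_) (ENNReal.tsum_comp_le_tsum_of_injective he _)
  refine tsum_congr fun i => ?_
  rw [hCe, hRe, diam_closedBall_eq _ (hr i)]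

lemma le_packPre0 {s : ℝ} (μ : Measure E2) [SFinite μ] (c : ℝ≥0∞) (A : Set E2)
    (h : ∀ x ∈ A, ∀ δ > 0, ∃ ρ ∈ Ioo (0:ℝ) δ,
      c * μ (closedBall x ρ) ≤ ENNReal.ofReal ((2 * ρ) ^ s)) :
    c * μ A ≤ packPre0 s A := by
  refine le_iInf₂ fun δ hδ => ?_
  rcases A.eq_empty_or_nonempty with rfl | hA
  · simp
  obtain ⟨t, R, htc, htA, htR, hcov, hdisj⟩ := Besicovitch.exists_disjoint_closedBall_covering_ae μ
    (fun x => {ρ | c * μ (closedBall x ρ) ≤ ENNReal.ofReal ((2 * ρ) ^ s)}) A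
    (fun x hx δ hδ => by
      obtain ⟨ρ, h1, h2⟩ := h x hx δ hδ
      exact ⟨ρ, h2, h1⟩) (fun _ => δ / 2) (fun _ _ => by positivity)
  have : Countable t := htc.to_subtype
  have h1 : μ A ≤ ∑' x : t, μ (closedBall (x : E2) (R x)) := by
    have hsub : A ⊆ (A \ ⋃ x ∈ t, closedBall x (R x)) ∪ ⋃ x ∈ t, closedBall x (R x) := by
      intro x hx
      by_cases hx' : x ∈ ⋃ x ∈ t, closedBall x (R x)
      · exact Or.inr hx'
      · exact Or.inl ⟨hx, hx'⟩
    refine (measure_mono hsub).trans ((measure_union_le _ _).trans ?_)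
    rw [hcov, zero_add]
    exact measure_biUnion_le μ htc _
  calc c * μ A ≤ c * ∑' x : t, μ (closedBall (x : E2) (R x)) := by gcongr
    _ = ∑' x : t, c * μ (closedBall (x : E2) (R x)) := ENNReal.tsum_mul_left.symm
    _ ≤ ∑' x : t, ENNReal.ofReal ((2 * R x) ^ s) :=
        ENNReal.tsum_le_tsum fun x => (htR x x.2).1
    _ ≤ packPre s δ A := by
        refine sum_le_packPre hδ hA (fun x : t => (x : E2)) (fun x => R x) (fun x => htA x.2)
          (fun x => (htR x x.2).2.1.le) (fun x => ?_) ?_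
        · have := (htR x x.2).2.2
          linarith
        · intro x y hxy
          exact hdisj x.2 y.2 (fun h => hxy (Subtype.ext h))

lemma packM_le {s : ℝ} (hs : 0 < s) (μ : Measure E2) [IsProbabilityMeasure μ] (c : ℝ≥0∞)
    (A : Set E2)
    (h : ∀ x ∈ A, ∀ ρ, 0 ≤ ρ → ρ ≤ 1 →
      ENNReal.ofReal ((2 * ρ) ^ s) ≤ c * μ (closedBall x ρ)) :
    packM s A ≤ c := by
  have h1 : packPre s 1 A ≤ c := by
    unfold packPre
    refine iSup_le fun cen => iSup_le fun rad => iSup_le fun hc => iSup_le fun hd =>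
      iSup_le fun hdisj => ?_
    calc ∑' i, ENNReal.ofReal (Metric.diam (closedBall (cen i) (rad i)) ^ s)
        ≤ ∑' i, c * μ (closedBall (cen i) (rad i)) := by
          refine ENNReal.tsum_le_tsum fun i => ?_
          rcases lt_or_ge (rad i) 0 with hi | hi
          · rw [closedBall_eq_empty.2 hi, diam_empty, Real.zero_rpow hs.ne']
            simp
          · have hdi := hd i
            rw [diam_closedBall_eq _ hi] at hdi ⊢
            exact h _ (hc i) _ hi (by linarith)
      _ = c * ∑' i, μ (closedBall (cen i) (rad i)) := ENNReal.tsum_mul_left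
      _ ≤ c * μ univ := by
          gcongr
          exact tsum_measure_le_measure_univ
            (fun i => isClosed_closedBall.measurableSet.nullMeasurableSet)
            (fun i j hij => (hdisj hij).aedisjoint)
      _ = c := by simp
  unfold packM
  refine (iInf₂_le (fun n : ℕ => if n = 0 then A else ∅) ?_).trans ?_
  · exact fun x hx => mem_iUnion.2 ⟨0, by simpa using hx⟩
  · rw [tsum_eq_single 0]
    · simp only [if_true]
      exact (iInf₂_le (1 : ℝ) one_pos).trans h1
    · intro n hn
      simp only [if_neg hn]
      exact packPre0_empty

lemma le_packM {s : ℝ} (μ : Measure E2) [SFinite μ] (c : ℝ≥0∞) (S G : Set E2)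
    (hGS : G ⊆ S)
    (h : ∀ x ∈ G, ∀ δ > 0, ∃ ρ ∈ Ioo (0:ℝ) δ,
      c * μ (closedBall x ρ) ≤ ENNReal.ofReal ((2 * ρ) ^ s)) :
    c * μ G ≤ packM s S := by
  refine le_iInf₂ fun U hU => ?_
  calc c * μ G ≤ c * ∑' i, μ (U i ∩ G) := by
        gcongr
        refine (measure_mono ?_).trans (measure_iUnion_le _)
        intro x hx
        obtain ⟨i, hi⟩ := mem_iUnion.1 (hU (hGS hx))
        exact mem_iUnion.2 ⟨i, hi, hx⟩
    _ = ∑' i, c * μ (U i ∩ G) := ENNReal.tsum_mul_left.symm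
    _ ≤ ∑' i, packPre0 s (U i) := ENNReal.tsum_le_tsum fun i =>
        (le_packPre0 μ c _ fun x hx => h x hx.2).trans (packPre0_mono inter_subset_left)

end SG

namespace SG

lemma ball_meas {r : ℝ} (h0 : 0 < r) (h1 : r < 1) (x : E2) (d : ℝ) :
    MeasurableSet (cod r ⁻¹' closedBall x d) :=
  (isClosed_closedBall.preimage (continuous_cod h0 h1)).measurableSet

lemma real_cyl (i : Fin 3) {A : Set Om} (hA : MeasurableSet A) :
    nu.real {σ | σ 0 = i ∧ shift σ ∈ A} = 1 / 3 * nu.real A := by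
  rw [measureReal_def, nu_cyl i hA, ENNReal.toReal_mul, measureReal_def]
  simp

lemma real_letter (i : Fin 3) : nu.real {σ | σ 0 = i} = 1 / 3 := by
  have := real_cyl i (A := univ) MeasurableSet.univ
  simpa using this

lemma lower_mass {r s : ℝ} (h0 : 0 < r) (hr : r ≤ 1 / 3) (hs0 : 0 < s) (hs1 : s ≤ 1)
    (hrs : r ^ s = 1 / 3) (n : ℕ) : ∀ (τ : Om) (d : ℝ), 0 ≤ d → d ≤ 1 →
      (d / (1 - r)) ^ s / 3 - (1 / 3) ^ n ≤ nu.real (cod r ⁻¹' closedBall (cod r τ) d) := by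
  have h1 : r < 1 := by linarith
  have hr1 : 0 < 1 - r := by linarith
  have hscale : ∀ d, 0 ≤ d → (d / r / (1 - r)) ^ s = 3 * (d / (1 - r)) ^ s := by
    intro d hd
    rw [div_right_comm, Real.div_rpow (div_nonneg hd hr1.le) h0.le, hrs]
    ring
  induction n with
  | zero =>
    intro τ d hd hd1
    have : (d / (1 - r)) ^ s ≤ 3 := by
      have hx : d / (1 - r) ≤ 3 := by
        rw [div_le_iff₀ hr1]; linarith
      calc (d / (1 - r)) ^ s ≤ 3 ^ s := Real.rpow_le_rpow (div_nonneg hd hr1.le) hx hs0.le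
        _ ≤ 3 ^ (1:ℝ) := Real.rpow_le_rpow_of_exponent_le (by norm_num) hs1
        _ = 3 := by simp
    have h2 : 0 ≤ nu.real (cod r ⁻¹' closedBall (cod r τ) d) := measureReal_nonneg
    simp only [pow_zero]
    linarith
  | succ n ih =>
    intro τ d hd hd1
    have hpow : (1 / 3 : ℝ) ^ (n + 1) = (1 / 3) ^ n / 3 := by rw [pow_succ]; ring
    have hpos : (0:ℝ) < (1 / 3) ^ n := by positivity
    rcases lt_or_ge d r with hdr | hdr
    · -- small radius: rescale
      have hih := ih (shift τ) (d / r) (div_nonneg hd h0.le) ((div_le_one h0).2 hdr.le)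
      rw [hscale d hd] at hih
      have hsub : {σ | σ 0 = τ 0 ∧ shift σ ∈ cod r ⁻¹' closedBall (cod r (shift τ)) (d / r)}
          ⊆ cod r ⁻¹' closedBall (cod r τ) d := by
        rintro σ ⟨hσ0, hσ⟩
        rw [mem_preimage, mem_closedBall] at hσ ⊢
        rw [cod_eq h0 h1 σ, cod_eq h0 h1 τ, hσ0, dist_add_right, dist_smul₀,
          Real.norm_of_nonneg h0.le]
        rw [le_div_iff₀ h0] at hσ
        linarith
      have hm := measureReal_mono (μ := nu) hsub
      rw [real_cyl _ (ball_meas h0 h1 _ _)] at hm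
      rw [hpow]
      linarith
    · have hsub1 : {σ : Om | σ 0 = τ 0} ⊆ cod r ⁻¹' closedBall (cod r τ) d := by
        intro σ hσ
        have hσ0 : σ 0 = τ 0 := hσ
        rw [mem_preimage, mem_closedBall, cod_eq h0 h1 σ, cod_eq h0 h1 τ, hσ0, dist_add_right,
          dist_smul₀, Real.norm_of_nonneg h0.le]
        have := dist_cod_le h0 h1 (shift σ) (shift τ)
        nlinarith
      rcases le_or_gt d (1 - r) with hd2 | hd2
      · have hm := measureReal_mono (μ := nu) hsub1
        rw [real_letter] at hm
        have : (d / (1 - r)) ^ s ≤ 1 :=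
          Real.rpow_le_one (div_nonneg hd hr1.le) ((div_le_one hr1).2 hd2) hs0.le
        rw [hpow]
        linarith
      · obtain ⟨j, hj⟩ : ∃ j : Fin 3, j ≠ τ 0 := exists_ne _
        set e := d - (1 - r) with he
        have he0 : 0 ≤ e := by linarith
        have hih := ih (fun _ => τ 0) (e / r) (div_nonneg he0 h0.le)
          ((div_le_one h0).2 (by linarith))
        rw [hscale e he0, cod_const h0 h1] at hih
        set A := {σ | σ 0 = j ∧ shift σ ∈ cod r ⁻¹' closedBall (pt (τ 0)) (e / r)} with hA
        have hAm : MeasurableSet A := cyl_meas j (ball_meas h0 h1 _ _)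
        have hsub2 : A ⊆ cod r ⁻¹' closedBall (cod r τ) d := by
          rintro σ ⟨hσ0, hσ⟩
          rw [mem_preimage, mem_closedBall, le_div_iff₀ h0] at hσ
          rw [mem_preimage, mem_closedBall, cod_eq h0 h1 σ, cod_eq h0 h1 τ, hσ0]
          have t1 : dist (cod r (shift τ)) (pt j) ≤ 1 := by
            rw [← cod_const h0 h1 j]; exact dist_cod_le h0 h1 _ _
          have t2 := dist_pt_le j (τ 0)
          have e1 : r • cod r (shift σ) + (1 - r) • pt j
              - (r • cod r (shift τ) + (1 - r) • pt (τ 0))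
              = r • (cod r (shift σ) - pt (τ 0)) + (r • (pt j - cod r (shift τ))
                + (1 - 2 * r) • (pt j - pt (τ 0))) := by module
          rw [dist_eq_norm, e1]
          refine (norm_add_le _ _).trans ((add_le_add_right (norm_add_le _ _) _).trans ?_)
          rw [norm_smul, norm_smul, norm_smul, Real.norm_of_nonneg h0.le,
            Real.norm_of_nonneg (by linarith : (0:ℝ) ≤ 1 - 2 * r), ← dist_eq_norm, ← dist_eq_norm,
            ← dist_eq_norm, dist_comm (pt j) (cod r (shift τ))]
          nlinarith
        have hdisj : Disjoint {σ : Om | σ 0 = τ 0} A := by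
          rw [Set.disjoint_left]
          rintro σ hσ ⟨hσ', _⟩
          exact hj (hσ'.symm.trans hσ)
        have hm := measureReal_mono (μ := nu) (union_subset hsub1 hsub2)
        rw [measureReal_union hdisj hAm, real_letter, hA, real_cyl _ (ball_meas h0 h1 _ _)] at hm
        have hadd : (d / (1 - r)) ^ s ≤ 1 + (e / (1 - r)) ^ s := by
          have : d / (1 - r) = 1 + e / (1 - r) := by
            rw [he]; field_simp; ring
          rw [this]
          refine (Real.rpow_add_le_add_rpow zero_le_one (div_nonneg he0 hr1.le) hs0.le hs1).trans ?_
          simp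
        rw [hpow]
        linarith

lemma lower_mass' {r s : ℝ} (h0 : 0 < r) (hr : r ≤ 1 / 3) (hs0 : 0 < s) (hs1 : s ≤ 1)
    (hrs : r ^ s = 1 / 3) (τ : Om) (d : ℝ) (hd : 0 ≤ d) (hd1 : d ≤ 1) :
      (d / (1 - r)) ^ s / 3 ≤ nu.real (cod r ⁻¹' closedBall (cod r τ) d) := by
  have ht : Tendsto (fun n : ℕ => (d / (1 - r)) ^ s / 3 - (1 / 3 : ℝ) ^ n) atTop
      (𝓝 ((d / (1 - r)) ^ s / 3 - 0)) :=
    tendsto_const_nhds.sub (tendsto_pow_atTop_nhds_zero_of_lt_one (by norm_num) (by norm_num))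
  rw [sub_zero] at ht
  exact le_of_tendsto' ht fun n => lower_mass h0 hr hs0 hs1 hrs n τ d hd hd1

lemma sep {r : ℝ} (h0 : 0 < r) (h1 : r < 1) {σ τ : Om} (h : σ 0 ≠ τ 0) :
    1 - 2 * r ≤ dist (cod r σ) (cod r τ) := by
  have e1 : (1 - r) • (pt (σ 0) - pt (τ 0)) = (cod r σ - cod r τ)
      - r • (cod r (shift σ) - cod r (shift τ)) := by
    rw [cod_eq h0 h1 σ, cod_eq h0 h1 τ]; module
  have e2 := congrArg norm e1
  rw [norm_smul, Real.norm_of_nonneg (by linarith), ← dist_eq_norm, dist_pt h] at e2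
  have e3 := norm_sub_le (cod r σ - cod r τ) (r • (cod r (shift σ) - cod r (shift τ)))
  rw [← e2, norm_smul, Real.norm_of_nonneg h0.le, ← dist_eq_norm, ← dist_eq_norm] at e3
  have := dist_cod_le h0 h1 (shift σ) (shift τ)
  nlinarith

lemma norm_run {r : ℝ} (h0 : 0 < r) (h1 : r < 1) (m : ℕ) (τ : Om) (h : ∀ j < m, τ j = 0) :
    ‖cod r τ‖ ≤ r ^ m := by
  induction m generalizing τ with
  | zero => simpa using norm_cod_le h0 h1 τ
  | succ m ih =>
    have := ih (shift τ) fun j hj => h (j + 1) (Nat.succ_lt_succ hj)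
    rw [cod_eq h0 h1, h 0 (Nat.succ_pos _), pt_zero, smul_zero, add_zero, norm_smul,
      Real.norm_of_nonneg h0.le, pow_succ']
    exact mul_le_mul_of_nonneg_left this h0.le

lemma norm_ge {r : ℝ} (h0 : 0 < r) (h1 : r < 1) (σ : Om) (h : σ 0 ≠ 0) :
    1 - r ≤ ‖cod r σ‖ := by
  have hn := norm_pt h
  have h2 : inner ℝ (pt (σ 0)) (cod r σ) ≤ ‖cod r σ‖ := by
    have := real_inner_le_norm (pt (σ 0)) (cod r σ)
    rwa [hn, one_mul] at this
  refine le_trans ?_ h2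
  rw [cod_eq h0 h1 σ, inner_add_right, inner_smul_right, inner_smul_right,
    real_inner_self_eq_norm_sq, hn]
  have := mul_nonneg h0.le (inner_cod h0 h1 (σ 0) (shift σ))
  linarith

lemma mass_scale {r : ℝ} (h0 : 0 < r) (hr : r ≤ 1 / 3) {d : ℝ} (hd0 : 0 < d) (hd : d < 1 - r)
    (k : ℕ) : ∀ τ : Om, nu (cod r ⁻¹' closedBall (cod r τ) (r ^ k * d))
      ≤ (3⁻¹) ^ k * nu (cod r ⁻¹' closedBall (cod r (shift^[k] τ)) d) := by
  have h1 : r < 1 := by linarith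
  induction k with
  | zero => intro τ; simp
  | succ k ih =>
    intro τ
    have hsub : cod r ⁻¹' closedBall (cod r τ) (r ^ (k + 1) * d) ⊆
        {σ | σ 0 = τ 0 ∧ shift σ ∈ cod r ⁻¹' closedBall (cod r (shift τ)) (r ^ k * d)} := by
      intro σ hσ
      rw [mem_preimage, mem_closedBall] at hσ
      have hσ0 : σ 0 = τ 0 := by
        by_contra hne
        have h2 := sep h0 h1 hne
        have h3 : r ^ k ≤ 1 := pow_le_one₀ h0.le h1.le
        have h4 : r ^ (k + 1) * d ≤ r * d := by
          rw [pow_succ, mul_assoc]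
          exact mul_le_of_le_one_left (by positivity) h3
        nlinarith
      refine ⟨hσ0, ?_⟩
      rw [cod_eq h0 h1 σ, cod_eq h0 h1 τ, hσ0, dist_add_right, dist_smul₀,
          Real.norm_of_nonneg h0.le, pow_succ', mul_assoc] at hσ
      exact le_of_mul_le_mul_left hσ h0
    refine (measure_mono hsub).trans ?_
    rw [nu_cyl _ (ball_meas h0 h1 _ _), Function.iterate_succ_apply, pow_succ', mul_assoc]
    gcongr
    exact ih (shift τ)

lemma good_density {r s : ℝ} (h0 : 0 < r) (hr : r ≤ 1 / 3) (hrs : r ^ s = 1 / 3)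
    {d : ℝ} (hd0 : 0 < d) (hd : d < 1 - r)
    {τ : Om} (hτ : τ ∈ good) {δ : ℝ} (hδ : 0 < δ) :
    ∃ ρ ∈ Ioo (0:ℝ) δ, ENNReal.ofReal (3 * (2 * d) ^ s) * nu (cod r ⁻¹' closedBall (cod r τ) ρ)
      ≤ ENNReal.ofReal ((2 * ρ) ^ s) := by
  have h1 : r < 1 := by linarith
  have hlim := tendsto_pow_atTop_nhds_zero_of_lt_one h0.le h1
  obtain ⟨m, hm⟩ := (hlim.eventually (gt_mem_nhds (sub_pos.2 hd))).exists
  obtain ⟨n, hn⟩ := (hlim.eventually (gt_mem_nhds (div_pos hδ hd0))).exists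
  obtain ⟨k, hk⟩ := hτ m n
  set N := k + n with hN
  refine ⟨r ^ N * d, ⟨by positivity, ?_⟩, ?_⟩
  · have : r ^ N ≤ r ^ n := pow_le_pow_of_le_one h0.le h1.le (by omega)
    rw [lt_div_iff₀ hd0] at hn
    nlinarith
  · have hrun : ∀ j < m, shift^[N] τ j = 0 := by
      intro j hj
      have := hk j hj
      rw [iter_shift] at this ⊢
      rw [← this]; congr 1; omega
    have hsub : cod r ⁻¹' closedBall (cod r (shift^[N] τ)) d ⊆
        {σ : Om | σ 0 = 0 ∧ shift σ ∈ (univ : Set Om)} := by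
      intro σ hσ
      refine ⟨?_, trivial⟩
      by_contra hne
      have a1 := norm_ge h0 h1 σ hne
      have a2 := norm_run h0 h1 m _ hrun
      rw [mem_preimage, mem_closedBall, dist_eq_norm] at hσ
      have a3 := norm_sub_norm_le (cod r σ) (cod r (shift^[N] τ))
      linarith
    have hmass : nu (cod r ⁻¹' closedBall (cod r τ) (r ^ N * d)) ≤ (3⁻¹) ^ N * 3⁻¹ := by
      refine (mass_scale h0 hr hd0 hd N τ).trans ?_
      gcongr
      refine (measure_mono hsub).trans ?_
      rw [nu_cyl 0 MeasurableSet.univ, measure_univ, mul_one]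
    have h3 : (3⁻¹ : ℝ≥0∞) = ENNReal.ofReal (1 / 3) := by
      rw [one_div, ENNReal.ofReal_inv_of_pos (by norm_num)]; simp
    calc _ ≤ ENNReal.ofReal (3 * (2 * d) ^ s) * ((3⁻¹) ^ N * 3⁻¹) := by gcongr
      _ = ENNReal.ofReal ((2 * (r ^ N * d)) ^ s) := by
        rw [h3, ← ENNReal.ofReal_pow (by norm_num), ← ENNReal.ofReal_mul (by positivity),
          ← ENNReal.ofReal_mul (by positivity)]
        congr 1
        have : (2 * (r ^ N * d)) = r ^ N * (2 * d) := by ring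
        rw [this, Real.mul_rpow (x := r ^ N) (by positivity) (by positivity), ← Real.rpow_natCast r N,
          ← Real.rpow_mul h0.le, mul_comm (N : ℝ) s, Real.rpow_mul h0.le, hrs, Real.rpow_natCast]
        ring

lemma main {r s : ℝ} (h0 : 0 < r) (hr : r ≤ 1 / 3) (hs0 : 0 < s) (hs1 : s ≤ 1)
    (hrs : r ^ s = 1 / 3) :
    packM s (range (cod r)) = ENNReal.ofReal (3 * (2 * (1 - r)) ^ s) := by
  have h1 : r < 1 := by linarith
  have hr1 : 0 < 1 - r := by linarith
  have hmc : Measurable (cod r) := (continuous_cod h0 h1).measurable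
  have hpm : IsProbabilityMeasure (nu.map (cod r)) :=
    Measure.isProbabilityMeasure_map hmc.aemeasurable
  have hball : ∀ x d, nu.map (cod r) (closedBall x d) = nu (cod r ⁻¹' closedBall x d) :=
    fun x d => Measure.map_apply hmc isClosed_closedBall.measurableSet
  refine le_antisymm ?_ ?_
  · refine packM_le hs0 (nu.map (cod r)) _ _ ?_
    rintro _ ⟨τ, rfl⟩ ρ hρ hρ1
    have hl := lower_mass' h0 hr hs0 hs1 hrs τ ρ hρ hρ1
    rw [hball, ← ofReal_measureReal, ← ENNReal.ofReal_mul (by positivity)]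
    refine ENNReal.ofReal_le_ofReal ?_
    have e : (2 * ρ) ^ s = 3 * (2 * (1 - r)) ^ s * ((ρ / (1 - r)) ^ s / 3) := by
      have : 2 * ρ = 2 * (1 - r) * (ρ / (1 - r)) := by field_simp
      rw [this, Real.mul_rpow (by positivity) (by positivity)]
      ring
    rw [e]
    gcongr
  · have hd : ∀ d ∈ Ioo 0 (1 - r),
        ENNReal.ofReal (3 * (2 * d) ^ s) ≤ packM s (range (cod r)) := by
      rintro d ⟨hd0, hd⟩
      have h := le_packM (s := s) (nu.map (cod r)) (ENNReal.ofReal (3 * (2 * d) ^ s))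
        (range (cod r)) (cod r '' good) (image_subset_range _ _) (by
          rintro _ ⟨τ, hτ, rfl⟩ δ hδ
          obtain ⟨ρ, hρ, h⟩ := good_density h0 hr hrs hd0 hd hτ hδ
          exact ⟨ρ, hρ, by rwa [hball]⟩)
      have hg : 1 ≤ nu.map (cod r) (cod r '' good) := by
        refine le_trans ?_ (Measure.le_map_apply hmc.aemeasurable _)
        refine le_trans ?_ (measure_mono (subset_preimage_image _ _))
        have : nu univ ≤ nu good + nu goodᶜ := by
          rw [← union_compl_self good]; exact measure_union_le _ _
        rwa [nu_good, add_zero, measure_univ] at this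
      calc _ = ENNReal.ofReal (3 * (2 * d) ^ s) * 1 := (mul_one _).symm
        _ ≤ _ := by gcongr
        _ ≤ _ := h
    have hcont : Tendsto (fun d : ℝ => ENNReal.ofReal (3 * (2 * d) ^ s)) (𝓝[<] (1 - r))
        (𝓝 (ENNReal.ofReal (3 * (2 * (1 - r)) ^ s))) := by
      refine Tendsto.mono_left ?_ nhdsWithin_le_nhds
      refine (ENNReal.continuous_ofReal.comp ?_).tendsto (1 - r)
      exact continuous_const.mul ((continuous_const.mul continuous_id).rpow_const
        fun _ => Or.inr hs0.le)
    refine le_of_tendsto hcont ?_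
    filter_upwards [Ioo_mem_nhdsLT hr1] with d h using hd d h

end SG

theorem packing_measure_sierpinski_gasket
(r : ℝ) (hr0 : 0 < r) (hr : r ≤ 1/3)
    (S : Set (EuclideanSpace ℝ (Fin 2))) (hSne : S.Nonempty) (hScp : IsCompact S)
    (hinv : S = (fun v => r • v) '' S ∪
        (fun v => r • v + (WithLp.equiv 2 (Fin 2 → ℝ)).symm ![1 - r, 0]) '' S ∪
        (fun v => r • v +
          (1 - r) • (WithLp.equiv 2 (Fin 2 → ℝ)).symm ![1/2, Real.sqrt 3 / 2]) '' S)
    :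
    packM (Real.log 3 / Real.log (1/r)) S =
      ENNReal.ofReal ((2 * (1 - r) / r) ^ (Real.log 3 / Real.log (1/r))) := by
  have h1 : r < 1 := by linarith
  have h3 : 0 < Real.log 3 := Real.log_pos (by norm_num)
  have h3r : 3 ≤ 1 / r := by rw [le_div_iff₀ hr0]; linarith
  have hle : Real.log 3 ≤ Real.log (1 / r) := Real.log_le_log (by norm_num) h3r
  have hpos : 0 < Real.log (1 / r) := lt_of_lt_of_le h3 hle
  set s := Real.log 3 / Real.log (1 / r) with hs
  have hs0 : 0 < s := div_pos h3 hpos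
  have hs1 : s ≤ 1 := (div_le_one hpos).2 hle
  have hrs : r ^ s = 1 / 3 := by
    have hl : Real.log r = - Real.log (1 / r) := by rw [one_div, Real.log_inv, neg_neg]
    rw [Real.rpow_def_of_pos hr0, hl, hs]
    have : -Real.log (1 / r) * (Real.log 3 / Real.log (1 / r)) = - Real.log 3 := by
      field_simp
    rw [this, Real.exp_neg, Real.exp_log (by norm_num), one_div]
  rw [SG.attr_eq hr0 h1 hSne hScp hinv, SG.main hr0 hr hs0 hs1 hrs,
    Real.div_rpow (by linarith) hr0.le, hrs]
  congr 1
  ring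
end

section
/- Let x ∈ E with code i = i_1 i_2 …, and suppose that for some k ≥ 0 one has d ≤ c·r_{i(k)} (with the convention r_{i(0)} = 1). Then h(x,d) = h(f_{i(k+1)}^{-1}(x), d / r_{i(k+1)}). -/
open Metric Set MeasureTheory Filter Topology
open scoped ENNReal NNReal

section Helpers

lemma aux_usc {X : Type*} [MetricSpace X] [CompactSpace X] [MeasurableSpace X] [BorelSpace X]
    (ν : Measure X) [IsFiniteMeasure ν] (q : C(X, ℝ)) (b : ℝ≥0∞) (hb : ν {v | q v = 0} < b) :
    ∃ ε > 0, ∀ q' : C(X, ℝ), dist q' q < ε → ν {v | q' v = 0} < b := by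
  have hm : Measurable q := q.continuous.measurable
  have h := tendsto_measure_cthickening_of_isClosed (μ := ν.map q) (s := {(0 : ℝ)})
    ⟨1, one_pos, measure_ne_top _ _⟩ isClosed_singleton
  have h0 : ν.map q {(0 : ℝ)} = ν {v | q v = 0} := by
    rw [Measure.map_apply hm (measurableSet_singleton _)]; rfl
  rw [h0] at h
  have h2 := h.eventually_lt_const hb
  obtain ⟨ε, hε, hh⟩ := Metric.eventually_nhds_iff.1 h2
  refine ⟨ε / 2, by positivity, fun q' hq' => ?_⟩
  have h3 := hh (y := ε / 2) (by rw [Real.dist_eq, sub_zero, abs_of_pos (by positivity)]; linarith)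
  refine lt_of_le_of_lt ?_ h3
  rw [Metric.cthickening_singleton _ (by positivity),
    Measure.map_apply hm measurableSet_closedBall]
  apply measure_mono
  intro v hv
  have hv' : q' v = 0 := hv
  have := ContinuousMap.dist_apply_le_dist (f := q') (g := q) v
  rw [hv', dist_comm] at this
  simp only [mem_preimage, mem_closedBall]
  linarith

lemma aux_inj {X : Type*} [MetricSpace X] [CompactSpace X] (Q : Submodule ℝ C(X, ℝ))
    [FiniteDimensional ℝ Q] (T : C(X, ℝ) →ₗ[ℝ] C(X, ℝ)) (h : Q ≤ Q.map T) :
    (∀ q ∈ Q, T q ∈ Q) ∧ ∀ q ∈ Q, T q = 0 → q = 0 := by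
  have h1 : Q = Q.map T := Submodule.eq_of_le_of_finrank_le h (Submodule.finrank_map_le T Q)
  have h2 : ∀ q ∈ Q, T q ∈ Q := fun q hq => by
    rw [h1]; exact Submodule.mem_map_of_mem hq
  refine ⟨h2, fun q hq h0 => ?_⟩
  have hs : Function.Surjective (T.restrict h2) := by
    rintro ⟨y, hy⟩
    obtain ⟨z, hz, rfl⟩ := h hy
    exact ⟨⟨z, hz⟩, rfl⟩
  have hi := LinearMap.injective_iff_surjective.2 hs
  have : (⟨q, hq⟩ : Q) = 0 := hi (by
    apply Subtype.ext
    simp [LinearMap.restrict_apply, h0])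
  exact congrArg Subtype.val this

lemma aux_sphere {X : Type*} [MetricSpace X] [CompactSpace X] [MeasurableSpace X] [BorelSpace X]
    {N : ℕ} (g : Fin N → X → X) (rr : Fin N → ℝ) (hr : ∀ i, 0 < rr i ∧ rr i < 1)
    (hsim : ∀ i x y, dist (g i x) (g i y) = rr i * dist x y)
    (hcov : ∀ z, ∃ i u, g i u = z)
    (p : Fin N → ℝ≥0∞) (hp0 : ∀ i, p i ≠ 0) (hpt : ∀ i, p i ≠ ⊤) (hp : ∑ i, p i = 1)
    (ν : Measure X) [IsFiniteMeasure ν]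
    (hν : ∀ A, MeasurableSet A → ν A = ∑ i, p i * ν (g i ⁻¹' A))
    (D : X → C(X, ℝ)) (hD : ∀ a v, D a v = dist v a ^ 2)
    (W : Submodule ℝ C(X, ℝ)) [FiniteDimensional ℝ W] (h1W : (1 : C(X, ℝ)) ∈ W)
    (hDW : ∀ a, D a ∈ W) (a : X) (c : ℝ) (hc : 0 < c) :
    ν {v | dist v a = c} = 0 := by
  have hgc : ∀ i, Continuous (g i) := fun i =>
    (LipschitzWith.of_dist_le_mul (K := ⟨rr i, (hr i).1.le⟩)
      (fun x y => (hsim i x y).le)).continuous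
  let T : Fin N → C(X, ℝ) →ₗ[ℝ] C(X, ℝ) := fun i =>
    (ContinuousMap.compRightAlgHom ℝ ℝ (⟨g i, hgc i⟩ : C(X, X))).toLinearMap
  have hT : ∀ i q v, T i q v = q (g i v) := fun i q v => rfl
  let Q : Submodule ℝ C(X, ℝ) := Submodule.span ℝ (insert 1 (range D))
  have hQW : Q ≤ W := by
    apply Submodule.span_le.2
    rintro q (rfl | ⟨a, rfl⟩)
    · exact h1W
    · exact hDW a
  have : FiniteDimensional ℝ Q := Submodule.finiteDimensional_of_le hQW
  have hQ1 : (1 : C(X, ℝ)) ∈ Q := Submodule.subset_span (mem_insert _ _)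
  have hQD : ∀ a, D a ∈ Q := fun a => Submodule.subset_span (mem_insert_of_mem _ ⟨a, rfl⟩)
  have hQT : ∀ i, Q ≤ Q.map (T i) := by
    intro i
    apply Submodule.span_le.2
    rintro q (rfl | ⟨a, rfl⟩)
    · exact ⟨1, hQ1, by ext v; simp [hT]⟩
    · refine ⟨(rr i ^ 2)⁻¹ • D (g i a), Q.smul_mem _ (hQD _), ?_⟩
      ext v
      have := (hr i).1
      rw [hT, ContinuousMap.smul_apply, hD, hD, hsim, smul_eq_mul]
      field_simp
  by_contra hne
  -- the polynomial in question
  let q₁ : C(X, ℝ) := D a - (c ^ 2) • 1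
  have hq₁Q : q₁ ∈ Q := Q.sub_mem (hQD a) (Q.smul_mem _ hQ1)
  have hq₁v : ∀ v, q₁ v = dist v a ^ 2 - c ^ 2 := fun v => by
    simp [q₁, hD]
  have hq₁0 : q₁ ≠ 0 := by
    intro h
    have := hq₁v a
    rw [h] at this
    simp at this
    exact hc.ne' this
  have hq₁Z : ν {v | q₁ v = 0} ≠ 0 := by
    have : {v | q₁ v = 0} = {v | dist v a = c} := by
      ext v
      simp only [mem_ofPred_eq, hq₁v, sub_eq_zero]
      exact pow_left_inj₀ dist_nonneg hc.le two_ne_zero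
    rwa [this]
  let m : C(X, ℝ) → ℝ≥0∞ := fun q => ν {v | q v = 0}
  have hscale : ∀ (t : ℝ) (q : C(X, ℝ)), t ≠ 0 → m (t • q) = m q := by
    intro t q ht
    simp [m, ht]
  have hnorm : ∀ q ∈ Q, q ≠ 0 → ∃ q' : Q, q' ∈ sphere (0 : Q) 1 ∧ m q' = m q := by
    intro q hq h0
    have h0' : ‖q‖ ≠ 0 := norm_ne_zero_iff.2 h0
    refine ⟨⟨‖q‖⁻¹ • q, Q.smul_mem _ hq⟩, ?_, hscale _ _ (inv_ne_zero h0')⟩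
    rw [mem_sphere_zero_iff_norm]
    change ‖‖q‖⁻¹ • q‖ = 1
    rw [norm_smul, norm_inv, norm_norm,
      inv_mul_cancel₀ h0']
  have husc : UpperSemicontinuousOn (fun q : Q => m q) (sphere (0 : Q) 1) := by
    intro q _ b hb
    obtain ⟨ε, hε, h⟩ := aux_usc ν (q : C(X, ℝ)) b hb
    apply mem_nhdsWithin_of_mem_nhds
    exact Metric.mem_nhds_iff.2 ⟨ε, hε, fun q' hq' => h q' hq'⟩
  have : ProperSpace Q := FiniteDimensional.proper_real Q
  obtain ⟨q', hq', hm'⟩ := hnorm q₁ hq₁Q hq₁0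
  obtain ⟨q₀, hq₀, hmax⟩ := husc.exists_isMaxOn ⟨q', hq'⟩ (isCompact_sphere _ _)
  have hle : ∀ q ∈ Q, q ≠ 0 → m q ≤ m q₀ := by
    intro q hq h0
    obtain ⟨q', hq', hm'⟩ := hnorm q hq h0
    rw [← hm']
    exact hmax hq'
  have hM0 : m q₀ ≠ 0 := by
    intro h
    have := hle q₁ hq₁Q hq₁0
    rw [h] at this
    exact hq₁Z (nonpos_iff_eq_zero.1 this)
  have hMt : m q₀ ≠ ⊤ := measure_ne_top _ _
  have hstep : ∀ q ∈ Q, q ≠ 0 → m q = m q₀ → ∀ i, T i q ∈ Q ∧ T i q ≠ 0 ∧ m (T i q) = m q₀ := by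
    intro q hq h0 hm i
    have hin : ∀ i, T i q ∈ Q ∧ T i q ≠ 0 := fun i =>
      ⟨(aux_inj Q (T i) (hQT i)).1 q hq, fun h => h0 ((aux_inj Q (T i) (hQT i)).2 q hq h)⟩
    refine ⟨(hin i).1, (hin i).2, ?_⟩
    have hs : m q = ∑ i, p i * m (T i q) :=
      hν _ ((isClosed_singleton (x := (0 : ℝ))).preimage q.continuous).measurableSet
    have hs2 : ∑ i, p i * m (T i q) = ∑ i, p i * m q₀ := by
      rw [← hs, hm, ← Finset.sum_mul, hp, one_mul]
    by_contra hlt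
    have hlt' : m (T i q) < m q₀ := lt_of_le_of_ne (hle _ (hin i).1 (hin i).2) hlt
    refine absurd hs2 (ne_of_lt ?_)
    rw [← Finset.add_sum_erase _ _ (Finset.mem_univ i),
      ← Finset.add_sum_erase _ (fun i => p i * m q₀) (Finset.mem_univ i)]
    refine ENNReal.add_lt_add_of_lt_of_le ?_ ?_ ?_
    · exact ENNReal.sum_ne_top.2 fun j _ => ENNReal.mul_ne_top (hpt j) (measure_ne_top _ _)
    · exact (ENNReal.mul_lt_mul_iff_right (hp0 i) (hpt i)).2 hlt'
    · exact Finset.sum_le_sum fun j _ => by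
        gcongr
        exact hle _ (hin j).1 (hin j).2
  obtain ⟨ρ, hρ0, hρ1, hρ⟩ : ∃ ρ : ℝ, 0 ≤ ρ ∧ ρ < 1 ∧ ∀ i, rr i ≤ ρ := by
    obtain ⟨i0, _⟩ := hcov a
    have : Nonempty (Fin N) := ⟨i0⟩
    obtain ⟨i, hi⟩ := Finite.exists_max rr
    exact ⟨rr i, (hr i).1.le, (hr i).2, hi⟩
  have hdense : ∀ k : ℕ, ∀ q ∈ Q, q ≠ 0 → m q = m q₀ → ∀ z, ∃ z', q z' = 0 ∧
      dist z z' ≤ ρ ^ k * Metric.diam (univ : Set X) := by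
    intro k
    induction k with
    | zero =>
      intro q hq h0 hm z
      have : {v | q v = 0}.Nonempty := by
        apply nonempty_of_measure_ne_zero (μ := ν)
        change m q ≠ 0
        rwa [hm]
      obtain ⟨z', hz'⟩ := this
      refine ⟨z', hz', ?_⟩
      rw [pow_zero, one_mul]
      exact dist_le_diam_of_mem isCompact_univ.isBounded (mem_univ _) (mem_univ _)
    | succ k ih =>
      intro q hq h0 hm z
      obtain ⟨i, u, rfl⟩ := hcov z
      obtain ⟨h1, h2, h3⟩ := hstep q hq h0 hm i
      obtain ⟨u', hu', hd⟩ := ih _ h1 h2 h3 u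
      refine ⟨g i u', hu', ?_⟩
      rw [hsim, pow_succ', mul_assoc]
      exact mul_le_mul (hρ i) hd dist_nonneg hρ0
  have hq₀0 : (q₀ : C(X, ℝ)) ≠ 0 := by
    intro h
    rw [mem_sphere_zero_iff_norm] at hq₀
    change ‖(q₀ : C(X, ℝ))‖ = 1 at hq₀
    rw [h, norm_zero] at hq₀
    exact zero_ne_one hq₀
  apply hq₀0
  ext z
  have hcl : IsClosed {v | (q₀ : C(X, ℝ)) v = 0} :=
    (isClosed_singleton (x := (0 : ℝ))).preimage (q₀ : C(X, ℝ)).continuous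
  choose zz hz0 hzd using fun k => hdense k q₀ q₀.2 hq₀0 rfl z
  have htend : Tendsto zz atTop (𝓝 z) := by
    rw [tendsto_iff_dist_tendsto_zero]
    refine squeeze_zero (fun _ => dist_nonneg) (fun k => (dist_comm _ _).trans_le (hzd k)) ?_
    simpa using (tendsto_pow_atTop_nhds_zero_of_lt_one hρ0 hρ1).mul_const
      (Metric.diam (univ : Set X))
  exact hcl.mem_of_tendsto htend (Eventually.of_forall hz0)


lemma aux_support {n N : ℕ} [Nonempty (Fin N)]
    (f : Fin N → EuclideanSpace ℝ (Fin n) → EuclideanSpace ℝ (Fin n))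
    (rr : Fin N → ℝ) (hr : ∀ i, 0 < rr i ∧ rr i < 1)
    (hsim : ∀ i x y, dist (f i x) (f i y) = rr i * dist x y)
    (E : Set (EuclideanSpace ℝ (Fin n))) (hEne : E.Nonempty) (hEcp : IsCompact E)
    (hEinv : E = ⋃ i, f i '' E)
    (p : Fin N → ℝ≥0∞) (hp : ∑ i, p i = 1)
    (μ : Measure (EuclideanSpace ℝ (Fin n))) [IsProbabilityMeasure μ]
    (hμss : ∀ A : Set (EuclideanSpace ℝ (Fin n)), MeasurableSet A →
      μ A = ∑ i, p i * μ (f i ⁻¹' A)) : μ Eᶜ = 0 := by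
  obtain ⟨i0, hi0⟩ := Finite.exists_max rr
  obtain ⟨hρ0, hρ1⟩ := hr i0
  set ρ := rr i0
  let F : ℝ → ℝ≥0∞ := fun t => μ (cthickening t E)
  have hstep : ∀ t, 0 ≤ t → F (t / ρ) ≤ F t := by
    intro t ht
    have h1 : F t = ∑ i, p i * μ (f i ⁻¹' cthickening t E) :=
      hμss _ isClosed_cthickening.measurableSet
    rw [h1]
    calc F (t / ρ) = ∑ i, p i * F (t / ρ) := by rw [← Finset.sum_mul, hp, one_mul]
      _ ≤ _ := by
        refine Finset.sum_le_sum fun i _ => ?_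
        gcongr
        apply measure_mono
        intro v hv
        rw [hEcp.cthickening_eq_biUnion_closedBall (by positivity)] at hv
        simp only [mem_iUnion, mem_closedBall, exists_prop] at hv
        obtain ⟨e, he, hd⟩ := hv
        refine mem_cthickening_of_dist_le _ (f i e) _ _ ?_ ?_
        · rw [hEinv]; exact mem_iUnion.2 ⟨i, e, he, rfl⟩
        · rw [hsim]
          calc rr i * dist v e ≤ ρ * (t / ρ) :=
                mul_le_mul (hi0 i) hd dist_nonneg hρ0.le
            _ = t := by field_simp
  have hiter : ∀ k : ℕ, ∀ t, 0 ≤ t → F (t / ρ ^ k) ≤ F t := by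
    intro k
    induction k with
    | zero => intro t _; simp
    | succ k ih =>
      intro t ht
      rw [pow_succ, ← div_div]
      exact (hstep _ (by positivity)).trans (ih t ht)
  have hone : ∀ t, 0 < t → F t = 1 := by
    intro t ht
    refine le_antisymm prob_le_one ?_
    obtain ⟨e, he⟩ := hEne
    have hmono : Monotone (fun k : ℕ => closedBall e (t / ρ ^ k)) := by
      intro a b hab
      apply closedBall_subset_closedBall
      apply div_le_div_of_nonneg_left ht.le (by positivity)
      exact pow_le_pow_of_le_one hρ0.le hρ1.le hab
    have hU : (⋃ k : ℕ, closedBall e (t / ρ ^ k)) = univ := by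
      rw [eq_univ_iff_forall]
      intro v
      have h1 : Tendsto (fun k : ℕ => t * (ρ⁻¹) ^ k) atTop atTop :=
        (tendsto_pow_atTop_atTop_of_one_lt ((one_lt_inv₀ hρ0).2 hρ1)).const_mul_atTop ht
      obtain ⟨k, hk⟩ := (h1.eventually_ge_atTop (dist v e)).exists
      refine mem_iUnion.2 ⟨k, ?_⟩
      rwa [mem_closedBall, div_eq_mul_inv, ← inv_pow]
    have ht2 := tendsto_measure_iUnion_atTop (μ := μ) hmono
    rw [hU, measure_univ] at ht2
    refine le_of_tendsto' ht2 fun k => ?_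
    refine le_trans (measure_mono ?_) (hiter k t ht.le)
    exact closedBall_subset_cthickening he _
  have hlim := tendsto_measure_cthickening_of_isClosed (μ := μ) (s := E)
    ⟨1, one_pos, measure_ne_top _ _⟩ hEcp.isClosed
  have hlim2 : Tendsto F (𝓝[>] 0) (𝓝 (μ E)) := hlim.mono_left nhdsWithin_le_nhds
  have hlim3 : Tendsto F (𝓝[>] 0) (𝓝 1) :=
    tendsto_const_nhds.congr' (by
      filter_upwards [self_mem_nhdsWithin] with t ht
      exact (hone t ht).symm)
  have hE1 : μ E = 1 := tendsto_nhds_unique hlim2 hlim3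
  exact (prob_compl_eq_zero_iff hEcp.isClosed.measurableSet).2 hE1

/-- Finite dimensional space of functions `α‖v‖² + β + ⟪b, v⟫` restricted to `E`. -/
lemma aux_findim {n : ℕ} (E : Set (EuclideanSpace ℝ (Fin n))) (D : E → C(E, ℝ))
    (hD : ∀ a v, D a v = dist v a ^ 2) :
    ∃ W : Submodule ℝ C(E, ℝ), FiniteDimensional ℝ W ∧ (1 : C(E, ℝ)) ∈ W ∧ ∀ a, D a ∈ W := by
  let L : (ℝ × ℝ × EuclideanSpace ℝ (Fin n)) →ₗ[ℝ] C(E, ℝ) :=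
    { toFun := fun z => ⟨fun v => z.1 * ‖(v : EuclideanSpace ℝ (Fin n))‖ ^ 2 + z.2.1
          + inner ℝ z.2.2 (v : EuclideanSpace ℝ (Fin n)), by fun_prop⟩
      map_add' := by
        intro z w
        ext v
        simp [inner_add_left]
        ring
      map_smul' := by
        intro t z
        ext v
        simp [inner_smul_left]
        ring }
  have hL : ∀ z v, L z v = z.1 * ‖(v : EuclideanSpace ℝ (Fin n))‖ ^ 2 + z.2.1
          + inner ℝ z.2.2 (v : EuclideanSpace ℝ (Fin n)) := fun z v => rfl
  refine ⟨LinearMap.range L, inferInstance, ⟨(0, 1, 0), ?_⟩, fun a =>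
    ⟨(1, ‖(a : EuclideanSpace ℝ (Fin n))‖ ^ 2, (-2 : ℝ) • (a : EuclideanSpace ℝ (Fin n))), ?_⟩⟩
  · ext v
    simp [hL]
  · ext v
    rw [hL, hD, Subtype.dist_eq, dist_eq_norm, norm_sub_sq_real, inner_smul_left,
      real_inner_comm]
    simp
    ring

lemma aux_sphere_E {n N : ℕ} [Nonempty (Fin N)]
    (f : Fin N → EuclideanSpace ℝ (Fin n) → EuclideanSpace ℝ (Fin n))
    (rr : Fin N → ℝ) (hr : ∀ i, 0 < rr i ∧ rr i < 1)
    (hsim : ∀ i x y, dist (f i x) (f i y) = rr i * dist x y)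
    (E : Set (EuclideanSpace ℝ (Fin n))) (hEne : E.Nonempty) (hEcp : IsCompact E)
    (hEinv : E = ⋃ i, f i '' E)
    (p : Fin N → ℝ≥0∞) (hp0 : ∀ i, p i ≠ 0) (hpt : ∀ i, p i ≠ ⊤) (hp : ∑ i, p i = 1)
    (μ : Measure (EuclideanSpace ℝ (Fin n))) [IsProbabilityMeasure μ]
    (hμss : ∀ A : Set (EuclideanSpace ℝ (Fin n)), MeasurableSet A →
      μ A = ∑ i, p i * μ (f i ⁻¹' A))
    (a : EuclideanSpace ℝ (Fin n)) (ha : a ∈ E) (c : ℝ) (hc : 0 < c) :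
    μ (sphere a c) = 0 := by
  have hsupp : μ Eᶜ = 0 := aux_support f rr hr hsim E hEne hEcp hEinv p hp μ hμss
  have hcap : ∀ A, μ (A ∩ E) = μ A := fun A => measure_inter_conull hsupp
  have hmap : ∀ i, ∀ v ∈ E, f i v ∈ E := by
    intro i v hv
    rw [hEinv]
    exact mem_iUnion.2 ⟨i, v, hv, rfl⟩
  have : CompactSpace E := isCompact_iff_compactSpace.1 hEcp
  let g : Fin N → E → E := fun i v => ⟨f i v, hmap i v v.2⟩
  have hemb : MeasurableEmbedding (Subtype.val : E → EuclideanSpace ℝ (Fin n)) :=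
    MeasurableEmbedding.subtype_coe hEcp.isClosed.measurableSet
  let ν : Measure E := μ.comap Subtype.val
  have hνapp : ∀ A, ν A = μ (Subtype.val '' A) := fun A => hemb.comap_apply μ A
  have : IsFiniteMeasure ν := ⟨by rw [hνapp]; exact measure_lt_top _ _⟩
  let D : E → C(E, ℝ) := fun a => ⟨fun v => dist v a ^ 2, by fun_prop⟩
  obtain ⟨W, hW, h1, hDW⟩ := aux_findim E D (fun _ _ => rfl)
  have key := aux_sphere g rr hr (fun i x y => hsim i x y)
    (by
      rintro ⟨z, hz⟩
      have hz' := hz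
      rw [hEinv] at hz'
      obtain ⟨i, u, hu, hh⟩ := mem_iUnion.1 hz'
      exact ⟨i, ⟨u, hu⟩, Subtype.ext hh⟩)
    p hp0 hpt hp ν
    (by
      intro A hA
      rw [hνapp, hμss _ (hemb.measurableSet_image.2 hA)]
      refine Finset.sum_congr rfl fun i _ => ?_
      rw [hνapp, ← hcap (f i ⁻¹' _)]
      congr 2
      ext v
      constructor
      · rintro ⟨⟨w, hw, hwv⟩, hv⟩
        refine ⟨⟨v, hv⟩, ?_, rfl⟩
        have : g i ⟨v, hv⟩ = w := Subtype.ext hwv.symm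
        rw [mem_preimage, this]
        exact hw
      · rintro ⟨w, hw, rfl⟩
        exact ⟨⟨g i w, hw, rfl⟩, w.2⟩)
    D (fun _ _ => rfl) W h1 hDW ⟨a, ha⟩ c hc
  rw [hνapp] at key
  rw [← hcap]
  refine measure_mono_null ?_ key
  rintro v ⟨hv, hvE⟩
  exact ⟨⟨v, hvE⟩, hv, rfl⟩

lemma fWord_dist {X : Type*} [MetricSpace X] {N : ℕ} (f : Fin N → X → X) (rr : Fin N → ℝ)
    (hsim : ∀ i x y, dist (f i x) (f i y) = rr i * dist x y) (σ : ℕ → Fin N) (k : ℕ) (x y : X) :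
    dist (fWord f σ k x) (fWord f σ k y) = rWord rr σ k * dist x y := by
  induction k generalizing x y with
  | zero => simp [fWord, rWord]
  | succ k ih =>
    simp only [fWord, Function.comp]
    rw [ih, hsim, rWord, rWord, Finset.prod_range_succ, mul_assoc]

end Helpers

theorem density_invariance_small_radius
{n N : ℕ} (hN : 2 ≤ N)
    (f : Fin N → EuclideanSpace ℝ (Fin n) → EuclideanSpace ℝ (Fin n))
    (rr : Fin N → ℝ) (hr : ∀ i, 0 < rr i ∧ rr i < 1)
    (hsim : ∀ i x y, dist (f i x) (f i y) = rr i * dist x y)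
    (E : Set (EuclideanSpace ℝ (Fin n))) (hEne : E.Nonempty) (hEcp : IsCompact E)
    (hEinv : E = ⋃ i, f i '' E)
    (hssc : ∀ i j, i ≠ j → Disjoint (f i '' E) (f j '' E))
(hEdiam : Metric.diam E = 1)
(c : ℝ) (hc : 0 < c)
    (hcdef : c = sInf {d : ℝ | ∃ i j : Fin N, i ≠ j ∧
      ∃ u ∈ f i '' E, ∃ v ∈ f j '' E, d = dist u v})
(s : ℝ) (hs : 0 < s) (hsum : ∑ i, rr i ^ s = 1)
    (μ : MeasureTheory.Measure (EuclideanSpace ℝ (Fin n))) (hμ : IsProbabilityMeasure μ)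
    (hμss : ∀ A : Set (EuclideanSpace ℝ (Fin n)), MeasurableSet A →
      μ A = ∑ i, ENNReal.ofReal (rr i ^ s) * μ (f i ⁻¹' A))
    (x : EuclideanSpace ℝ (Fin n)) (hx : x ∈ E)
    (σ : ℕ → Fin N) (hσ : (⋂ k, fWord f σ k '' E) = {x})
    (k : ℕ) (d : ℝ) (hd : 0 < d) (hdc : d ≤ c * rWord rr σ k)
    (y : EuclideanSpace ℝ (Fin n)) (hy : fWord f σ (k+1) y = x) :
    densityh μ s x d = densityh μ s y (d / rWord rr σ (k+1)) := by
  have hNe : Nonempty (Fin N) := ⟨⟨0, by omega⟩⟩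
  let p : Fin N → ℝ≥0∞ := fun i => ENNReal.ofReal (rr i ^ s)
  have hp0 : ∀ i, p i ≠ 0 := fun i =>
    (ENNReal.ofReal_pos.2 (Real.rpow_pos_of_pos (hr i).1 s)).ne'
  have hpt : ∀ i, p i ≠ ⊤ := fun i => ENNReal.ofReal_ne_top
  have hp : ∑ i, p i = 1 := by
    rw [← ENNReal.ofReal_sum_of_nonneg (fun i _ => Real.rpow_nonneg (hr i).1.le s), hsum,
      ENNReal.ofReal_one]
  have hsupp : μ Eᶜ = 0 := aux_support f rr hr hsim E hEne hEcp hEinv p hp μ hμss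
  have hcap : ∀ A, μ (A ∩ E) = μ A := fun A => measure_inter_conull hsupp
  have hmap : ∀ i, ∀ v ∈ E, f i v ∈ E := by
    intro i v hv
    rw [hEinv]
    exact mem_iUnion.2 ⟨i, v, hv, rfl⟩
  have hcle : ∀ i j, i ≠ j → ∀ u ∈ E, ∀ v ∈ E, c ≤ dist (f i u) (f j v) := by
    intro i j hij u hu v hv
    rw [hcdef]
    refine csInf_le ⟨0, ?_⟩ ⟨i, j, hij, _, ⟨u, hu, rfl⟩, _, ⟨v, hv, rfl⟩, rfl⟩
    rintro _ ⟨i, j, -, u, -, v, -, rfl⟩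
    exact dist_nonneg
  -- one step
  have hstep : ∀ (i : Fin N) (u : EuclideanSpace ℝ (Fin n)), u ∈ E → ∀ t, t ≤ c →
      μ (closedBall (f i u) t) = p i * μ (closedBall u (t / rr i)) := by
    intro i u hu t ht
    rw [hμss _ measurableSet_closedBall, Finset.sum_eq_single i]
    · congr 2
      ext v
      rw [mem_preimage, mem_closedBall, mem_closedBall, hsim, le_div_iff₀' (hr i).1]
    · intro j _ hji
      have hS := aux_sphere_E f rr hr hsim E hEne hEcp hEinv p hp0 hpt hp μ hμss (f i u)
        (hmap i u hu) c hc
      rw [hμss _ isClosed_sphere.measurableSet, Finset.sum_eq_zero_iff] at hS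
      have hSj := (mul_eq_zero.1 (hS j (Finset.mem_univ j))).resolve_left (hp0 j)
      rw [mul_eq_zero]
      right
      rw [← hcap]
      refine measure_mono_null ?_ hSj
      rintro v ⟨hv, hvE⟩
      exact le_antisymm (le_trans hv ht) (hcle j i hji v hvE u hu)
    · intro h
      exact absurd (Finset.mem_univ i) h
  have hrpos : ∀ j, 0 < rWord rr σ j := fun j => Finset.prod_pos fun i _ => (hr _).1
  have hrsucc : ∀ j, rWord rr σ (j + 1) = rWord rr σ j * rr (σ j) := fun j =>
    Finset.prod_range_succ _ _
  have hranti : Antitone (rWord rr σ) := antitone_nat_of_succ_le fun j => by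
    rw [hrsucc]
    exact mul_le_of_le_one_right (hrpos j).le (hr _).2.le
  have hind : ∀ j, j ≤ k + 1 → ∀ y ∈ E, fWord f σ j y = x →
      μ (closedBall x d) = ENNReal.ofReal (rWord rr σ j ^ s) *
        μ (closedBall y (d / rWord rr σ j)) := by
    intro j
    induction j with
    | zero =>
      intro _ y _ hyx
      have : y = x := hyx
      simp [rWord, this]
    | succ j ih =>
      intro hj y hyE hyx
      rw [ih (by omega) (f (σ j) y) (hmap _ y hyE) hyx, hstep (σ j) y hyE, hrsucc,
        Real.mul_rpow (hrpos j).le (hr _).1.le,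
        ENNReal.ofReal_mul (Real.rpow_nonneg (hrpos j).le s), mul_assoc, div_div]
      rw [div_le_iff₀ (hrpos j)]
      exact hdc.trans (mul_le_mul_of_nonneg_left (hranti (by omega)) hc.le)
  have hyE : y ∈ E := by
    have hx' : x ∈ ⋂ k, fWord f σ k '' E := by rw [hσ]; rfl
    obtain ⟨y', hy', hh⟩ := mem_iInter.1 hx' (k + 1)
    have h0 := fWord_dist f rr hsim σ (k + 1) y y'
    rw [hy, hh, dist_self] at h0
    have h1 : dist y y' = 0 := (mul_eq_zero.1 h0.symm).resolve_left (hrpos _).ne'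
    rwa [dist_eq_zero.1 h1]
  have hR := hrpos (k + 1)
  have hRs := Real.rpow_pos_of_pos hR s
  unfold densityh
  rw [hind (k + 1) le_rfl y hyE hy]
  have hnum : (2 * d) ^ s = rWord rr σ (k + 1) ^ s * (2 * (d / rWord rr σ (k + 1))) ^ s := by
    rw [← Real.mul_rpow hR.le (by positivity)]
    congr 1
    field_simp
  rw [hnum, ENNReal.ofReal_mul hRs.le, ENNReal.mul_div_mul_left _ _
    (ENNReal.ofReal_pos.2 hRs).ne' ENNReal.ofReal_ne_top]
end

section
/- Let i ∈ {1,…,N} be an index with r_i = r_min. Then for every x ∈ E and every d with 0 < d ≤ c/r_min, one has h(x,d) = h(f_i(x), d·r_i). -/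
open Metric Set MeasureTheory Filter Topology
open scoped ENNReal NNReal

/-- A similitude of Euclidean space is affine. -/
lemma sim_affine {n : ℕ} (g : EuclideanSpace ℝ (Fin n) → EuclideanSpace ℝ (Fin n)) (r : ℝ)
    (hr : 0 < r) (hg : ∀ x y, dist (g x) (g y) = r * dist x y) :
    ∃ (U : EuclideanSpace ℝ (Fin n) ≃ₗᵢ[ℝ] EuclideanSpace ℝ (Fin n))
      (t : EuclideanSpace ℝ (Fin n)), ∀ y, g y = r • U y + t := by
  have hiso : Isometry (fun y => r⁻¹ • g y) := by
    refine Isometry.of_dist_eq fun x y => ?_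
    rw [dist_smul₀, hg, Real.norm_of_nonneg (by positivity)]
    field_simp
  let A := hiso.affineIsometryOfStrictConvexSpace
  refine ⟨A.linearIsometry.toLinearIsometryEquiv rfl, g 0, fun y => ?_⟩
  have h1 : A.linearIsometry y = A y - A 0 := by
    have := A.map_vsub y 0
    simpa using this
  have hA : ∀ z, A z = r⁻¹ • g z := fun z => rfl
  rw [LinearIsometry.toLinearIsometryEquiv_apply, h1, hA, hA, ← smul_sub, smul_smul,
    mul_inv_cancel₀ hr.ne', one_smul]
  abel

/-- The self-similar measure is carried by the attractor. -/
lemma mu_compl_zero {n N : ℕ}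
    (f : Fin N → EuclideanSpace ℝ (Fin n) → EuclideanSpace ℝ (Fin n))
    (rr : Fin N → ℝ) (hr : ∀ i, 0 < rr i ∧ rr i < 1)
    (hsim : ∀ i x y, dist (f i x) (f i y) = rr i * dist x y)
    (ρ : ℝ) (hρ0 : 0 < ρ) (hρ1 : ρ < 1) (hρ : ∀ i, rr i ≤ ρ)
    (E : Set (EuclideanSpace ℝ (Fin n))) (hEne : E.Nonempty) (hEcp : IsCompact E)
    (hmap : ∀ i, ∀ y ∈ E, f i y ∈ E)
    (s : ℝ) (hsum : ∑ i, rr i ^ s = 1)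
    (μ : MeasureTheory.Measure (EuclideanSpace ℝ (Fin n))) (hμ : IsProbabilityMeasure μ)
    (hμss : ∀ A : Set (EuclideanSpace ℝ (Fin n)), MeasurableSet A →
      μ A = ∑ i, ENNReal.ofReal (rr i ^ s) * μ (f i ⁻¹' A)) : μ Eᶜ = 0 := by
  have hsumE : ∑ i, ENNReal.ofReal (rr i ^ s) = 1 := by
    rw [← ENNReal.ofReal_sum_of_nonneg (fun i _ => Real.rpow_nonneg (hr i).1.le s), hsum,
      ENNReal.ofReal_one]
  let B : ℝ → Set (EuclideanSpace ℝ (Fin n)) := fun R => {y | R < infDist y E}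
  have hBm : ∀ R, MeasurableSet (B R) := fun R =>
    (isOpen_lt continuous_const (continuous_infDist_pt E)).measurableSet
  have hstep : ∀ R, μ (B (ρ * R)) ≤ μ (B R) := by
    intro R
    rw [hμss _ (hBm _)]
    calc _ ≤ ∑ i, ENNReal.ofReal (rr i ^ s) * μ (B R) := by
          refine Finset.sum_le_sum fun i _ => ?_
          gcongr
          intro y hy
          change ρ * R < infDist (f i y) E at hy
          change R < infDist y E
          obtain ⟨e, he, hee⟩ := hEcp.exists_infDist_eq_dist hEne y
          have h1 := infDist_le_dist_of_mem (x := f i y) (hmap i e he)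
          rw [hsim, ← hee] at h1
          have h2 : rr i * infDist y E ≤ ρ * infDist y E := by
            gcongr
            · exact infDist_nonneg
            · exact hρ i
          exact lt_of_mul_lt_mul_left (hy.trans_le (h1.trans h2)) hρ0.le
      _ = μ (B R) := by rw [← Finset.sum_mul, hsumE, one_mul]
  have hiter : ∀ (k : ℕ) R, μ (B R) ≤ μ (B ((ρ⁻¹) ^ k * R)) := by
    intro k
    induction k with
    | zero => intro R; simp
    | succ k ih =>
      intro R
      refine (ih R).trans ?_
      have := hstep ((ρ⁻¹) ^ (k+1) * R)
      have he : ρ * ((ρ⁻¹) ^ (k+1) * R) = (ρ⁻¹) ^ k * R := by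
        rw [pow_succ]; field_simp
      rwa [he] at this
  have hzero : ∀ R, 0 < R → μ (B R) = 0 := by
    intro R hR
    have hlim : Tendsto (fun k : ℕ => μ (B ((k : ℝ)))) atTop (𝓝 0) := by
      have h := tendsto_measure_iInter_atTop (μ := μ) (s := fun k : ℕ => B (k:ℝ))
        (fun k => (hBm _).nullMeasurableSet)
        (by intro a b hab y hy
            have : (a:ℝ) ≤ b := by exact_mod_cast hab
            exact lt_of_le_of_lt this hy) ⟨0, measure_ne_top _ _⟩
      have he : (⋂ k : ℕ, B (k:ℝ)) = ∅ := by
        ext y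
        simp only [mem_iInter, mem_empty_iff_false, iff_false, not_forall]
        obtain ⟨k, hk⟩ := exists_nat_gt (infDist y E)
        exact ⟨k, fun h => lt_asymm hk h⟩
      rwa [he, measure_empty] at h
    refine le_antisymm (ge_of_tendsto' hlim fun k => ?_) zero_le
    obtain ⟨m, hm⟩ := pow_unbounded_of_one_lt ((k:ℝ) / R) ((one_lt_inv₀ hρ0).2 hρ1)
    refine (hiter m R).trans (measure_mono fun y hy => ?_)
    have : (k:ℝ) < (ρ⁻¹) ^ m * R := by rwa [div_lt_iff₀ hR] at hm
    exact this.trans hy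
  have : Eᶜ ⊆ ⋃ k : ℕ, B (1 / ((k:ℝ) + 1)) := by
    intro y hy
    have hpos : 0 < infDist y E := (hEcp.isClosed.notMem_iff_infDist_pos hEne).1 hy
    obtain ⟨k, hk⟩ := exists_nat_one_div_lt hpos
    exact mem_iUnion.2 ⟨k, hk⟩
  exact measure_mono_null this (measure_iUnion_null fun k => hzero _ (by positivity))

/-- Zero sets of a finite-dimensional, invariant family of functions are null,
unless the function vanishes on all of the attractor. -/
lemma zeroset_null {n N : ℕ} {P : Type*} [NormedAddCommGroup P] [NormedSpace ℝ P]
    [FiniteDimensional ℝ P]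
    (f : Fin N → EuclideanSpace ℝ (Fin n) → EuclideanSpace ℝ (Fin n))
    (rr : Fin N → ℝ) (hr : ∀ i, 0 < rr i ∧ rr i < 1)
    (hsim : ∀ i x y, dist (f i x) (f i y) = rr i * dist x y)
    (ρ : ℝ) (hρ0 : 0 < ρ) (hρ1 : ρ < 1) (hρ : ∀ i, rr i ≤ ρ)
    (E : Set (EuclideanSpace ℝ (Fin n))) (hEcp : IsCompact E)
    (hEinv : E = ⋃ i, f i '' E) (hmap : ∀ i, ∀ y ∈ E, f i y ∈ E)
    (s : ℝ) (hsum : ∑ i, rr i ^ s = 1)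
    (μ : MeasureTheory.Measure (EuclideanSpace ℝ (Fin n))) (hμ : IsProbabilityMeasure μ)
    (hμss : ∀ A : Set (EuclideanSpace ℝ (Fin n)), MeasurableSet A →
      μ A = ∑ i, ENNReal.ofReal (rr i ^ s) * μ (f i ⁻¹' A))
    (hE0 : μ Eᶜ = 0)
    (ev : P →ₗ[ℝ] (EuclideanSpace ℝ (Fin n) → ℝ))
    (hev : Continuous fun q : P × EuclideanSpace ℝ (Fin n) => ev q.1 q.2)
    (T : Fin N → P →ₗ[ℝ] P) (hTinj : ∀ i, Function.Injective (T i))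
    (hT : ∀ i p y, ev (T i p) y = ev p (f i y))
    (p : P) (hp : ∃ y ∈ E, ev p y ≠ 0) : μ {y | ev p y = 0} = 0 := by
  let Z : P → Set (EuclideanSpace ℝ (Fin n)) := fun q => {y | ev q y = 0}
  have hevq : ∀ q, Continuous (ev q) := fun q => hev.comp (Continuous.prodMk_right q)
  have hZc : ∀ q, IsClosed (Z q) := fun q => isClosed_eq (hevq q) continuous_const
  let P0 : Submodule ℝ P :=
    { carrier := {q | ∀ y ∈ E, ev q y = 0}
      add_mem' := by
        intro a b ha hb y hy
        simp [ha y hy, hb y hy]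
      zero_mem' := by intro y _; simp
      smul_mem' := by
        intro a b hb y hy
        simp [hb y hy] }
  have hP0 : ∀ q, q ∈ P0 ↔ ∀ y ∈ E, ev q y = 0 := fun q => Iff.rfl
  have hTnot : ∀ i q, q ∉ P0 → T i q ∉ P0 := by
    intro i q hq hTq
    have hle : P0.map (T i) ≤ P0 := by
      rintro _ ⟨a, ha, rfl⟩ y hy
      rw [hT]; exact ha _ (hmap i y hy)
    have heq : P0.map (T i) = P0 := by
      apply Submodule.eq_of_le_of_finrank_eq hle
      exact (Submodule.equivMapOfInjective (T i) (hTinj i) P0).finrank_eq.symm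
    rw [← heq] at hTq
    obtain ⟨a, ha, hae⟩ := hTq
    exact hq (hTinj i hae ▸ ha)
  obtain ⟨C, hC⟩ := Submodule.exists_isCompl P0
  have hnorm : ∀ q, q ∉ P0 → ∃ a ∈ (C : Set P) ∩ sphere 0 1, a ∉ P0 ∧ μ (Z a) = μ (Z q) := by
    intro q hq
    have hqt : q ∈ P0 ⊔ C := by rw [hC.sup_eq_top]; trivial
    obtain ⟨a, ha, b, hb, hab⟩ := Submodule.mem_sup.1 hqt
    have hbP : b ∉ P0 := fun h => hq (hab ▸ P0.add_mem ha h)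
    have hb0 : b ≠ 0 := fun h => hbP (h ▸ P0.zero_mem)
    have hbn : ‖b‖ ≠ 0 := norm_ne_zero_iff.2 hb0
    refine ⟨‖b‖⁻¹ • b, ⟨C.smul_mem _ hb, ?_⟩, ?_, ?_⟩
    · simp [norm_smul, hbn]
    · intro h
      apply hbP
      have := P0.smul_mem ‖b‖ h
      rwa [smul_smul, mul_inv_cancel₀ hbn, one_smul] at this
    · apply measure_congr
      have hEae : ∀ᵐ y ∂μ, y ∈ E := hE0
      filter_upwards [hEae] with y hy
      apply propext
      change ev (‖b‖⁻¹ • b) y = 0 ↔ ev q y = 0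
      rw [← hab]
      simp [ha y hy, hb0]
  have husc : ∀ (q : P), ∀ ε, μ (Z q) < ε → ∀ᶠ q' in 𝓝 q, μ (Z q') < ε := by
    intro q ε hε
    obtain ⟨O, hOsub, hOo, hOlt⟩ := (Z q).exists_isOpen_lt_of_lt ε hε
    have hK : IsCompact (E \ O) := hEcp.diff hOo
    have h1 : ∀ᶠ q' in 𝓝 q, ∀ y ∈ E \ O, ev q' y ≠ 0 := by
      apply hK.eventually_forall_of_forall_eventually
      intro y hy
      have : ev q y ≠ 0 := fun h => hy.2 (hOsub h)
      exact (hev.continuousAt (x := (q, y))).eventually_ne this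
    filter_upwards [h1] with q' hq'
    refine lt_of_le_of_lt ?_ hOlt
    calc μ (Z q') ≤ μ (O ∪ Eᶜ) := by
          refine measure_mono fun y hy => ?_
          by_contra hcon
          simp only [mem_union, mem_compl_iff, not_or, not_not] at hcon
          exact hq' y ⟨hcon.2, hcon.1⟩ hy
      _ ≤ μ O + μ Eᶜ := measure_union_le _ _
      _ = μ O := by rw [hE0, add_zero]
  have hpP : p ∉ P0 := by
    intro h
    obtain ⟨y, hy, hne⟩ := hp
    exact hne (h y hy)
  have hKc : IsCompact ((C : Set P) ∩ sphere 0 1) :=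
    (isCompact_sphere _ _).inter_left C.closed_of_finiteDimensional
  obtain ⟨a0, ha0, -⟩ := hnorm p hpP
  obtain ⟨q, hqK, hqmax⟩ := UpperSemicontinuousOn.exists_isMaxOn (f := fun q => μ (Z q))
    ⟨a0, ha0⟩ hKc (fun q _ ε hε => (husc q ε hε).filter_mono nhdsWithin_le_nhds)
  have hqP : q ∉ P0 := by
    intro h
    have : q = 0 := by
      have := hC.inf_eq_bot ▸ Submodule.mem_inf.2 ⟨h, hqK.1⟩
      simpa using this
    have h2 := hqK.2
    rw [this] at h2
    simp at h2
  have hle : ∀ a, a ∉ P0 → μ (Z a) ≤ μ (Z q) := by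
    intro a ha
    obtain ⟨b, hb, -, hbe⟩ := hnorm a ha
    rw [← hbe]; exact hqmax hb
  have hinv : ∀ i a, a ∉ P0 → μ (Z a) = μ (Z q) → μ (Z (T i a)) = μ (Z q) := by
    intro i a ha hae
    by_contra hne
    have hlt : μ (Z (T i a)) < μ (Z q) := lt_of_le_of_ne (hle _ (hTnot i a ha)) hne
    have h1 : μ.real (Z a) = ∑ j, rr j ^ s * μ.real (Z (T j a)) := by
      have h := hμss (Z a) (hZc a).measurableSet
      have hpre : ∀ j, f j ⁻¹' (Z a) = Z (T j a) := by
        intro j; ext y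
        change ev a (f j y) = 0 ↔ ev (T j a) y = 0
        rw [hT]
      rw [measureReal_def, h, ENNReal.toReal_sum
        (fun j _ => ENNReal.mul_ne_top ENNReal.ofReal_ne_top (measure_ne_top _ _))]
      refine Finset.sum_congr rfl fun j _ => ?_
      rw [ENNReal.toReal_mul, ENNReal.toReal_ofReal (Real.rpow_nonneg (hr j).1.le s), hpre]
      rfl
    have h2 : ∑ j, rr j ^ s * μ.real (Z (T j a)) < ∑ j, rr j ^ s * μ.real (Z q) := by
      apply Finset.sum_lt_sum
      · intro j _
        exact mul_le_mul_of_nonneg_left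
          (ENNReal.toReal_mono (measure_ne_top _ _) (hle _ (hTnot j a ha)))
          (Real.rpow_nonneg (hr j).1.le s)
      · refine ⟨i, Finset.mem_univ _, ?_⟩
        exact mul_lt_mul_of_pos_left
          ((ENNReal.toReal_lt_toReal (measure_ne_top _ _) (measure_ne_top _ _)).2 hlt)
          (Real.rpow_pos_of_pos (hr i).1 s)
    rw [← h1, ← Finset.sum_mul, hsum, one_mul, measureReal_def, measureReal_def, hae] at h2
    exact lt_irrefl _ h2
  obtain ⟨y, hyE, hy⟩ : ∃ y ∈ E, ev q y ≠ 0 := by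
    by_contra hcon
    push Not at hcon
    exact hqP hcon
  have hword : ∀ k : ℕ, ∃ (g : EuclideanSpace ℝ (Fin n) → EuclideanSpace ℝ (Fin n)) (a : P),
      (∀ u v, dist (g u) (g v) ≤ ρ ^ k * dist u v) ∧ y ∈ g '' E ∧
      a ∉ P0 ∧ μ (Z a) = μ (Z q) ∧ ∀ u, ev a u = ev q (g u) := by
    intro k
    induction k with
    | zero => exact ⟨id, q, by simp, ⟨y, hyE, rfl⟩, hqP, rfl, fun _ => rfl⟩
    | succ k ih =>
      obtain ⟨g, a, hg, ⟨z, hz, hzy⟩, ha, hae, haev⟩ := ih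
      rw [hEinv] at hz
      obtain ⟨i, z', hz', hzz⟩ := mem_iUnion.1 hz
      refine ⟨g ∘ f i, T i a, ?_, ⟨z', hz', ?_⟩, hTnot i a ha, hinv i a ha hae, ?_⟩
      · intro u v
        refine (hg _ _).trans ?_
        rw [hsim, pow_succ, mul_assoc]
        gcongr
        exact hρ i
      · simp [hzz, hzy]
      · intro u; rw [hT, haev]; rfl
  have hM : μ (Z q) = 0 := by
    have hnhds : ∀ᶠ z in 𝓝 y, ev q z ≠ 0 := (hevq q).continuousAt.eventually_ne hy
    obtain ⟨δ, hδ, hball⟩ := Metric.eventually_nhds_iff.1 hnhds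
    obtain ⟨k, hk⟩ := exists_pow_lt_of_lt_one
      (show 0 < δ / (Metric.diam E + 1) from div_pos hδ (by linarith [Metric.diam_nonneg (s := E)]))
      hρ1
    obtain ⟨g, a, hg, ⟨z, hz, hzy⟩, ha, hae, haev⟩ := hword k
    rw [← hae]
    refine measure_mono_null (t := Eᶜ) ?_ hE0
    intro u hu huE
    have hdpos : 0 < Metric.diam E + 1 := by linarith [Metric.diam_nonneg (s := E)]
    refine hball (y := g u) ?_ (by rw [← haev]; exact hu)
    rw [← hzy]
    rw [lt_div_iff₀ hdpos] at hk
    calc _ ≤ ρ ^ k * dist u z := hg u z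
      _ ≤ ρ ^ k * (Metric.diam E + 1) := by
        gcongr
        linarith [Metric.dist_le_diam_of_mem hEcp.isBounded huE hz]
      _ < δ := hk
  exact le_antisymm ((hle p hpP).trans hM.le) zero_le

/-- The evaluation of the quadratic `a‖y‖² + ⟪b,y⟫ + g`. -/
noncomputable def quadEv (n : ℕ) : (ℝ × EuclideanSpace ℝ (Fin n) × ℝ) →ₗ[ℝ]
    (EuclideanSpace ℝ (Fin n) → ℝ) where
  toFun p y := p.1 * ‖y‖ ^ 2 + inner ℝ p.2.1 y + p.2.2
  map_add' p q := by
    ext y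
    simp [inner_add_left]; ring
  map_smul' a p := by
    ext y
    simp [real_inner_smul_left]; ring

/-- Pullback of quadratics under `y ↦ r • U y + t`. -/
noncomputable def quadT {n : ℕ} (r : ℝ)
    (U : EuclideanSpace ℝ (Fin n) ≃ₗᵢ[ℝ] EuclideanSpace ℝ (Fin n))
    (t : EuclideanSpace ℝ (Fin n)) : (ℝ × EuclideanSpace ℝ (Fin n) × ℝ) →ₗ[ℝ]
    (ℝ × EuclideanSpace ℝ (Fin n) × ℝ) where
  toFun p := (r ^ 2 * p.1, (2 * r * p.1) • U.symm t + r • U.symm p.2.1,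
    p.1 * ‖t‖ ^ 2 + inner ℝ p.2.1 t + p.2.2)
  map_add' p q := by
    ext1
    · simp; ring
    · ext1
      · simp only [Prod.fst_add, Prod.snd_add, map_add]
        module
      · simp [inner_add_left]; ring
  map_smul' a p := by
    ext1
    · simp; ring
    · ext1
      · simp only [Prod.smul_fst, Prod.smul_snd, map_smul, RingHom.id_apply, smul_eq_mul]
        module
      · simp [real_inner_smul_left]; ring

lemma quadT_inj {n : ℕ} (r : ℝ) (hr : 0 < r)
    (U : EuclideanSpace ℝ (Fin n) ≃ₗᵢ[ℝ] EuclideanSpace ℝ (Fin n))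
    (t : EuclideanSpace ℝ (Fin n)) : Function.Injective (quadT r U t) := by
  rw [injective_iff_map_eq_zero]
  rintro ⟨a, b, g⟩ h
  simp only [quadT, LinearMap.coe_mk, AddHom.coe_mk, Prod.mk_eq_zero] at h
  obtain ⟨h1, h2, h3⟩ := h
  have ha : a = 0 := by
    rcases mul_eq_zero.1 h1 with h | h
    · exact absurd h (by positivity)
    · exact h
  subst ha
  have hb : b = 0 := by
    simpa [hr.ne'] using h2
  subst hb
  simpa using h3

lemma quadT_ev {n : ℕ} (r : ℝ)
    (U : EuclideanSpace ℝ (Fin n) ≃ₗᵢ[ℝ] EuclideanSpace ℝ (Fin n))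
    (t : EuclideanSpace ℝ (Fin n)) (p : ℝ × EuclideanSpace ℝ (Fin n) × ℝ)
    (y : EuclideanSpace ℝ (Fin n)) :
    quadEv n (quadT r U t p) y = quadEv n p (r • U y + t) := by
  have key : ∀ b, inner ℝ (U.symm b) y = inner ℝ b (U y) := by
    intro b
    rw [← U.inner_map_map, U.apply_symm_apply]
  simp only [quadEv, quadT, LinearMap.coe_mk, AddHom.coe_mk]
  rw [norm_add_sq_real, norm_smul, U.norm_map, inner_add_left, real_inner_smul_left,
    real_inner_smul_left, real_inner_smul_left, key, key, inner_add_right, real_inner_smul_right,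
    real_inner_comm t (U y), mul_pow, Real.norm_eq_abs, sq_abs]
  ring

theorem density_invariance_rmin_map
{n N : ℕ} (hN : 2 ≤ N)
    (f : Fin N → EuclideanSpace ℝ (Fin n) → EuclideanSpace ℝ (Fin n))
    (rr : Fin N → ℝ) (hr : ∀ i, 0 < rr i ∧ rr i < 1)
    (hsim : ∀ i x y, dist (f i x) (f i y) = rr i * dist x y)
    (E : Set (EuclideanSpace ℝ (Fin n))) (hEne : E.Nonempty) (hEcp : IsCompact E)
    (hEinv : E = ⋃ i, f i '' E)
    (hssc : ∀ i j, i ≠ j → Disjoint (f i '' E) (f j '' E))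
(hEdiam : Metric.diam E = 1)
(rmin : ℝ) (hrmin : IsLeast (Set.range rr) rmin)
(c : ℝ) (hc : 0 < c)
    (hcdef : c = sInf {d : ℝ | ∃ i j : Fin N, i ≠ j ∧
      ∃ u ∈ f i '' E, ∃ v ∈ f j '' E, d = dist u v})
(s : ℝ) (hs : 0 < s) (hsum : ∑ i, rr i ^ s = 1)
    (μ : MeasureTheory.Measure (EuclideanSpace ℝ (Fin n))) (hμ : IsProbabilityMeasure μ)
    (hμss : ∀ A : Set (EuclideanSpace ℝ (Fin n)), MeasurableSet A →
      μ A = ∑ i, ENNReal.ofReal (rr i ^ s) * μ (f i ⁻¹' A))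
    (i : Fin N) (hi : rr i = rmin)
    (x : EuclideanSpace ℝ (Fin n)) (hx : x ∈ E) (d : ℝ) (hd : 0 < d)
    (hdc : d ≤ c / rmin) :
    densityh μ s x d = densityh μ s (f i x) (d * rr i) := by
  have hmap : ∀ i, ∀ y ∈ E, f i y ∈ E := by
    intro j y hy
    rw [hEinv]
    exact mem_iUnion.2 ⟨j, y, hy, rfl⟩
  obtain ⟨jm, -, hjm⟩ := Finset.exists_max_image Finset.univ rr ⟨i, Finset.mem_univ _⟩
  have hρ : ∀ j, rr j ≤ rr jm := fun j => hjm j (Finset.mem_univ _)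
  have hE0 : μ Eᶜ = 0 := mu_compl_zero f rr hr hsim (rr jm) (hr jm).1 (hr jm).2 hρ E hEne hEcp
    hmap s hsum μ hμ hμss
  choose U t hUt using fun j => sim_affine (f j) (rr j) (hr j).1 (hsim j)
  have hrc : d * rr i ≤ c := by
    rw [hi]
    rwa [le_div_iff₀ (hi ▸ (hr i).1)] at hdc
  let q : ℝ × EuclideanSpace ℝ (Fin n) × ℝ := (1, (-2 : ℝ) • f i x, ‖f i x‖ ^ 2 - c ^ 2)
  have hq : ∀ y, quadEv n q y = dist y (f i x) ^ 2 - c ^ 2 := by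
    intro y
    simp only [quadEv, q, LinearMap.coe_mk, AddHom.coe_mk]
    rw [dist_eq_norm, norm_sub_sq_real, real_inner_smul_left, real_inner_comm]
    ring
  have hnull : μ {y | quadEv n q y = 0} = 0 := by
    refine zeroset_null f rr hr hsim (rr jm) (hr jm).1 (hr jm).2 hρ E hEcp hEinv hmap s hsum
      μ hμ hμss hE0 (quadEv n) ?_ (fun j => quadT (rr j) (U j) (t j))
      (fun j => quadT_inj _ (hr j).1 _ _) (fun j p y => by rw [quadT_ev, hUt]) q
      ⟨f i x, hmap i x hx, ?_⟩
    · simp only [quadEv, LinearMap.coe_mk, AddHom.coe_mk]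
      fun_prop
    · rw [hq, dist_self]
      have : 0 < c ^ 2 := by positivity
      intro h; linarith
  have hqm : MeasurableSet {y | quadEv n q y = 0} := by
    simp only [hq]
    exact (isClosed_eq (by fun_prop) continuous_const).measurableSet
  have hj : ∀ j, j ≠ i → μ (f j ⁻¹' closedBall (f i x) (d * rr i)) = 0 := by
    intro j hji
    have h1 : μ (f j ⁻¹' {y | quadEv n q y = 0}) = 0 := by
      have h := hμss _ hqm
      rw [hnull] at h
      have h2 := (Finset.sum_eq_zero_iff.1 h.symm) j (Finset.mem_univ _)
      rcases mul_eq_zero.1 h2 with h3 | h3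
      · exact absurd h3 (by simpa using Real.rpow_pos_of_pos (hr j).1 s)
      · exact h3
    refine measure_mono_null (t := f j ⁻¹' {y | quadEv n q y = 0} ∪ Eᶜ) ?_
      (measure_union_null h1 hE0)
    intro y hy
    by_cases hyE : y ∈ E
    · left
      have h2 : c ≤ dist (f j y) (f i x) := by
        rw [hcdef]
        refine csInf_le ⟨0, ?_⟩ ⟨j, i, hji, f j y, ⟨y, hyE, rfl⟩, f i x, ⟨x, hx, rfl⟩, rfl⟩
        rintro _ ⟨_, _, _, u, _, v, _, rfl⟩
        exact dist_nonneg
      have h3 : dist (f j y) (f i x) = c := le_antisymm (le_trans hy hrc) h2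
      change quadEv n q (f j y) = 0
      rw [hq, h3, sub_self]
    · right; exact hyE
  have hpre : f i ⁻¹' closedBall (f i x) (d * rr i) = closedBall x d := by
    ext y
    simp only [mem_preimage, mem_closedBall]
    rw [hsim, mul_comm]
    exact mul_le_mul_iff_left₀ (hr i).1
  have hball : μ (closedBall (f i x) (d * rr i)) =
      ENNReal.ofReal (rr i ^ s) * μ (closedBall x d) := by
    rw [hμss _ measurableSet_closedBall, Finset.sum_eq_single i, hpre]
    · intro j _ hji; rw [hj j hji, mul_zero]
    · simp
  have hrs : 0 < rr i ^ s := Real.rpow_pos_of_pos (hr i).1 s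
  unfold densityh
  rw [hball, show 2 * (d * rr i) = rr i * (2 * d) by ring,
    Real.mul_rpow (hr i).1.le (by positivity), ENNReal.ofReal_mul hrs.le]
  rw [ENNReal.mul_div_mul_left _ _ (by simpa using hrs) ENNReal.ofReal_ne_top]
end

section
/- For every a ∈ (0, c/r_min], sup{ h(x,d) : x ∈ E, 0 < d ≤ a } = sup{ h(x,d) : x ∈ E, a·r_min ≤ d ≤ a }, and the right-hand supremum is attained (it is a maximum over the compact set E × [a·r_min, a]). -/
open Metric Set MeasureTheory Filter Topology
open scoped ENNReal NNReal

lemma ennreal_sum_lt {N : ℕ} {u v : Fin N → ℝ≥0∞} (i : Fin N) (h : ∀ j, u j ≤ v j)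
    (hi : u i < v i) (hv : ∀ j, v j ≠ ∞) : ∑ j, u j < ∑ j, v j := by
  rw [← Finset.add_sum_erase _ _ (Finset.mem_univ i), ← Finset.add_sum_erase _ v (Finset.mem_univ i)]
  refine ENNReal.add_lt_add_of_lt_of_le ?_ hi (Finset.sum_le_sum fun j _ => h j)
  exact (ENNReal.sum_lt_top.2 fun j _ => lt_of_le_of_lt (h j) (lt_top_iff_ne_top.2 (hv j))).ne

set_option maxHeartbeats 1000000 in
lemma zero_set_null {E : Type*} [MetricSpace E] [CompactSpace E] [MeasurableSpace E] [BorelSpace E]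
    (ν : Measure E) [IsFiniteMeasure ν] {N : ℕ} (F : Fin N → C(E, E)) (p : Fin N → ℝ≥0∞)
    (hp : ∑ i, p i = 1) (hp0 : ∀ i, p i ≠ 0) (ρ D : ℝ) (hρ0 : 0 < ρ) (hρ : ρ < 1)
    (hD : ∀ x y : E, dist x y ≤ D)
    (hF : ∀ i x y, dist (F i x) (F i y) ≤ ρ * dist x y)
    (hsurj : ∀ y, ∃ i z, F i z = y)
    (hν : ∀ A, MeasurableSet A → ν A = ∑ i, p i * ν (F i ⁻¹' A))
    (P : Submodule ℝ C(E, ℝ)) [FiniteDimensional ℝ P]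
    (hP : ∀ i, ∀ q ∈ P, q.comp (F i) ∈ P)
    (hP' : ∀ i, ∀ q ∈ P, ∃ q' ∈ P, q'.comp (F i) = q) :
    ∀ q ∈ P, q ≠ 0 → ν {y | q y = 0} = 0 := by
  -- injectivity
  have hinj : ∀ i, ∀ q ∈ P, q.comp (F i) = 0 → q = 0 := by
    intro i q hq h0
    let T : P →ₗ[ℝ] P :=
      { toFun := fun q => ⟨(q : C(E, ℝ)).comp (F i), hP i q q.2⟩
        map_add' := fun a b => by ext; simp
        map_smul' := fun a b => by ext; simp }
    have hs : Function.Surjective T := by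
      rintro ⟨q, hq⟩
      obtain ⟨q', h', e⟩ := hP' i q hq
      exact ⟨⟨q', h'⟩, Subtype.ext e⟩
    have hi := LinearMap.injective_iff_surjective.2 hs
    have : (⟨q, hq⟩ : P) = 0 := hi (by rw [map_zero]; exact Subtype.ext h0)
    exact congrArg Subtype.val this
  intro q₁ hq₁ hq₁0
  by_contra hne
  have hmeas : ∀ q : C(E, ℝ), MeasurableSet {y | q y = 0} := fun q =>
    (isClosed_eq q.continuous continuous_const).measurableSet
  have husc : UpperSemicontinuous (fun q : P => ν {y | (q : C(E, ℝ)) y = 0}) := by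
    intro q t ht
    have hanti : Antitone (fun n : ℕ => {y | |(q : C(E, ℝ)) y| ≤ 1 / ((n : ℝ) + 1)}) := by
      intro a b hab y hy
      have hy' : |(q : C(E, ℝ)) y| ≤ 1 / ((b : ℝ) + 1) := hy
      exact le_trans hy' (Nat.one_div_le_one_div hab)
    have hI : (⋂ n : ℕ, {y | |(q : C(E, ℝ)) y| ≤ 1 / ((n : ℝ) + 1)}) = {y | (q : C(E, ℝ)) y = 0} := by
      ext y
      simp only [mem_iInter, mem_ofPred_eq]
      constructor
      · intro h
        have := ge_of_tendsto' (tendsto_one_div_add_atTop_nhds_zero_nat (𝕜 := ℝ)) h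
        exact abs_eq_zero.1 (le_antisymm this (abs_nonneg _))
      · intro h n
        rw [h, abs_zero]; positivity
    have := tendsto_measure_iInter_atTop (μ := ν)
      (fun n => (isClosed_le (continuous_abs.comp (q : C(E, ℝ)).continuous)
        continuous_const).measurableSet.nullMeasurableSet) hanti ⟨0, measure_ne_top _ _⟩
    erw [hI] at this
    obtain ⟨n, hn⟩ := (this.eventually (gt_mem_nhds ht)).exists
    have hpos : (0 : ℝ) < 1 / ((n : ℝ) + 1) := by positivity
    filter_upwards [Metric.ball_mem_nhds q hpos] with q' hq'
    refine lt_of_le_of_lt (measure_mono ?_) hn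
    intro y hy
    have h1 : dist (q' : C(E, ℝ)) (q : C(E, ℝ)) < 1 / ((n : ℝ) + 1) := hq'
    have h2 := ContinuousMap.dist_apply_le_dist (f := (q' : C(E, ℝ))) (g := (q : C(E, ℝ))) y
    have hy' : (q' : C(E, ℝ)) y = 0 := hy
    rw [hy', Real.dist_eq, zero_sub, abs_neg] at h2
    exact h2.trans h1.le
  have hcomp : IsCompact (Metric.sphere (0 : P) 1) := isCompact_sphere _ _
  have hscale : ∀ q : P, q ≠ 0 → ∃ q' ∈ Metric.sphere (0 : P) 1,
      {y | (q' : C(E, ℝ)) y = 0} = {y | (q : C(E, ℝ)) y = 0} := by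
    intro q hq
    have hq0 : ‖q‖ ≠ 0 := norm_ne_zero_iff.2 hq
    refine ⟨‖q‖⁻¹ • q, ?_, ?_⟩
    · rw [mem_sphere_zero_iff_norm]
      have h1 : ‖(‖q‖⁻¹ • q : P)‖ = ‖‖q‖⁻¹ • (q : C(E, ℝ))‖ := rfl
      have h2 : ‖q‖ = ‖(q : C(E, ℝ))‖ := rfl
      refine h1.trans ?_
      rw [norm_smul, Real.norm_of_nonneg (by positivity), ← h2, inv_mul_cancel₀ hq0]
    · ext y
      have : ((‖q‖⁻¹ • q : P) : C(E, ℝ)) y = ‖q‖⁻¹ * (q : C(E, ℝ)) y := rfl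
      rw [mem_ofPred_eq, mem_ofPred_eq, this]
      exact ⟨fun h => (mul_eq_zero.1 h).resolve_left (inv_ne_zero hq0), fun h => by rw [h, mul_zero]⟩
  have hq₁P : (⟨q₁, hq₁⟩ : P) ≠ 0 := fun h => hq₁0 (congrArg Subtype.val h)
  obtain ⟨qm, hqm, hmax⟩ := UpperSemicontinuousOn.exists_isMaxOn
    (let ⟨q', h, _⟩ := hscale _ hq₁P; ⟨q', h⟩) hcomp (husc.upperSemicontinuousOn _)
  set M := ν {y | (qm : C(E, ℝ)) y = 0} with hM
  have hle : ∀ q ∈ P, q ≠ 0 → ν {y | q y = 0} ≤ M := by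
    intro q hq hq0
    obtain ⟨q', h', e⟩ := hscale ⟨q, hq⟩ (fun h => hq0 (congrArg Subtype.val h))
    have := hmax h'
    simp only [mem_ofPred_eq] at this e
    rwa [e] at this
  have hM0 : M ≠ 0 := fun h => hne (le_antisymm (h ▸ hle q₁ hq₁ hq₁0) zero_le)
  have hMtop : M ≠ ∞ := measure_ne_top _ _
  have hstep : ∀ q ∈ P, q ≠ 0 → ν {y | q y = 0} = M → ∀ i,
      ν {y | q.comp (F i) y = 0} = M := by
    intro q hq hq0 hqM i
    by_contra hlt
    have hlt' : ν {y | q.comp (F i) y = 0} < M :=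
      lt_of_le_of_ne (hle _ (hP i q hq) (fun h => hq0 (hinj i q hq h))) hlt
    have hpt : ∀ j, p j ≠ ∞ := fun j => ne_top_of_le_ne_top ENNReal.one_ne_top
      (hp ▸ Finset.single_le_sum (f := p) (fun _ _ => zero_le) (Finset.mem_univ j))
    have : ν {y | q y = 0} < ∑ j, p j * M := by
      rw [hν _ (hmeas q)]
      refine ennreal_sum_lt i (fun j => ?_) ?_ ?_
      · exact mul_le_mul_right (hle _ (hP j q hq) (fun h => hq0 (hinj j q hq h))) (p j)
      · exact ENNReal.mul_lt_mul_right (hp0 i) (hpt i) hlt'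
      · exact fun j => ENNReal.mul_ne_top (hpt j) hMtop
    rw [← Finset.sum_mul, hp, one_mul, hqM] at this
    exact lt_irrefl _ this
  have hnear : ∀ k : ℕ, ∀ q ∈ P, q ≠ 0 → ν {y | q y = 0} = M → ∀ y,
      ∃ z, dist z y ≤ ρ ^ k * D ∧ q z = 0 := by
    intro k
    induction k with
    | zero =>
      intro q _ _ hqM y
      obtain ⟨z, hz⟩ := nonempty_of_measure_ne_zero (hqM.trans_ne hM0)
      exact ⟨z, by simpa using hD z y, hz⟩
    | succ k ih =>
      intro q hq hq0 hqM y
      obtain ⟨i, y', rfl⟩ := hsurj y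
      obtain ⟨z, hz, hz0⟩ := ih _ (hP i q hq) (fun h => hq0 (hinj i q hq h))
        (hstep q hq hq0 hqM i) y'
      refine ⟨F i z, (hF i z y').trans ?_, hz0⟩
      rw [pow_succ', mul_assoc]
      exact mul_le_mul_of_nonneg_left hz hρ0.le
  have hqm0 : (qm : C(E, ℝ)) ≠ 0 := by
    intro h
    have h0 : qm = 0 := Subtype.ext h
    simp [h0] at hqm
  apply hqm0
  ext y
  choose z hz hz0 using fun k => hnear k qm qm.2 hqm0 rfl y
  have ht : Tendsto z atTop (𝓝 y) := by
    rw [tendsto_iff_dist_tendsto_zero]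
    refine squeeze_zero (fun _ => dist_nonneg) hz ?_
    simpa using (tendsto_pow_atTop_nhds_zero_of_lt_one hρ0.le hρ).mul_const D
  have h1 := ((qm : C(E, ℝ)).continuous.tendsto y).comp ht
  have h2 : (fun k => (qm : C(E, ℝ)) (z k)) = fun _ => 0 := funext hz0
  exact tendsto_nhds_unique h1 (by simp [Function.comp_def, h2])


section
variable {n : ℕ}
local notation "V" => EuclideanSpace ℝ (Fin n)

lemma simil_affine (g : V → V) (r : ℝ) (hr : 0 < r) (hg : ∀ x y, dist (g x) (g y) = r * dist x y) :
    ∃ (L : V →ₗᵢ[ℝ] V) (t : V), ∀ y, g y = r • (L y + t) := by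
  have hi : Isometry (fun y => r⁻¹ • g y) := by
    refine Isometry.of_dist_eq fun x y => ?_
    rw [dist_smul₀, hg, Real.norm_of_nonneg (by positivity), ← mul_assoc, inv_mul_cancel₀ hr.ne',
      one_mul]
  refine ⟨hi.affineIsometryOfStrictConvexSpace.linearIsometry, r⁻¹ • g 0, fun y => ?_⟩
  have h := hi.affineIsometryOfStrictConvexSpace.map_vadd 0 y
  simp only [vadd_eq_add, add_zero, Isometry.affineIsometryOfStrictConvexSpace_apply] at h
  rw [← h, smul_smul, mul_inv_cancel₀ hr.ne', one_smul]

lemma simil_surj (g : V → V) (r : ℝ) (hr : 0 < r)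
    (hg : ∀ x y, dist (g x) (g y) = r * dist x y) : Function.Surjective g := by
  obtain ⟨L, t, h⟩ := simil_affine g r hr hg
  intro z
  have hs : Function.Surjective L.toLinearMap :=
    LinearMap.injective_iff_surjective.1 L.injective
  obtain ⟨y, hy⟩ := hs (r⁻¹ • z - t)
  refine ⟨y, ?_⟩
  have hy' : L y = r⁻¹ • z - t := hy
  rw [h, hy', sub_add_cancel, smul_smul, mul_inv_cancel₀ hr.ne', one_smul]

/-- The quadratic functions. -/
noncomputable def quadFn (w : ℝ × EuclideanSpace ℝ (Fin n) × ℝ) (y : EuclideanSpace ℝ (Fin n)) : ℝ :=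
  w.1 * ‖y‖ ^ 2 + inner ℝ w.2.1 y + w.2.2

lemma quad_comp (g : V → V) (r : ℝ) (hr : 0 < r) (hg : ∀ x y, dist (g x) (g y) = r * dist x y)
    (w : ℝ × V × ℝ) : ∃ w' : ℝ × V × ℝ, ∀ y, quadFn w (g y) = quadFn w' y := by
  obtain ⟨L, t, h⟩ := simil_affine g r hr hg
  obtain ⟨α, b, γ⟩ := w
  refine ⟨⟨α * r ^ 2, LinearMap.adjoint L.toLinearMap ((2 * α * r ^ 2) • t + r • b),
    α * r ^ 2 * ‖t‖ ^ 2 + r * inner ℝ b t + γ⟩, fun y => ?_⟩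
  simp only [quadFn, h, LinearMap.adjoint_inner_left, norm_smul, mul_pow, inner_smul_right,
    inner_add_left, inner_add_right, inner_smul_left, norm_add_sq_real, L.norm_map,
    LinearIsometry.coe_toLinearMap, RCLike.conj_to_real, Real.norm_eq_abs, sq_abs,
    real_inner_comm t (L y)]
  ring

lemma quadFn_cont (w : ℝ × V × ℝ) : Continuous (quadFn w) := by
  unfold quadFn; fun_prop

/-- Restriction of quadratic functions to a set, as a linear map. -/
noncomputable def quadLin (E : Set (EuclideanSpace ℝ (Fin n))) :
    (ℝ × EuclideanSpace ℝ (Fin n) × ℝ) →ₗ[ℝ] C(E, ℝ) where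
  toFun w := ⟨fun y => quadFn w y, (quadFn_cont w).comp continuous_subtype_val⟩
  map_add' a b := by
    ext y
    simp only [quadFn, ContinuousMap.coe_mk, ContinuousMap.add_apply, Prod.fst_add, Prod.snd_add,
      inner_add_left]
    ring
  map_smul' a b := by
    ext y
    simp only [quadFn, ContinuousMap.coe_mk, ContinuousMap.smul_apply, Prod.smul_fst,
      Prod.smul_snd, inner_smul_left, RingHom.id_apply, smul_eq_mul, RCLike.conj_to_real]
    ring

lemma measure_E_compl {N : ℕ} (f : Fin N → V → V) (rr : Fin N → ℝ)
    (hr : ∀ i, 0 < rr i ∧ rr i < 1)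
    (hsim : ∀ i x y, dist (f i x) (f i y) = rr i * dist x y)
    (E : Set V) (hEne : E.Nonempty) (hEcp : IsCompact E) (hEinv : E = ⋃ i, f i '' E)
    (s ρ : ℝ) (hρ0 : 0 < ρ) (hρ : ρ < 1) (hρr : ∀ i, rr i ≤ ρ) (hsum : ∑ i, rr i ^ s = 1)
    (μ : Measure V) [IsProbabilityMeasure μ]
    (hμss : ∀ A : Set V, MeasurableSet A →
      μ A = ∑ i, ENNReal.ofReal (rr i ^ s) * μ (f i ⁻¹' A)) : μ Eᶜ = 0 := by
  have hsum' : ∑ i, ENNReal.ofReal (rr i ^ s) = 1 := by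
    rw [← ENNReal.ofReal_sum_of_nonneg (fun i _ => (Real.rpow_pos_of_pos (hr i).1 s).le), hsum,
      ENNReal.ofReal_one]
  have hfE : ∀ i, ∀ y ∈ E, f i y ∈ E := by
    intro i y hy
    rw [hEinv]
    exact mem_iUnion.2 ⟨i, mem_image_of_mem _ hy⟩
  have hstep : ∀ t : ℝ, 0 < t → μ (cthickening (t / ρ) E) ≤ μ (cthickening t E) := by
    intro t ht
    rw [hμss (cthickening t E) isClosed_cthickening.measurableSet]
    calc μ (cthickening (t / ρ) E) = ∑ i, ENNReal.ofReal (rr i ^ s) * μ (cthickening (t / ρ) E) := by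
          rw [← Finset.sum_mul, hsum', one_mul]
      _ ≤ _ := by
          refine Finset.sum_le_sum fun i _ => mul_le_mul_right (measure_mono ?_) _
          intro y hy
          rw [hEcp.cthickening_eq_biUnion_closedBall (by positivity)] at hy
          simp only [mem_iUnion] at hy
          obtain ⟨z, hz, hyz⟩ := hy
          refine mem_cthickening_of_dist_le (f i y) (f i z) t E (hfE i z hz) ?_
          rw [hsim]
          rw [mem_closedBall, le_div_iff₀ hρ0] at hyz
          nlinarith [hρr i, dist_nonneg (x := y) (y := z)]
  have hiter : ∀ k : ℕ, ∀ t : ℝ, 0 < t → μ (cthickening (t / ρ ^ k) E) ≤ μ (cthickening t E) := by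
    intro k
    induction k with
    | zero => intro t _; simp
    | succ k ih =>
      intro t ht
      have := (ih (t / ρ) (by positivity)).trans (hstep t ht)
      rwa [div_div, ← pow_succ'] at this
  have hone : ∀ t : ℝ, 0 < t → 1 ≤ μ (cthickening t E) := by
    intro t ht
    have hmono : Monotone fun k : ℕ => cthickening (t / ρ ^ k) E := by
      intro a b hab
      apply cthickening_mono
      exact div_le_div_of_nonneg_left ht.le (by positivity)
        (pow_le_pow_of_le_one hρ0.le hρ.le hab)
    have hU : (⋃ k : ℕ, cthickening (t / ρ ^ k) E) = univ := by
      rw [eq_univ_iff_forall]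
      intro y
      obtain ⟨z, hz⟩ := hEne
      obtain ⟨k, hk⟩ := exists_pow_lt_of_lt_one (show 0 < t / (dist y z + 1) by positivity) hρ
      refine mem_iUnion.2 ⟨k, mem_cthickening_of_dist_le y z _ E hz ?_⟩
      rw [le_div_iff₀ (by positivity)]
      rw [lt_div_iff₀ (by positivity)] at hk
      nlinarith [pow_pos hρ0 k]
    have := tendsto_measure_iUnion_atTop (μ := μ) hmono
    rw [hU, measure_univ] at this
    exact le_of_tendsto' this fun k => hiter k t ht
  have hE1 : 1 ≤ μ E := by
    have h := (tendsto_measure_cthickening_of_isCompact (μ := μ) hEcp).mono_left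
      (nhdsWithin_le_nhds (s := Ioi 0))
    exact ge_of_tendsto h (eventually_mem_nhdsWithin.mono fun t ht => hone t ht)
  rw [prob_compl_eq_zero_iff hEcp.measurableSet]
  exact le_antisymm prob_le_one hE1

lemma measure_sphere_zero {N : ℕ} (f : Fin N → V → V) (rr : Fin N → ℝ)
    (hr : ∀ i, 0 < rr i ∧ rr i < 1)
    (hsim : ∀ i x y, dist (f i x) (f i y) = rr i * dist x y)
    (E : Set V) (hEcp : IsCompact E) (hEinv : E = ⋃ i, f i '' E)
    (s ρ : ℝ) (hρ0 : 0 < ρ) (hρ : ρ < 1) (hρr : ∀ i, rr i ≤ ρ) (hsum : ∑ i, rr i ^ s = 1)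
    (μ : Measure V) [IsProbabilityMeasure μ] (hμE : μ Eᶜ = 0)
    (hμss : ∀ A : Set V, MeasurableSet A →
      μ A = ∑ i, ENNReal.ofReal (rr i ^ s) * μ (f i ⁻¹' A))
    (x : V) (hx : x ∈ E) (d : ℝ) (hd : 0 < d) : μ (sphere x d) = 0 := by
  have hsum' : ∑ i, ENNReal.ofReal (rr i ^ s) = 1 := by
    rw [← ENNReal.ofReal_sum_of_nonneg (fun i _ => (Real.rpow_pos_of_pos (hr i).1 s).le), hsum,
      ENNReal.ofReal_one]
  have hfE : ∀ i, ∀ y ∈ E, f i y ∈ E := by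
    intro i y hy
    rw [hEinv]
    exact mem_iUnion.2 ⟨i, mem_image_of_mem _ hy⟩
  have hcont : ∀ i, Continuous (f i) := fun i =>
    (LipschitzWith.of_dist_le_mul (K := ⟨rr i, (hr i).1.le⟩) fun x y => (hsim i x y).le).continuous
  have : CompactSpace E := isCompact_iff_compactSpace.1 hEcp
  let F : Fin N → C(E, E) := fun i =>
    ⟨fun y => ⟨f i y, hfE i y y.2⟩, ((hcont i).comp continuous_subtype_val).subtype_mk _⟩
  let ν : Measure E := μ.comap Subtype.val
  have hνa : ∀ A : Set E, ν A = μ (Subtype.val '' A) :=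
    comap_subtype_coe_apply hEcp.measurableSet μ
  have : IsFiniteMeasure ν := ⟨by rw [hνa]; exact measure_lt_top _ _⟩
  have hinter : ∀ A : Set V, μ A = μ (A ∩ E) := fun A =>
    (measure_inter_conull hμE).symm
  have hν : ∀ A, MeasurableSet A → ν A = ∑ i, ENNReal.ofReal (rr i ^ s) * ν (F i ⁻¹' A) := by
    intro A hA
    rw [hνa, hμss _ (hEcp.measurableSet.subtype_image hA)]
    refine Finset.sum_congr rfl fun i _ => ?_
    rw [hνa, hinter]
    congr 2
    ext y
    simp only [mem_inter_iff, mem_preimage, mem_image, Subtype.exists, exists_and_right,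
      exists_eq_right]
    constructor
    · rintro ⟨⟨h, hA'⟩, hy⟩
      exact ⟨hy, hA'⟩
    · rintro ⟨hy, hA'⟩
      exact ⟨⟨hfE i y hy, hA'⟩, hy⟩
  have key := zero_set_null ν F (fun i => ENNReal.ofReal (rr i ^ s)) hsum'
    (fun i => (ENNReal.ofReal_pos.2 (Real.rpow_pos_of_pos (hr i).1 s)).ne') ρ (diam E) hρ0 hρ
    (fun x y => dist_le_diam_of_mem hEcp.isBounded x.2 y.2)
    (fun i x y => by
      have : dist (F i x) (F i y) = rr i * dist x y := hsim i x y
      rw [this]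
      exact mul_le_mul_of_nonneg_right (hρr i) dist_nonneg)
    (fun y => by
      have hy : (y : V) ∈ ⋃ i, f i '' E := hEinv ▸ y.2
      obtain ⟨i, z, hz, e⟩ := mem_iUnion.1 hy
      exact ⟨i, ⟨z, hz⟩, Subtype.ext e⟩)
    hν (LinearMap.range (quadLin E))
    (by
      rintro i _ ⟨w, rfl⟩
      obtain ⟨w', h'⟩ := quad_comp (f i) (rr i) (hr i).1 (hsim i) w
      exact ⟨w', by ext y; exact (h' y).symm⟩)
    (by
      rintro i _ ⟨w, rfl⟩
      have hsj := simil_surj (f i) (rr i) (hr i).1 (hsim i)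
      choose g hg using hsj
      have hgs : ∀ x y, dist (g x) (g y) = (rr i)⁻¹ * dist x y := by
        intro x y
        have := hsim i (g x) (g y)
        rw [hg, hg] at this
        rw [this, ← mul_assoc, inv_mul_cancel₀ (hr i).1.ne', one_mul]
      obtain ⟨w', h'⟩ := quad_comp g (rr i)⁻¹ (inv_pos.2 (hr i).1) hgs w
      refine ⟨_, ⟨w', rfl⟩, ?_⟩
      ext y
      have h1 : g (f i y) = y := by
        have := hsim i (g (f i y)) y
        rw [hg, dist_self] at this
        exact dist_eq_zero.1 ((mul_eq_zero.1 this.symm).resolve_left (hr i).1.ne')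
      have h2 := h' (f i y)
      rw [h1] at h2
      exact h2.symm)
    (quadLin E ⟨1, (-2 : ℝ) • x, ‖x‖ ^ 2 - d ^ 2⟩) ⟨_, rfl⟩
  have hq : ∀ y : V, quadFn ⟨1, (-2 : ℝ) • x, ‖x‖ ^ 2 - d ^ 2⟩ y = dist y x ^ 2 - d ^ 2 := by
    intro y
    simp only [quadFn, dist_eq_norm, norm_sub_sq_real, inner_smul_left, RCLike.conj_to_real,
      real_inner_comm x y]
    ring
  have key2 := key (by
    intro h
    have h1 : quadFn ⟨1, (-2 : ℝ) • x, ‖x‖ ^ 2 - d ^ 2⟩ x = 0 := DFunLike.congr_fun h (⟨x, hx⟩ : E)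
    rw [hq, dist_self] at h1
    nlinarith)
  rw [hνa] at key2
  rw [hinter]
  refine measure_mono_null ?_ key2
  rintro y ⟨hy, hyE⟩
  refine ⟨⟨y, hyE⟩, ?_, rfl⟩
  show quadFn ⟨1, (-2 : ℝ) • x, ‖x‖ ^ 2 - d ^ 2⟩ y = 0
  rw [hq, mem_sphere.1 hy, sub_self]

end

theorem sup_density_attained_on_annulus_of_radii
{n N : ℕ} (hN : 2 ≤ N)
    (f : Fin N → EuclideanSpace ℝ (Fin n) → EuclideanSpace ℝ (Fin n))
    (rr : Fin N → ℝ) (hr : ∀ i, 0 < rr i ∧ rr i < 1)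
    (hsim : ∀ i x y, dist (f i x) (f i y) = rr i * dist x y)
    (E : Set (EuclideanSpace ℝ (Fin n))) (hEne : E.Nonempty) (hEcp : IsCompact E)
    (hEinv : E = ⋃ i, f i '' E)
    (hssc : ∀ i j, i ≠ j → Disjoint (f i '' E) (f j '' E))
(hEdiam : Metric.diam E = 1)
(rmin : ℝ) (hrmin : IsLeast (Set.range rr) rmin)
(c : ℝ) (hc : 0 < c)
    (hcdef : c = sInf {d : ℝ | ∃ i j : Fin N, i ≠ j ∧
      ∃ u ∈ f i '' E, ∃ v ∈ f j '' E, d = dist u v})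
(s : ℝ) (hs : 0 < s) (hsum : ∑ i, rr i ^ s = 1)
    (μ : MeasureTheory.Measure (EuclideanSpace ℝ (Fin n))) (hμ : IsProbabilityMeasure μ)
    (hμss : ∀ A : Set (EuclideanSpace ℝ (Fin n)), MeasurableSet A →
      μ A = ∑ i, ENNReal.ofReal (rr i ^ s) * μ (f i ⁻¹' A))
    (a : ℝ) (ha : 0 < a) (ha' : a ≤ c / rmin) :
    sSup {v : ℝ≥0∞ | ∃ x ∈ E, ∃ d : ℝ, 0 < d ∧ d ≤ a ∧ v = densityh μ s x d} =
      sSup {v : ℝ≥0∞ | ∃ x ∈ E, ∃ d : ℝ, a * rmin ≤ d ∧ d ≤ a ∧ v = densityh μ s x d} ∧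
    IsGreatest {v : ℝ≥0∞ | ∃ x ∈ E, ∃ d : ℝ, a * rmin ≤ d ∧ d ≤ a ∧ v = densityh μ s x d}
      (sSup {v : ℝ≥0∞ | ∃ x ∈ E, ∃ d : ℝ, a * rmin ≤ d ∧ d ≤ a ∧ v = densityh μ s x d}) := by
  have hN0 : Nonempty (Fin N) := ⟨⟨0, by omega⟩⟩
  obtain ⟨i₀, hi₀⟩ := Finite.exists_max rr
  have hρ0 := (hr i₀).1
  have hρ1 := (hr i₀).2
  set ρ := rr i₀ with hρdef
  obtain ⟨⟨j₀, hj₀⟩, hlow⟩ := hrmin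
  have hrm0 : 0 < rmin := hj₀ ▸ (hr j₀).1
  have hrm1 : rmin < 1 := hj₀ ▸ (hr j₀).2
  have hrml : ∀ i, rmin ≤ rr i := fun i => hlow ⟨i, rfl⟩
  have hμE := measure_E_compl f rr hr hsim E hEne hEcp hEinv s ρ hρ0 hρ1 hi₀ hsum μ hμss
  have hsph := measure_sphere_zero f rr hr hsim E hEcp hEinv s ρ hρ0 hρ1 hi₀ hsum μ hμE hμss
  have hac : a * rmin ≤ c := (le_div_iff₀ hrm0).1 ha'
  have hcle : ∀ i j, i ≠ j → ∀ u ∈ E, ∀ v ∈ E, c ≤ dist (f i u) (f j v) := by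
    intro i j hij u hu v hv
    rw [hcdef]
    refine csInf_le ⟨0, ?_⟩ ⟨i, j, hij, _, mem_image_of_mem _ hu, _, mem_image_of_mem _ hv, rfl⟩
    rintro _ ⟨_, _, _, _, _, _, _, rfl⟩
    exact dist_nonneg
  have hred : ∀ x ∈ E, ∀ d : ℝ, 0 < d → d < a * rmin →
      ∃ i, ∃ y ∈ E, densityh μ s x d = densityh μ s y (d / rr i) := by
    intro x hx d hd hda
    have hx' : x ∈ ⋃ i, f i '' E := hEinv ▸ hx
    obtain ⟨i, y, hy, rfl⟩ := mem_iUnion.1 hx'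
    refine ⟨i, y, hy, ?_⟩
    have hri := (hr i).1
    have hm : μ (closedBall (f i y) d) =
        ENNReal.ofReal (rr i ^ s) * μ (closedBall y (d / rr i)) := by
      rw [hμss _ isClosed_closedBall.measurableSet, Finset.sum_eq_single i]
      · congr 2
        ext z
        rw [mem_preimage, mem_closedBall, mem_closedBall, hsim, le_div_iff₀ hri, mul_comm]
      · intro j _ hji
        have : μ (f j ⁻¹' closedBall (f i y) d) = 0 := by
          refine measure_mono_null (t := Eᶜ) ?_ hμE
          intro z hz
          rw [mem_compl_iff]
          intro hzE
          have h1 := hcle j i hji z hzE y hy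
          have h2 : dist (f j z) (f i y) ≤ d := hz
          linarith
        rw [this, mul_zero]
      · intro h; exact absurd (Finset.mem_univ i) h
    have hrs := Real.rpow_pos_of_pos hri s
    have hn : (2 * d) ^ s = rr i ^ s * (2 * (d / rr i)) ^ s := by
      rw [← Real.mul_rpow hri.le (by positivity)]
      congr 1
      field_simp
    unfold densityh
    rw [hm, hn, ENNReal.ofReal_mul hrs.le, ENNReal.mul_div_mul_left _ _
      (ENNReal.ofReal_pos.2 hrs).ne' ENNReal.ofReal_ne_top]
  have hiter : ∀ k : ℕ, ∀ x ∈ E, ∀ d : ℝ, 0 < d → d ≤ a → a * rmin * ρ ^ k ≤ d →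
      ∃ y ∈ E, ∃ d' : ℝ, a * rmin ≤ d' ∧ d' ≤ a ∧ densityh μ s x d = densityh μ s y d' := by
    intro k
    induction k with
    | zero =>
      intro x hx d _ hda hk
      exact ⟨x, hx, d, by simpa using hk, hda, rfl⟩
    | succ k ih =>
      intro x hx d hd hda hk
      by_cases hlt : d < a * rmin
      · obtain ⟨i, y, hy, e⟩ := hred x hx d hd hlt
        have hri := (hr i).1
        have h1 : d / rr i ≤ a := by
          rw [div_le_iff₀ hri]
          nlinarith [hrml i]
        have h2 : a * rmin * ρ ^ k ≤ d / rr i := by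
          rw [le_div_iff₀ hri]
          refine le_trans ?_ hk
          rw [pow_succ, ← mul_assoc]
          exact mul_le_mul_of_nonneg_left (hi₀ i) (by positivity)
        obtain ⟨z, hz, d', h3, h4, h5⟩ := ih y hy _ (by positivity) h1 h2
        exact ⟨z, hz, d', h3, h4, e.trans h5⟩
      · exact ⟨x, hx, d, not_lt.1 hlt, hda, rfl⟩
  constructor
  · congr 1
    ext v
    constructor
    · rintro ⟨x, hx, d, hd, hda, rfl⟩
      obtain ⟨k, hk⟩ := exists_pow_lt_of_lt_one (show 0 < d / (a * rmin) by positivity) hρ1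
      rw [lt_div_iff₀ (by positivity), mul_comm] at hk
      exact hiter k x hx d hd hda hk.le
    · rintro ⟨x, hx, d, hd, hda, rfl⟩
      exact ⟨x, hx, d, lt_of_lt_of_le (by positivity) hd, hda, rfl⟩
  · have hcont : ContinuousOn (fun z : EuclideanSpace ℝ (Fin n) × ℝ => densityh μ s z.1 z.2)
        (E ×ˢ Icc (a * rmin) a) := by
      rintro ⟨x, d⟩ ⟨hx, hd⟩
      have hd0 : 0 < d := lt_of_lt_of_le (by positivity) hd.1
      apply ContinuousAt.continuousWithinAt
      unfold densityh
      refine ENNReal.Tendsto.div ?_ (Or.inl ?_) ?_ (Or.inr ENNReal.ofReal_ne_top)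
      · refine (ENNReal.continuous_ofReal.tendsto _).comp ?_
        exact (Continuous.rpow_const (by fun_prop) (fun _ => Or.inr hs.le)).tendsto
          ((x, d) : EuclideanSpace ℝ (Fin n) × ℝ)
      · exact (ENNReal.ofReal_pos.2 (Real.rpow_pos_of_pos (by simpa using hd0) s)).ne'
      · refine tendsto_measure_of_ae_tendsto_indicator_of_isFiniteMeasure _
          isClosed_closedBall.measurableSet (fun _ => isClosed_closedBall.measurableSet) ?_
        have hnot : ∀ᵐ y ∂μ, y ∉ sphere x d := measure_eq_zero_iff_ae_notMem.1 (hsph x hx d hd0)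
        filter_upwards [hnot] with y hy
        have c1 : Continuous fun z : EuclideanSpace ℝ (Fin n) × ℝ => dist y z.1 := by fun_prop
        have c2 : Continuous fun z : EuclideanSpace ℝ (Fin n) × ℝ => z.2 := continuous_snd
        rcases lt_or_gt_of_ne (show dist y x ≠ d from hy) with h | h
        · filter_upwards [(isOpen_lt c1 c2).mem_nhds (show (x, d) ∈ _ from h)] with z hz
          exact ⟨fun _ => mem_closedBall.2 h.le, fun _ => mem_closedBall.2 (le_of_lt hz)⟩
        · filter_upwards [(isOpen_lt c2 c1).mem_nhds (show (x, d) ∈ _ from h)] with z hz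
          exact ⟨fun h' => absurd (mem_closedBall.1 h') (not_le.2 hz),
            fun h' => absurd (mem_closedBall.1 h') (not_le.2 h)⟩
    have hne : (E ×ˢ Icc (a * rmin) a).Nonempty :=
      hEne.prod (nonempty_Icc.2 (by nlinarith))
    obtain ⟨⟨x, d⟩, ⟨hx, hd⟩, hmax⟩ := (hEcp.prod isCompact_Icc).exists_isMaxOn hne hcont
    have hg : IsGreatest {v : ℝ≥0∞ | ∃ x ∈ E, ∃ d : ℝ, a * rmin ≤ d ∧ d ≤ a ∧
        v = densityh μ s x d} (densityh μ s x d) := by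
      refine ⟨⟨x, hx, d, hd.1, hd.2, rfl⟩, ?_⟩
      rintro _ ⟨x', hx', d', h1, h2, rfl⟩
      exact hmax (show ((x', d') : EuclideanSpace ℝ (Fin n) × ℝ) ∈ E ×ˢ Icc (a * rmin) a from
        ⟨hx', h1, h2⟩)
    rw [hg.isLUB.sSup_eq]
    exact hg
end
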